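/- There exist constants c > 0 and C > 0 such that for all integers m ≥ 1 and all real y ≥ 3, R(y; m) := (1/ψ(m)) ∑_{δ ≤ y^{3/4}, gcd(δ, m) = 1} (δ/ψ(δ)²) (∑_{d ≤ y/δ} μ(dδ)/ψ_m(d))² satisfies R(y; m) ≤ C/(√ψ(m) · 𝓛(y)^c). -/

import Mathlib

open Finset MeasureTheory Filter

/-- `M(n, z) := ∑_{d ∣ n, d ≤ z} μ(d)`. -/
noncomputable def mobM (n : ℕ) (z : ℝ) : ℤ :=
  ∑ d ∈ n.divisors.filter (fun d : ℕ => (d : ℝ) ≤ z), ArithmeticFunction.moebius d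

/-- `S(x, z) := ∑_{n ≤ x} M(n, z)²`. -/
noncomputable def Ssum (x z : ℝ) : ℝ :=
  ∑ n ∈ Finset.Icc 1 ⌊x⌋₊, ((mobM n z : ℝ)) ^ 2

/-- `S(z) := ∑_{m, n ≤ z} μ(m) μ(n) / [m, n]`. -/
noncomputable def Sz (z : ℝ) : ℝ :=
  ∑ m ∈ Finset.Icc 1 ⌊z⌋₊, ∑ n ∈ Finset.Icc 1 ⌊z⌋₊,
    ((ArithmeticFunction.moebius m : ℝ) * (ArithmeticFunction.moebius n : ℝ)) / (Nat.lcm m n : ℝ)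

/-- `f(n; iτ) := ∏_{p ∣ n} |1 - p^{-iτ}|²`. -/
noncomputable def fI (n : ℕ) (τ : ℝ) : ℝ :=
  ∏ p ∈ n.primeFactors, ‖(1 : ℂ) - (p : ℂ) ^ (-(τ * Complex.I))‖ ^ 2

/-- `f(n; s) := ∏_{p ∣ n} |1 - p^{-s}|²` for complex `s`. -/
noncomputable def fC (n : ℕ) (s : ℂ) : ℝ :=
  ∏ p ∈ n.primeFactors, ‖(1 : ℂ) - (p : ℂ) ^ (-s)‖ ^ 2

/-- The constant `L`. -/
noncomputable def Lconst : ℝ :=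
  (1 / (2 * Real.pi)) *
    ∫ τ : ℝ,
      (∏' p : Nat.Primes,
        (1 - 1 / ((p : ℕ) : ℝ)) * (1 + (fI (p : ℕ) τ - 1) / ((p : ℕ) : ℝ))) / τ ^ 2

/-- `𝓛(y) := exp{(log y)^{3/5} / (log log y)^{1/5}}`. -/
noncomputable def curlyL (y : ℝ) : ℝ :=
  Real.exp ((Real.log y) ^ ((3 : ℝ) / 5) / (Real.log (Real.log y)) ^ ((1 : ℝ) / 5))

/-- `ψ(n) := ∏_{p ∣ n} (p + 1)`. -/
def psi (n : ℕ) : ℕ := ∏ p ∈ n.primeFactors, (p + 1)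

/-- `ψ_m(n) := ∏_{p ∣ n, p ∤ m} (p + 1)`. -/
def psiM (m n : ℕ) : ℕ := ∏ p ∈ n.primeFactors.filter (fun p : ℕ => ¬ p ∣ m), (p + 1)

/-- `r(n) := ∏_{p ∣ n} (1 + 2/√p)`. -/
noncomputable def rfun (n : ℕ) : ℝ := ∏ p ∈ n.primeFactors, (1 + 2 / Real.sqrt p)

/-- `k(n)`, the squarefree kernel of `n`. -/
def ker (n : ℕ) : ℕ := ∏ p ∈ n.primeFactors, p

/-- `T(y; m) := (6/π²) ∑_{d, t ≤ y} μ(d) μ(t) / ψ([d, t, m])`. -/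
noncomputable def T (y : ℝ) (m : ℕ) : ℝ :=
  (6 / Real.pi ^ 2) *
    ∑ d ∈ Finset.Icc 1 ⌊y⌋₊, ∑ t ∈ Finset.Icc 1 ⌊y⌋₊,
      ((ArithmeticFunction.moebius d : ℝ) * (ArithmeticFunction.moebius t : ℝ)) /
        (psi (Nat.lcm (Nat.lcm d t) m) : ℝ)

/-- The constant `L(m)`. -/
noncomputable def Lm (m : ℕ) : ℝ :=
  ((Nat.totient m : ℝ) ^ 2 / (2 * Real.pi * (m : ℝ) ^ 2 * (ker m : ℝ))) *
    ∫ τ : ℝ,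
      (fI m τ *
        ∏' p : {p : Nat.Primes // ¬ ((p : ℕ) ∣ m)},
          (1 - 1 / ((p.1 : ℕ) : ℝ)) ^ 2 * (1 + fI (p.1 : ℕ) τ / ((p.1 : ℕ) : ℝ))) / τ ^ 2

/-- `B := ∏_p (1 - (3p + 1)/(p (p + 1)²))`. -/
noncomputable def Bconst : ℝ :=
  ∏' p : Nat.Primes,
    (1 - (3 * ((p : ℕ) : ℝ) + 1) / (((p : ℕ) : ℝ) * (((p : ℕ) : ℝ) + 1) ^ 2))

/-- `α(n) := ∏_{p ∣ n} (1 - p/(p² + 3p + 1))`. -/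
noncomputable def alpha (n : ℕ) : ℝ :=
  ∏ p ∈ n.primeFactors, (1 - (p : ℝ) / ((p : ℝ) ^ 2 + 3 * (p : ℝ) + 1))

/-- Over a ring in which `k!` is invertible, equal power sums give equal elementary symmetric functions. -/
lemma esymm_eq_of_psum_eq {R : Type*} [CommRing R] {k : ℕ} (hk : IsUnit ((k.factorial : ℕ) : R))
    (x y : Fin k → R) (h : ∀ j, 1 ≤ j → j ≤ k → ∑ i, x i ^ j = ∑ i, y i ^ j) :
    ∀ j, j ≤ k → MvPolynomial.aeval x (MvPolynomial.esymm (Fin k) R j) =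
      MvPolynomial.aeval y (MvPolynomial.esymm (Fin k) R j) := by
  intro j
  induction j using Nat.strong_induction_on with
  | _ j ih =>
    intro hj
    rcases Nat.eq_zero_or_pos j with rfl | hj0
    · simp
    have hu : IsUnit ((j : ℕ) : R) := by
      have : ((j : ℕ) : R) ∣ ((k.factorial : ℕ) : R) := by
        exact_mod_cast Nat.cast_dvd_cast (α := R) (Nat.dvd_factorial hj0 hj)
      exact isUnit_of_dvd_unit this hk
    have e := MvPolynomial.mul_esymm_eq_sum (Fin k) R j
    have ex := congrArg (MvPolynomial.aeval x) e
    have ey := congrArg (MvPolynomial.aeval y) e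
    simp only [map_mul, map_natCast, map_sum, map_pow, map_neg, map_one] at ex ey
    apply hu.mul_left_cancel
    rw [ex, ey]
    congr 1
    apply Finset.sum_congr rfl
    rintro ⟨a, b⟩ hab
    simp only [mem_filter, HasAntidiagonal.mem_antidiagonal] at hab
    rw [ih a (by omega) (by omega)]
    congr 1
    simp only [MvPolynomial.psum, map_sum, map_pow, MvPolynomial.aeval_X]
    exact h b (by omega) (by omega)

lemma prod_sub_eq_zero_of_psum_eq {R : Type*} [CommRing R] {k : ℕ}
    (hk : IsUnit ((k.factorial : ℕ) : R))
    (x y : Fin k → R) (h : ∀ j, 1 ≤ j → j ≤ k → ∑ i, x i ^ j = ∑ i, y i ^ j) (i : Fin k) :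
    ∏ l, (y i - x l) = 0 := by
  have key : ∀ z : Fin k → R, (∏ l, (Polynomial.X - Polynomial.C (z l))) =
      ∑ j ∈ range (k + 1), (-1) ^ j * (Polynomial.C
        (MvPolynomial.aeval z (MvPolynomial.esymm (Fin k) R j)) * Polynomial.X ^ (k - j)) := by
    intro z
    have := Multiset.prod_X_sub_X_eq_sum_esymm (Multiset.map z univ.val)
    simp only [Multiset.map_map, Multiset.card_map, card_val, card_univ, Fintype.card_fin] at this
    simp only [MvPolynomial.aeval_esymm_eq_multiset_esymm]
    exact this
  have hxy : (∏ l, (Polynomial.X - Polynomial.C (x l))) = ∏ l, (Polynomial.X - Polynomial.C (y l)) := by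
    rw [key x, key y]
    refine sum_congr rfl fun j hj => ?_
    rw [esymm_eq_of_psum_eq hk x y h j (by simpa [Nat.lt_succ_iff] using hj)]
  have := congrArg (Polynomial.eval (y i)) hxy
  simp only [Polynomial.eval_prod, Polynomial.eval_sub, Polynomial.eval_X, Polynomial.eval_C] at this
  rw [this]
  exact prod_eq_zero (mem_univ i) (sub_self _)

lemma exists_perm_of_psum_eq {R : Type*} [CommRing R] [IsLocalRing R] {k : ℕ}
    (hk : IsUnit ((k.factorial : ℕ) : R)) (x y : Fin k → R)
    (hx : ∀ i j, i ≠ j → IsUnit (x i - x j)) (hy : ∀ i j, i ≠ j → IsUnit (y i - y j))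
    (h : ∀ j, 1 ≤ j → j ≤ k → ∑ i, x i ^ j = ∑ i, y i ^ j) :
    ∃ σ : Equiv.Perm (Fin k), y = x ∘ σ := by
  have hex : ∀ i, ∃ l, y i = x l := by
    intro i
    have h0 := prod_sub_eq_zero_of_psum_eq hk x y h i
    have : ∃ l, ¬ IsUnit (y i - x l) := by
      by_contra hcon
      push Not at hcon
      have : IsUnit (∏ l, (y i - x l)) := by
        rw [IsUnit.prod_univ_iff]; exact hcon
      rw [h0] at this
      exact not_isUnit_zero this
    obtain ⟨l, hl⟩ := this
    refine ⟨l, ?_⟩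
    rw [← mul_prod_erase univ _ (mem_univ l)] at h0
    have hu : IsUnit (∏ l' ∈ univ.erase l, (y i - x l')) := by
      rw [IsUnit.prod_iff]
      intro l' hl'
      by_contra hcon
      have hne : l' ≠ l := (mem_erase.mp hl').1
      have h1 := hx l' l hne
      have : x l' - x l = (y i - x l) + -(y i - x l') := by ring
      rw [this] at h1
      exact IsLocalRing.nonunits_add hl (by rw [mem_nonunits_iff, IsUnit.neg_iff]; exact hcon) h1
    have := hu.mul_left_eq_zero.mp h0
    exact sub_eq_zero.mp this
  choose τ hτ using hex
  have inj : Function.Injective τ := by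
    intro i j hij
    by_contra hne
    have := hy i j hne
    rw [hτ i, hτ j, hij, sub_self] at this
    exact not_isUnit_zero this
  refine ⟨Equiv.ofBijective τ (Finite.injective_iff_bijective.mp inj), ?_⟩
  ext i; simp [hτ i]

lemma isUnit_intCast_zmod_prime_pow {p k : ℕ} (hp : p.Prime) {z : ℤ} (hz : ¬ (p : ℤ) ∣ z) :
    IsUnit ((z : ℤ) : ZMod (p ^ k)) := by
  rw [ZMod.coe_int_isUnit_iff_isCoprime]
  push_cast
  exact ((Prime.coprime_iff_not_dvd (Nat.prime_iff_prime_int.mp hp)).mpr hz).pow_left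

lemma dvd_of_not_isUnit_zmod_prime_pow {p k : ℕ} (hp : p.Prime) (hk : 0 < k) (z : ℤ) :
    ¬ IsUnit ((z : ℤ) : ZMod (p ^ k)) ↔ (p : ℤ) ∣ z := by
  constructor
  · intro h; by_contra h2; exact h (isUnit_intCast_zmod_prime_pow hp h2)
  · intro h hu
    rw [ZMod.coe_int_isUnit_iff_isCoprime] at hu
    push_cast at hu
    have := (IsCoprime.pow_left_iff hk).mp hu
    exact ((Prime.coprime_iff_not_dvd (Nat.prime_iff_prime_int.mp hp)).mp this) h

lemma isLocalRing_zmod_prime_pow {p k : ℕ} (hp : p.Prime) (hk : 0 < k) :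
    IsLocalRing (ZMod (p ^ k)) := by
  have : Nontrivial (ZMod (p ^ k)) :=
    ZMod.nontrivial_iff.mpr (Nat.one_lt_pow hk.ne' hp.one_lt).ne'
  refine IsLocalRing.of_nonunits_add fun a b ha hb => ?_
  obtain ⟨a, rfl⟩ := ZMod.intCast_surjective a
  obtain ⟨b, rfl⟩ := ZMod.intCast_surjective b
  rw [mem_nonunits_iff, dvd_of_not_isUnit_zmod_prime_pow hp hk] at ha hb
  rw [mem_nonunits_iff, ← Int.cast_add, dvd_of_not_isUnit_zmod_prime_pow hp hk]
  exact dvd_add ha hb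

/-- Linnik's lemma: the number of solutions of a system of congruences
`∑ xᵢ ^ j ≡ lⱼ (mod p ^ j)` in integers that are pairwise incongruent modulo `p`. -/
lemma card_le_of_psum_congruences {p k : ℕ} (hp : p.Prime) (hk : 0 < k) (hkp : k < p)
    (S : Finset (Fin k → ℤ)) (l : Fin k → ℤ)
    (hinj : ∀ x ∈ S, ∀ x' ∈ S, (∀ i, (x i : ZMod (p ^ k)) = x' i) → x = x')
    (hdist : ∀ x ∈ S, ∀ i j, i ≠ j → ¬ (p : ℤ) ∣ x i - x j)
    (hcong : ∀ x ∈ S, ∀ j : Fin k, (p : ℤ) ^ (j.1 + 1) ∣ ∑ i, x i ^ (j.1 + 1) - l j) :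
    S.card ≤ k.factorial * p ^ (k * (k - 1) / 2) := by
  classical
  have := isLocalRing_zmod_prime_pow hp hk
  have : NeZero (p ^ k) := ⟨(pow_pos hp.pos k).ne'⟩
  let g : (Fin k → ℤ) → (Fin k → ZMod (p ^ k)) :=
    fun x j => ∑ i, ((x i : ℤ) : ZMod (p ^ k)) ^ (j.1 + 1)
  have hfib : ∀ b ∈ image g S, #{a ∈ S | g a = b} ≤ k.factorial := by
    intro b hb
    obtain ⟨x, hx, rfl⟩ := mem_image.mp hb
    have : #{a ∈ S | g a = g x} ≤ #(univ : Finset (Equiv.Perm (Fin k))) := by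
      have hperm : ∀ a ∈ ({a ∈ S | g a = g x} : Finset _), ∃ σ : Equiv.Perm (Fin k),
          (fun i => ((a i : ℤ) : ZMod (p ^ k))) = (fun i => ((x i : ℤ) : ZMod (p ^ k))) ∘ σ := by
        intro a ha
        rw [mem_filter] at ha
        apply exists_perm_of_psum_eq
        · have := isUnit_intCast_zmod_prime_pow (p := p) (k := k) hp (z := (k.factorial : ℤ)) (by
            rw [Int.natCast_dvd_natCast, hp.dvd_factorial]; omega)
          simpa using this
        · intro i j hij
          have := isUnit_intCast_zmod_prime_pow (p := p) (k := k) hp (hdist x hx i j hij)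
          simpa using this
        · intro i j hij
          have := isUnit_intCast_zmod_prime_pow (p := p) (k := k) hp (hdist a ha.1 i j hij)
          simpa using this
        · intro j hj1 hjk
          have := congrFun ha.2 ⟨j - 1, by omega⟩
          simp only [g, Nat.sub_add_cancel hj1] at this
          exact this.symm
      choose! F hF using hperm
      apply card_le_card_of_injOn F (fun _ _ => mem_coe.mpr (mem_univ _))
      intro a ha a' ha' haa
      have h1 := hF a ha
      have h2 := hF a' ha'
      rw [mem_coe, mem_filter] at ha ha'
      apply hinj a ha.1 a' ha'.1
      intro i
      rw [haa, ← h2] at h1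
      exact congrFun h1 i
    rwa [card_univ, Fintype.card_perm, Fintype.card_fin] at this
  have himg : #(image g S) ≤ p ^ (k * (k - 1) / 2) := by
    let Tj : Fin k → Finset (ZMod (p ^ k)) := fun j =>
      image (fun u : ℕ => ((l j + (p : ℤ) ^ (j.1 + 1) * u : ℤ) : ZMod (p ^ k)))
        (range (p ^ (k - 1 - j.1)))
    have hsub : image g S ⊆ Fintype.piFinset Tj := by
      intro b hb
      obtain ⟨x, hx, rfl⟩ := mem_image.mp hb
      rw [Fintype.mem_piFinset]
      intro j
      obtain ⟨c, hc⟩ := hcong x hx j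
      rw [mem_image]
      have hpos : (0 : ℤ) < (p : ℤ) ^ (k - 1 - j.1) := pow_pos (by exact_mod_cast hp.pos) _
      refine ⟨(c % (p : ℤ) ^ (k - 1 - j.1)).toNat, ?_, ?_⟩
      · rw [mem_range, Int.toNat_lt (Int.emod_nonneg _ hpos.ne')]
        push_cast
        exact Int.emod_lt_of_pos _ hpos
      · have e : g x j = ((∑ i, x i ^ (j.1 + 1) : ℤ) : ZMod (p ^ k)) := by simp [g]
        rw [e, ZMod.intCast_eq_intCast_iff_dvd_sub, Int.toNat_of_nonneg (Int.emod_nonneg _ hpos.ne')]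
        have e2 : ∑ i, x i ^ (j.1 + 1) = l j + (p : ℤ) ^ (j.1 + 1) * c := by rw [← hc]; ring
        have e3 := Int.emod_add_mul_ediv c ((p : ℤ) ^ (k - 1 - j.1))
        refine ⟨c / (p : ℤ) ^ (k - 1 - j.1), ?_⟩
        have e4 : (p : ℤ) ^ k = (p : ℤ) ^ (j.1 + 1) * (p : ℤ) ^ (k - 1 - j.1) := by
          rw [← pow_add]; congr 1; have := j.2; omega
        rw [e2]
        push_cast
        rw [e4]
        linear_combination (p : ℤ) ^ (j.1 + 1) * (- e3)
    refine (card_le_card hsub).trans ?_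
    rw [Fintype.card_piFinset]
    calc ∏ j, #(Tj j) ≤ ∏ j : Fin k, p ^ (k - 1 - j.1) :=
          prod_le_prod' fun j _ => card_image_le.trans (by simp)
      _ = p ^ (k * (k - 1) / 2) := by
          rw [prod_pow_eq_pow_sum, Fin.sum_univ_eq_sum_range (fun j => k - 1 - j),
            sum_range_reflect (fun j => j), sum_range_id]
  exact (card_le_mul_card_image S _ hfib).trans (Nat.mul_le_mul_left _ himg)

/-- The number of coincidences `v x = v y` with `x, y ∈ D`. -/
noncomputable def energy {τ V : Type*} [DecidableEq V] (D : Finset τ) (v : τ → V) : ℕ :=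
  #{q ∈ D ×ˢ D | v q.1 = v q.2}

lemma energy_le_of_injOn {τ τ' V V' : Type*} [DecidableEq V] [DecidableEq V'] {D : Finset τ}
    {D' : Finset τ'} {v : τ → V} {v' : τ' → V'} (φ : τ → τ') (hφ : ∀ x ∈ D, φ x ∈ D')
    (hinj : ∀ x ∈ D, ∀ y ∈ D, φ x = φ y → x = y)
    (hv : ∀ x ∈ D, ∀ y ∈ D, v x = v y → v' (φ x) = v' (φ y)) :
    energy D v ≤ energy D' v' := by
  unfold energy
  apply card_le_card_of_injOn (fun q => (φ q.1, φ q.2))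
  · rintro ⟨x, y⟩ h
    simp only [coe_filter, mem_product, Set.mem_ofPred_eq] at h ⊢
    exact ⟨⟨hφ x h.1.1, hφ y h.1.2⟩, hv x h.1.1 y h.1.2 h.2⟩
  · rintro ⟨x, y⟩ h ⟨x', y'⟩ h' e
    simp only [coe_filter, mem_product, Set.mem_ofPred_eq, Prod.mk.injEq] at h h' e ⊢
    exact ⟨hinj x h.1.1 x' h'.1.1 e.1, hinj y h.1.2 y' h'.1.2 e.2⟩

/-- A finite family of unitary characters of `ℤ ^ k` that is orthogonal on a finite set. -/
structure OrthoFamily {k : ℕ} (U : Finset (Fin k → ℤ)) (Ω : Finset (AddChar (Fin k → ℤ) ℂ)) :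
    Prop where
  nonempty : Ω.Nonempty
  norm_one : ∀ ψ ∈ Ω, ∀ u, ‖ψ u‖ = 1
  sum_eq : ∀ u ∈ U, ∑ ψ ∈ Ω, ψ u = if u = 0 then (#Ω : ℂ) else 0

lemma exists_orthoFamily {k : ℕ} (U : Finset (Fin k → ℤ)) :
    ∃ Ω : Finset (AddChar (Fin k → ℤ) ℂ), OrthoFamily U Ω := by
  classical
  obtain ⟨M, hM0, hM⟩ : ∃ M : ℕ, 0 < M ∧ ∀ u ∈ U, ∀ j, (u j).natAbs < M := by
    refine ⟨(U.sup fun u => univ.sup fun j => (u j).natAbs) + 1, Nat.succ_pos _, fun u hu j => ?_⟩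
    have h1 : (u j).natAbs ≤ univ.sup fun j => (u j).natAbs :=
      le_sup (f := fun j => (u j).natAbs) (mem_univ j)
    have h2 := le_sup (f := fun u : Fin k → ℤ => univ.sup fun j => (u j).natAbs) hu
    omega
  have : NeZero M := ⟨hM0.ne'⟩
  let red : (Fin k → ℤ) →+ (Fin k → ZMod M) :=
    { toFun := fun u j => (u j : ZMod M)
      map_zero' := by ext; simp
      map_add' := by intro x y; ext; simp }
  have hsurj : Function.Surjective red := by
    intro y
    choose x hx using fun j => ZMod.intCast_surjective (y j)
    exact ⟨x, funext hx⟩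
  let Φ : AddChar (Fin k → ZMod M) ℂ → AddChar (Fin k → ℤ) ℂ := fun ψ => ψ.compAddMonoidHom red
  have hΦ : Function.Injective Φ := by
    intro a b hab
    ext y
    obtain ⟨x, rfl⟩ := hsurj y
    exact DFunLike.congr_fun hab x
  refine ⟨univ.image Φ, ⟨by simp, ?_, ?_⟩⟩
  · intro ψ hψ u
    obtain ⟨a, -, rfl⟩ := mem_image.mp hψ
    exact AddChar.norm_apply a _
  · intro u hu
    rw [sum_image (fun a _ b _ h => hΦ h), card_image_of_injective _ hΦ]
    have h1 : ∑ ψ, Φ ψ u = ∑ ψ : AddChar (Fin k → ZMod M) ℂ, ψ (red u) := rfl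
    rw [h1, AddChar.sum_apply_eq_ite, card_univ, AddChar.card_eq]
    have h2 : red u = 0 ↔ u = 0 := by
      constructor
      · intro h
        ext j
        have := congrFun h j
        simp only [red, AddMonoidHom.coe_mk, ZeroHom.coe_mk, Pi.zero_apply] at this
        rw [ZMod.intCast_zmod_eq_zero_iff_dvd] at this
        exact Int.eq_zero_of_dvd_of_natAbs_lt_natAbs this (by simpa using hM u hu j)
      · rintro rfl; simp
    simp only [h2]

lemma OrthoFamily.energy_mul_card {k : ℕ} {U : Finset (Fin k → ℤ)}
    {Ω : Finset (AddChar (Fin k → ℤ) ℂ)} (hΩ : OrthoFamily U Ω) {τ : Type*} (D : Finset τ)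
    (v : τ → Fin k → ℤ) (hU : ∀ x ∈ D, ∀ y ∈ D, v x - v y ∈ U) :
    (energy D v : ℝ) * #Ω = ∑ ψ ∈ Ω, ‖∑ x ∈ D, ψ (v x)‖ ^ 2 := by
  have key : ∀ ψ ∈ Ω, ((‖∑ x ∈ D, ψ (v x)‖ ^ 2 : ℝ) : ℂ) =
      ∑ q ∈ D ×ˢ D, ψ (v q.1 - v q.2) := by
    intro ψ hψ
    rw [Complex.ofReal_pow, ← Complex.mul_conj', map_sum, sum_mul_sum, sum_product]
    refine sum_congr rfl fun x _ => sum_congr rfl fun y _ => ?_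
    rw [sub_eq_add_neg, AddChar.map_add_eq_mul, AddChar.map_neg_eq_inv,
      Complex.inv_eq_conj (hΩ.norm_one ψ hψ _)]
  have : ((∑ ψ ∈ Ω, ‖∑ x ∈ D, ψ (v x)‖ ^ 2 : ℝ) : ℂ) = ((energy D v : ℝ) * #Ω : ℝ) := by
    rw [Complex.ofReal_sum, sum_congr rfl key, sum_comm]
    have h2 : ∀ q ∈ D ×ˢ D, ∑ ψ ∈ Ω, ψ (v q.1 - v q.2) =
        if v q.1 = v q.2 then (#Ω : ℂ) else 0 := by
      intro q hq
      rw [mem_product] at hq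
      rw [hΩ.sum_eq _ (hU _ hq.1 _ hq.2)]
      simp only [sub_eq_zero]
    rw [sum_congr rfl h2, ← sum_filter, sum_const, nsmul_eq_mul]
    simp [energy]
  exact_mod_cast this.symm

lemma card_sub_eq_le_energy {k : ℕ} {τ : Type*} (D : Finset τ) (v : τ → Fin k → ℤ)
    (h : Fin k → ℤ) : #{q ∈ D ×ˢ D | v q.1 - v q.2 = h} ≤ energy D v := by
  classical
  set U : Finset (Fin k → ℤ) := (D ×ˢ D).image (fun q => v q.1 - v q.2) ∪
    (D ×ˢ D).image (fun q => v q.1 - v q.2 - h) with hU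
  obtain ⟨Ω, hΩ⟩ := exists_orthoFamily U
  have h1 := hΩ.energy_mul_card D v (fun x hx y hy => mem_union_left _
    (mem_image.mpr ⟨(x, y), mem_product.mpr ⟨hx, hy⟩, rfl⟩))
  have h2 : (∑ ψ ∈ Ω, ψ (-h) * ((‖∑ x ∈ D, ψ (v x)‖ ^ 2 : ℝ) : ℂ)) =
      (#{q ∈ D ×ˢ D | v q.1 - v q.2 = h} : ℂ) * #Ω := by
    have key : ∀ ψ ∈ Ω, ψ (-h) * ((‖∑ x ∈ D, ψ (v x)‖ ^ 2 : ℝ) : ℂ) =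
        ∑ q ∈ D ×ˢ D, ψ (v q.1 - v q.2 - h) := by
      intro ψ hψ
      rw [Complex.ofReal_pow, ← Complex.mul_conj', map_sum, sum_mul_sum, sum_product, mul_sum]
      refine sum_congr rfl fun x _ => ?_
      rw [mul_sum]
      refine sum_congr rfl fun y _ => ?_
      rw [sub_eq_add_neg, sub_eq_add_neg, AddChar.map_add_eq_mul, AddChar.map_add_eq_mul,
        AddChar.map_neg_eq_inv ψ (v y), Complex.inv_eq_conj (hΩ.norm_one ψ hψ _)]
      ring
    rw [sum_congr rfl key, sum_comm]
    have h2 : ∀ q ∈ D ×ˢ D, ∑ ψ ∈ Ω, ψ (v q.1 - v q.2 - h) =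
        if v q.1 - v q.2 = h then (#Ω : ℂ) else 0 := by
      intro q hq
      rw [hΩ.sum_eq _ (mem_union_right _ (mem_image.mpr ⟨q, hq, rfl⟩))]
      simp only [sub_eq_zero]
    rw [sum_congr rfl h2, ← sum_filter, sum_const, nsmul_eq_mul]
  have h3 : (#{q ∈ D ×ˢ D | v q.1 - v q.2 = h} : ℝ) * #Ω ≤ (energy D v : ℝ) * #Ω := by
    rw [h1]
    have : ‖(#{q ∈ D ×ˢ D | v q.1 - v q.2 = h} : ℂ) * #Ω‖ ≤
        ∑ ψ ∈ Ω, ‖∑ x ∈ D, ψ (v x)‖ ^ 2 := by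
      rw [← h2]
      refine (norm_sum_le _ _).trans (sum_le_sum fun ψ hψ => ?_)
      rw [norm_mul, hΩ.norm_one ψ hψ, one_mul, Complex.norm_real, Real.norm_of_nonneg (by positivity)]
    simpa using this
  have hpos : (0 : ℝ) < #Ω := by exact_mod_cast hΩ.nonempty.card_pos
  exact_mod_cast le_of_mul_le_mul_right h3 hpos

lemma energy_eq_sum_sq {τ V : Type*} [DecidableEq V] (D : Finset τ) (v : τ → V) (H : Finset V)
    (hH : ∀ x ∈ D, v x ∈ H) : energy D v = ∑ h ∈ H, #{x ∈ D | v x = h} ^ 2 := by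
  unfold energy
  rw [card_eq_sum_card_fiberwise (f := fun q => v q.1) (t := H)]
  · refine sum_congr rfl fun h _ => ?_
    rw [sq, ← card_product]
    congr 1
    ext ⟨x, y⟩
    simp only [mem_filter, mem_product]
    constructor
    · rintro ⟨⟨⟨hx, hy⟩, e⟩, e'⟩
      exact ⟨⟨hx, e'⟩, hy, e ▸ e'⟩
    · rintro ⟨⟨hx, e⟩, hy, e'⟩
      exact ⟨⟨⟨hx, hy⟩, e.trans e'.symm⟩, e⟩
  · rintro ⟨x, y⟩ hq
    simp only [coe_filter, mem_product, Set.mem_ofPred_eq] at hq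
    exact hH x hq.1.1

lemma energy_le_card_mul_sum {τ V T : Type*} [DecidableEq V] (D : Finset τ) (v : τ → V)
    (I : Finset T) (Dt : T → Finset τ) (hD : ∀ x ∈ D, ∃ t ∈ I, x ∈ Dt t) :
    energy D v ≤ #I * ∑ t ∈ I, energy (Dt t) v := by
  classical
  set H : Finset V := D.image v ∪ I.biUnion fun t => (Dt t).image v
  have h1 : ∀ t ∈ I, energy (Dt t) v = ∑ h ∈ H, #{x ∈ Dt t | v x = h} ^ 2 := fun t ht =>
    energy_eq_sum_sq _ _ _ fun x hx => mem_union_right _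
      (mem_biUnion.mpr ⟨t, ht, mem_image_of_mem _ hx⟩)
  rw [energy_eq_sum_sq D v H fun x hx => mem_union_left _ (mem_image_of_mem _ hx),
    sum_congr rfl h1, sum_comm, mul_sum]
  refine sum_le_sum fun h _ => ?_
  have h2 : #{x ∈ D | v x = h} ≤ ∑ t ∈ I, #{x ∈ Dt t | v x = h} := by
    refine le_trans (card_le_card ?_) (card_biUnion_le (s := I)
      (t := fun t => {x ∈ Dt t | v x = h}))
    intro x hx
    rw [mem_filter] at hx
    obtain ⟨t, ht, hxt⟩ := hD x hx.1
    exact mem_biUnion.mpr ⟨t, ht, mem_filter.mpr ⟨hxt, hx.2⟩⟩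
  exact (Nat.pow_le_pow_left h2 2).trans sq_sum_le_card_mul_sum_sq

/-- The vector of powers `(x, x², …, x^k)`. -/
def powVec (k : ℕ) (x : ℤ) : Fin k → ℤ := fun j => x ^ (j.1 + 1)

/-- Number of solutions of the Vinogradov system with the variables ranging over `A`. -/
noncomputable def vinE (ι : Type*) [Fintype ι] [DecidableEq ι] (k : ℕ) (A : Finset ℤ) : ℕ :=
  energy (Fintype.piFinset fun _ : ι => A) fun x => ∑ i, powVec k (x i)

lemma sum_powVec_sub_eq {ι : Type*} [Fintype ι] {k : ℕ} {x y : ι → ℤ} (a : ℤ)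
    (h : ∑ i, powVec k (x i) = ∑ i, powVec k (y i)) :
    ∑ i, powVec k (x i - a) = ∑ i, powVec k (y i - a) := by
  have h0 : ∀ m ≤ k, ∑ i, x i ^ m = ∑ i, y i ^ m := by
    intro m hm
    rcases m with _ | m
    · simp
    · have := congrFun h ⟨m, hm⟩
      simpa [powVec, Finset.sum_apply] using this
  funext j
  simp only [Finset.sum_apply, powVec, sub_eq_add_neg, add_pow]
  rw [sum_comm, sum_comm (s := (univ : Finset ι))]
  refine sum_congr rfl fun m hm => ?_
  rw [mem_range] at hm
  rw [← sum_mul, ← sum_mul, ← sum_mul, ← sum_mul, h0 m (by omega)]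

lemma vinE_residue_le {ι : Type*} [Fintype ι] [DecidableEq ι] (k X p : ℕ) (hp : 0 < p)
    (b : ZMod p) :
    vinE ι k {x ∈ Ico (0 : ℤ) X | (x : ZMod p) = b} ≤ vinE ι k (Ico (0 : ℤ) (X / p + 1 : ℕ)) := by
  have : NeZero p := ⟨hp.ne'⟩
  have hp0 : (0 : ℤ) < p := by exact_mod_cast hp
  have key : ∀ x ∈ ({x ∈ Ico (0 : ℤ) X | (x : ZMod p) = b} : Finset ℤ),
      x - b.val = p * (x / p) := by
    intro x hx
    rw [mem_filter] at hx
    have h1 : x % p = b.val := by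
      rw [← hx.2, ZMod.val_intCast]
    have := Int.mul_ediv_add_emod x p
    omega
  refine energy_le_of_injOn (fun x i => x i / p) ?_ ?_ ?_
  · intro x hx
    rw [Fintype.mem_piFinset] at hx ⊢
    intro i
    have := hx i
    rw [mem_filter, mem_Ico] at this
    rw [mem_Ico]
    refine ⟨Int.ediv_nonneg this.1.1 hp0.le, ?_⟩
    push_cast
    have : x i / (p : ℤ) ≤ (X : ℤ) / p := Int.ediv_le_ediv hp0 this.1.2.le
    omega
  · intro x hx y hy h
    rw [Fintype.mem_piFinset] at hx hy
    funext i
    have h1 := key _ (hx i)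
    have h2 := key _ (hy i)
    have h3 := congrFun h i
    beta_reduce at h3
    rw [h3] at h1
    linarith
  · intro x hx y hy h
    rw [Fintype.mem_piFinset] at hx hy
    have h1 := sum_powVec_sub_eq (b.val : ℤ) h
    funext j
    have h2 := congrFun h1 j
    simp only [Finset.sum_apply, powVec] at h2 ⊢
    simp only [fun i => key _ (hx i), fun i => key _ (hy i), mul_pow, ← mul_sum] at h2
    exact mul_left_cancel₀ (pow_ne_zero _ hp0.ne') h2

lemma sum_piFinset_addChar {ι : Type*} [Fintype ι] [DecidableEq ι] {k : ℕ}
    (ψ : AddChar (Fin k → ℤ) ℂ) (A : ι → Finset ℤ) :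
    ∑ x ∈ Fintype.piFinset A, ψ (∑ i, powVec k (x i)) = ∏ i, ∑ a ∈ A i, ψ (powVec k a) := by
  rw [prod_univ_sum]
  exact sum_congr rfl fun x _ => map_prod ψ.toMonoidHom
    (fun i => Multiplicative.ofAdd (powVec k (x i))) univ

lemma prod_comp_le_sum_pow {ι β : Type*} [Fintype ι] [Fintype β] [Nonempty β] (c : ι → β)
    (a : β → ℝ) (ha : ∀ b, 0 ≤ a b) : ∏ i, a (c i) ≤ ∑ b, a b ^ Fintype.card ι := by
  obtain ⟨b0, hb0⟩ := Finite.exists_max a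
  calc ∏ i, a (c i) ≤ ∏ _i : ι, a b0 := prod_le_prod (fun i _ => ha _) fun i _ => hb0 _
    _ = a b0 ^ Fintype.card ι := by simp
    _ ≤ _ := single_le_sum (f := fun b => a b ^ Fintype.card ι) (fun b _ => pow_nonneg (ha b) _)
        (mem_univ b0)

lemma energy_piFinset_le {ι β : Type*} [Fintype ι] [DecidableEq ι] [Fintype β] [Nonempty β]
    (k : ℕ) (c : ι → β) (B : β → Finset ℤ) :
    energy (Fintype.piFinset fun i => B (c i)) (fun x => ∑ i, powVec k (x i)) ≤
      ∑ b, vinE ι k (B b) := by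
  classical
  set v : (ι → ℤ) → Fin k → ℤ := fun x => ∑ i, powVec k (x i) with hv
  set diff : Finset (ι → ℤ) → Finset (Fin k → ℤ) := fun D => (D ×ˢ D).image fun q => v q.1 - v q.2
  have hdiff : ∀ D, ∀ x ∈ D, ∀ y ∈ D, v x - v y ∈ diff D := fun D x hx y hy =>
    mem_image.mpr ⟨(x, y), mem_product.mpr ⟨hx, hy⟩, rfl⟩
  obtain ⟨Ω, hΩ⟩ := exists_orthoFamily (diff (Fintype.piFinset fun i => B (c i)) ∪
    univ.biUnion fun b => diff (Fintype.piFinset fun _ => B b))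
  have h1 := hΩ.energy_mul_card (Fintype.piFinset fun i => B (c i)) v
    fun x hx y hy => mem_union_left _ (hdiff _ x hx y hy)
  have h2 : ∀ b, (vinE ι k (B b) : ℝ) * #Ω = _ := fun b =>
    hΩ.energy_mul_card (Fintype.piFinset fun _ => B b) v
    fun x hx y hy => mem_union_right _ (mem_biUnion.mpr ⟨b, mem_univ _, hdiff _ x hx y hy⟩)
  have hpos : (0 : ℝ) < #Ω := by exact_mod_cast hΩ.nonempty.card_pos
  have h3 : (energy (Fintype.piFinset fun i => B (c i)) v : ℝ) * #Ω ≤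
      (∑ b, (vinE ι k (B b) : ℝ)) * #Ω := by
    rw [h1, sum_mul, sum_congr rfl fun b _ => h2 b, sum_comm]
    refine sum_le_sum fun ψ _ => ?_
    simp only [hv, sum_piFinset_addChar, prod_const, norm_prod, norm_pow, ← prod_pow]
    refine (prod_comp_le_sum_pow c (fun b => ‖∑ a ∈ B b, ψ (powVec k a)‖ ^ 2)
      fun b => by positivity).trans (le_of_eq ?_)
    refine sum_congr rfl fun b _ => ?_
    rw [card_univ, ← pow_mul, ← pow_mul, mul_comm]
  exact_mod_cast le_of_mul_le_mul_right h3 hpos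

/-- The sum of power vectors over two tuples of variables. -/
def pairVec {k s : ℕ} (q : (Fin k → ℤ) × (Fin s → ℤ)) : Fin k → ℤ :=
  ∑ i, powVec k (q.1 i) + ∑ i, powVec k (q.2 i)

lemma energy_prod_le_sum {k s : ℕ} {β : Type*} [Fintype β] [Nonempty β] (G : Finset (Fin k → ℤ))
    (A : Finset ℤ) (B : β → Finset ℤ) (hB : ∀ a ∈ A, ∃ b, a ∈ B b) (hBA : ∀ b, B b ⊆ A)
    (hdisj : ∀ b b' a, a ∈ B b → a ∈ B b' → b = b') :
    Fintype.card β * energy (G ×ˢ Fintype.piFinset fun _ : Fin s => A) pairVec ≤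
      Fintype.card β ^ (2 * s) *
        ∑ b, energy (G ×ˢ Fintype.piFinset fun _ : Fin s => B b) pairVec := by
  classical
  set D := G ×ˢ Fintype.piFinset fun _ : Fin s => A with hD
  obtain ⟨Ω, hΩ⟩ := exists_orthoFamily ((D ×ˢ D).image fun q => pairVec q.1 - pairVec q.2)
  have hU : ∀ x ∈ D, ∀ y ∈ D, pairVec x - pairVec y ∈
      ((D ×ˢ D).image fun q => pairVec q.1 - pairVec q.2) := fun x hx y hy =>
    mem_image.mpr ⟨(x, y), mem_product.mpr ⟨hx, hy⟩, rfl⟩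
  have hsub : ∀ b, (G ×ˢ Fintype.piFinset fun _ : Fin s => B b) ⊆ D := fun b =>
    product_subset_product_right (Fintype.piFinset_subset _ _ fun _ => hBA b)
  have h1 := hΩ.energy_mul_card D pairVec hU
  have h2 := fun b => hΩ.energy_mul_card _ pairVec
    fun x hx y hy => hU x (hsub b hx) y (hsub b hy)
  have hF : ∀ ψ : AddChar (Fin k → ℤ) ℂ, ∀ A' : Finset ℤ,
      ∑ q ∈ G ×ˢ Fintype.piFinset (fun _ : Fin s => A'), ψ (pairVec q) =
        (∑ x ∈ G, ψ (∑ i, powVec k (x i))) * (∑ a ∈ A', ψ (powVec k a)) ^ s := by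
    intro ψ A'
    rw [sum_product]
    simp only [pairVec, AddChar.map_add_eq_mul, ← mul_sum, sum_piFinset_addChar, prod_const,
      card_univ, Fintype.card_fin, ← sum_mul]
  have hpos : (0 : ℝ) < #Ω := by exact_mod_cast hΩ.nonempty.card_pos
  have hsplit : ∀ ψ : AddChar (Fin k → ℤ) ℂ,
      ∑ a ∈ A, ψ (powVec k a) = ∑ b, ∑ a ∈ B b, ψ (powVec k a) := by
    intro ψ
    have : A = univ.biUnion B := by
      ext a
      simp only [mem_biUnion, mem_univ, true_and]
      exact ⟨hB a, fun ⟨b, hb⟩ => hBA b hb⟩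
    rw [this, sum_biUnion]
    intro b _ b' _ hbb'
    exact disjoint_left.mpr fun a ha ha' => hbb' (hdisj _ _ _ ha ha')
  have hcard : (0 : ℝ) < Fintype.card β := by exact_mod_cast Fintype.card_pos
  have hpow : ∀ a : β → ℝ, (∀ b, 0 ≤ a b) → Fintype.card β * (∑ b, a b) ^ (2 * s) ≤
      Fintype.card β ^ (2 * s) * ∑ b, a b ^ (2 * s) := by
    intro a ha
    rcases s with _ | s
    · simp
    · have := pow_sum_div_card_le_sum_pow (s := univ) (f := a) (fun b _ => ha b) (2 * s + 1)
      rw [card_univ, div_le_iff₀ (by positivity)] at this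
      calc _ ≤ Fintype.card β * ((∑ b, a b ^ (2 * (s + 1))) * (Fintype.card β : ℝ) ^ (2 * s + 1)) := by
            exact mul_le_mul_of_nonneg_left this hcard.le
        _ = _ := by ring
  have h3 : ((Fintype.card β : ℝ) * energy D pairVec) * #Ω ≤
      ((Fintype.card β : ℝ) ^ (2 * s) * ∑ b, (energy (G ×ˢ Fintype.piFinset fun _ : Fin s => B b)
        (pairVec (k := k)) : ℝ)) * #Ω := by
    rw [mul_assoc, h1, mul_assoc, sum_mul, sum_congr rfl fun b _ => h2 b, sum_comm, mul_sum, mul_sum]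
    refine sum_le_sum fun ψ _ => ?_
    simp only [hD, hF, norm_mul, norm_pow, mul_pow, ← pow_mul, ← mul_sum]
    rw [mul_left_comm, mul_left_comm ((Fintype.card β : ℝ) ^ _)]
    refine mul_le_mul_of_nonneg_left ?_ (by positivity)
    rw [mul_comm s 2]
    refine le_trans ?_ (hpow _ fun b => norm_nonneg _)
    rw [hsplit]
    gcongr
    exact norm_sum_le _ _
  exact_mod_cast le_of_mul_le_mul_right h3 hpos

/-- Tuples of elements of `[0, X)` with pairwise distinct residues modulo `p`. -/
noncomputable def distinctTuples (k X p : ℕ) : Finset (Fin k → ℤ) :=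
  {x ∈ Fintype.piFinset fun _ => Ico (0 : ℤ) X | ∀ i j, i ≠ j → (x i : ZMod p) ≠ x j}

lemma card_distinctTuples_le (k X p : ℕ) : #(distinctTuples k X p) ≤ X ^ k := by
  refine (card_filter_le _ _).trans ?_
  rw [Fintype.card_piFinset]
  simp

lemma card_congruent_tuples_le {p k X : ℕ} (hp : p.Prime) (hk : 0 < k) (hkp : k < p)
    (hX : X ≤ p ^ k) (b : ℤ) (l : Fin k → ℤ) :
    #{x ∈ distinctTuples k X p | ∀ j : Fin k,
      (p : ℤ) ^ (j.1 + 1) ∣ ∑ i, (x i - b) ^ (j.1 + 1) - l j} ≤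
        k.factorial * p ^ (k * (k - 1) / 2) := by
  classical
  set S : Finset (Fin k → ℤ) := {x ∈ distinctTuples k X p | ∀ j : Fin k,
      (p : ℤ) ^ (j.1 + 1) ∣ ∑ i, (x i - b) ^ (j.1 + 1) - l j} with hS
  have hinj : Function.Injective fun (x : Fin k → ℤ) i => x i - b := by
    intro x y h
    funext i
    have := congrFun h i
    simpa using this
  rw [← card_image_of_injective S hinj]
  have hmem : ∀ x ∈ S, (∀ i, 0 ≤ x i ∧ x i < X) ∧ (∀ i j, i ≠ j → (x i : ZMod p) ≠ x j) ∧
      ∀ j : Fin k, (p : ℤ) ^ (j.1 + 1) ∣ ∑ i, (x i - b) ^ (j.1 + 1) - l j := by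
    intro x hx
    simp only [hS, distinctTuples, mem_filter, Fintype.mem_piFinset, mem_Ico] at hx
    exact ⟨hx.1.1, hx.1.2, hx.2⟩
  refine card_le_of_psum_congruences hp hk hkp _ l ?_ ?_ ?_
  · intro _ h0 _ h0' h
    obtain ⟨x, hx, rfl⟩ := mem_image.mp h0
    obtain ⟨y, hy, rfl⟩ := mem_image.mp h0'
    funext i
    have h1 := h i
    push_cast at h1
    rw [sub_left_inj, ZMod.intCast_eq_intCast_iff_dvd_sub] at h1
    have hx0 := (hmem x hx).1 i
    have hy0 := (hmem y hy).1 i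
    have hX' : (X : ℤ) ≤ ((p ^ k : ℕ) : ℤ) := by exact_mod_cast hX
    have := Int.eq_zero_of_abs_lt_dvd h1 (by rw [abs_lt]; constructor <;> linarith)
    linarith
  · intro _ h0 i j hij hdvd
    obtain ⟨x, hx, rfl⟩ := mem_image.mp h0
    refine (hmem x hx).2.1 i j hij ?_
    rw [ZMod.intCast_eq_intCast_iff_dvd_sub, ← neg_sub, dvd_neg]
    simpa using hdvd
  · intro _ h0 j
    obtain ⟨x, hx, rfl⟩ := mem_image.mp h0
    exact (hmem x hx).2.2 j

lemma energy_distinct_le {p k s X : ℕ} (hp : p.Prime) (hk : 0 < k) (hkp : k < p)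
    (hX : X ≤ p ^ k) (b : ZMod p) :
    energy (distinctTuples k X p ×ˢ
        Fintype.piFinset fun _ : Fin s => ({x ∈ Ico (0 : ℤ) X | (x : ZMod p) = b} : Finset ℤ)) pairVec ≤
      X ^ k * (k.factorial * p ^ (k * (k - 1) / 2)) *
        vinE (Fin s) k {x ∈ Ico (0 : ℤ) X | (x : ZMod p) = b} := by
  classical
  have : NeZero p := ⟨hp.ne_zero⟩
  set G := distinctTuples k X p with hG
  set B : Finset ℤ := {x ∈ Ico (0 : ℤ) X | (x : ZMod p) = b} with hB
  set P := Fintype.piFinset fun _ : Fin s => B with hP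
  set S : (Fin k → ℤ) → Finset (Fin k → ℤ) := fun x' => {x ∈ G | ∀ j : Fin k,
    (p : ℤ) ^ (j.1 + 1) ∣ ∑ i, (x i - b.val) ^ (j.1 + 1) - ∑ i, (x' i - b.val) ^ (j.1 + 1)} with hS
  set T := G.sigma S with hT
  have hTc : #T ≤ X ^ k * (k.factorial * p ^ (k * (k - 1) / 2)) := by
    rw [hT, card_sigma]
    calc ∑ a ∈ G, #(S a) ≤ ∑ _a ∈ G, k.factorial * p ^ (k * (k - 1) / 2) :=
          sum_le_sum fun x' _ => card_congruent_tuples_le hp hk hkp hX b.val _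
      _ ≤ _ := by
          rw [sum_const, smul_eq_mul]
          exact Nat.mul_le_mul_right _ (card_distinctTuples_le k X p)
  refine le_trans ?_ (Nat.mul_le_mul_right _ hTc)
  rw [mul_comm]
  unfold energy
  refine card_le_mul_card_image_of_maps_to
    (f := fun q => (⟨q.2.1, q.1.1⟩ : Σ _ : Fin k → ℤ, Fin k → ℤ)) (t := T) ?_ _ ?_
  · rintro ⟨⟨x, z⟩, ⟨x', z'⟩⟩ hq
    simp only [mem_filter, mem_product] at hq
    obtain ⟨⟨⟨hx, hz⟩, hx', hz'⟩, he⟩ := hq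
    rw [hT, mem_sigma]
    refine ⟨hx', ?_⟩
    rw [hS, mem_filter]
    refine ⟨hx, fun j => ?_⟩
    have h1 : ∑ i, powVec k (Sum.elim x z i) = ∑ i, powVec k (Sum.elim x' z' i) := by
      simpa [Fintype.sum_sum_type, pairVec] using he
    have h2 := congrFun (sum_powVec_sub_eq (b.val : ℤ) h1) j
    simp only [Fintype.sum_sum_type, Sum.elim_inl, Sum.elim_inr, Finset.sum_apply,
      powVec] at h2
    have hdvd : ∀ z ∈ P, (p : ℤ) ^ (j.1 + 1) ∣ ∑ i, (z i - b.val) ^ (j.1 + 1) := by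
      intro z hz
      refine dvd_sum fun i _ => pow_dvd_pow_of_dvd ?_ _
      rw [hP, Fintype.mem_piFinset] at hz
      have := (mem_filter.mp (hz i)).2
      rw [← ZMod.intCast_zmod_eq_zero_iff_dvd]
      simp [this]
    have h3 : ∑ i, (x i - b.val) ^ (j.1 + 1) - ∑ i, (x' i - b.val) ^ (j.1 + 1) =
        ∑ i, (z' i - b.val) ^ (j.1 + 1) - ∑ i, (z i - b.val) ^ (j.1 + 1) := by linarith
    rw [h3]
    exact dvd_sub (hdvd _ hz') (hdvd _ hz)
  · rintro ⟨x', x⟩ _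
    refine le_trans ?_ (card_sub_eq_le_energy P (fun z => ∑ i, powVec k (z i))
      (∑ i, powVec k (x' i) - ∑ i, powVec k (x i)))
    refine card_le_card_of_injOn (fun q => (q.1.2, q.2.2)) ?_ ?_
    · rintro ⟨⟨y, z⟩, ⟨y', z'⟩⟩ hq
      simp only [coe_filter, mem_filter, mem_product, Set.mem_ofPred_eq, Sigma.mk.injEq,
        heq_eq_eq] at hq ⊢
      obtain ⟨⟨⟨⟨hx, hz⟩, hx', hz'⟩, he⟩, rfl, rfl⟩ := hq
      refine ⟨⟨hz, hz'⟩, ?_⟩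
      unfold pairVec at he
      simp only at he
      rw [sub_eq_sub_iff_add_eq_add, add_comm, he, add_comm]
    · rintro ⟨⟨y, z⟩, ⟨y', z'⟩⟩ hq ⟨⟨w, u⟩, ⟨w', u'⟩⟩ hq' h
      simp only [coe_filter, mem_filter, Set.mem_ofPred_eq, Sigma.mk.injEq,
        heq_eq_eq, Prod.mk.injEq] at hq hq' h ⊢
      exact ⟨⟨hq.2.2.trans hq'.2.2.symm, h.1⟩, hq.2.1.trans hq'.2.1.symm, h.2⟩

lemma exists_comp_injective_or_factor {ι β : Type*} [Fintype ι] [Nonempty β] (k : ℕ) (f : ι → β) :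
    (∃ I : Fin k → ι, Function.Injective fun i => f (I i)) ∨
      ∃ (e : Fin k → β) (g : ι → Fin k), ∀ i, f i = e (g i) := by
  classical
  rcases le_total k #(univ.image f) with h | h
  · left
    have h1 : Fintype.card (Fin k) ≤ Fintype.card (univ.image f) := by simpa using h
    obtain ⟨E⟩ := Function.Embedding.nonempty_of_card_le h1
    have h2 : ∀ i, ∃ j, f j = (E i : β) := fun i => by
      obtain ⟨j, -, hj⟩ := mem_image.mp (E i).2
      exact ⟨j, hj⟩
    choose I hI using h2
    refine ⟨I, fun i j hij => ?_⟩
    beta_reduce at hij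
    rw [hI, hI] at hij
    exact E.injective (Subtype.ext hij)
  · right
    have h1 : Fintype.card (univ.image f) ≤ Fintype.card (Fin k) := by simpa using h
    obtain ⟨E⟩ := Function.Embedding.nonempty_of_card_le h1
    refine ⟨Function.extend E (fun b => (b : β)) fun _ => Classical.arbitrary β,
      fun i => E ⟨f i, mem_image_of_mem f (mem_univ i)⟩, fun i => ?_⟩
    rw [E.injective.extend_apply]

lemma exists_equiv_extending {k s : ℕ} (I : Fin k → Fin (k + s)) (hI : Function.Injective I) :
    ∃ e : Fin k ⊕ Fin s ≃ Fin (k + s), ∀ i, e (Sum.inl i) = I i := by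
  classical
  have hc : Fintype.card ((Set.range I)ᶜ : Set (Fin (k + s))) = s := by
    rw [Fintype.card_compl_set, Set.card_range_of_injective hI]
    simp
  let e2 : Fin s ≃ ((Set.range I)ᶜ : Set (Fin (k + s))) := (Fintype.equivFinOfCardEq hc).symm
  exact ⟨((Equiv.ofInjective I hI).sumCongr e2).trans (Equiv.Set.sumCompl (Set.range I)),
    fun i => by simp⟩

theorem vinE_recursion {p k s X : ℕ} (hp : p.Prime) (hk : 0 < k) (hkp : k < p) (hX : X ≤ p ^ k) :
    vinE (Fin (k + s)) k (Ico (0 : ℤ) X) ≤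
      2 * (k + s) ^ (2 * k) * p ^ (2 * s) * X ^ k * (k.factorial * p ^ (k * (k - 1) / 2)) *
        vinE (Fin s) k (Ico (0 : ℤ) (X / p + 1 : ℕ)) +
      2 * (p ^ k * k ^ (k + s)) ^ 2 * p * vinE (Fin (k + s)) k (Ico (0 : ℤ) (X / p + 1 : ℕ)) := by
  classical
  have : NeZero p := ⟨hp.ne_zero⟩
  set A := Ico (0 : ℤ) X with hA
  set B : ZMod p → Finset ℤ := fun b => {x ∈ A | (x : ZMod p) = b} with hB
  set D := Fintype.piFinset fun _ : Fin (k + s) => A with hD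
  set v : (Fin (k + s) → ℤ) → Fin k → ℤ := fun x => ∑ i, powVec k (x i) with hv
  set L := k.factorial * p ^ (k * (k - 1) / 2) with hL
  set J1 := vinE (Fin s) k (Ico (0 : ℤ) (X / p + 1 : ℕ)) with hJ1
  set J2 := vinE (Fin (k + s)) k (Ico (0 : ℤ) (X / p + 1 : ℕ)) with hJ2
  let D1 : (Fin k → Fin (k + s)) → Finset (Fin (k + s) → ℤ) := fun I =>
    {x ∈ D | Function.Injective fun i => (x (I i) : ZMod p)}
  let D2 : (Fin k → ZMod p) × (Fin (k + s) → Fin k) → Finset (Fin (k + s) → ℤ) := fun t =>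
    Fintype.piFinset fun i => B (t.1 (t.2 i))
  have hstd : energy (distinctTuples k X p ×ˢ Fintype.piFinset fun _ : Fin s => A) pairVec ≤
      p ^ (2 * s) * (X ^ k * L * J1) := by
    have h1 := energy_prod_le_sum (s := s) (distinctTuples k X p) A B
      (fun a ha => ⟨(a : ZMod p), by simp [hB, ha]⟩) (fun b => filter_subset _ _)
      (fun b b' a h h' => by
        rw [hB, mem_filter] at h h'
        exact h.2.symm.trans h'.2)
    rw [ZMod.card] at h1
    have h2 : ∑ b, energy (distinctTuples k X p ×ˢ Fintype.piFinset fun _ : Fin s => B b)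
        pairVec ≤ p * (X ^ k * L * J1) := by
      calc _ ≤ ∑ _b : ZMod p, X ^ k * L * J1 := by
            refine sum_le_sum fun b _ => ?_
            exact (energy_distinct_le hp hk hkp hX b).trans
              (Nat.mul_le_mul_left _ (vinE_residue_le k X p hp.pos b))
        _ = _ := by rw [sum_const, card_univ, ZMod.card, smul_eq_mul]
    refine Nat.le_of_mul_le_mul_left ?_ hp.pos
    calc _ ≤ _ := h1
      _ ≤ p ^ (2 * s) * (p * (X ^ k * L * J1)) := Nat.mul_le_mul_left _ h2
      _ = _ := by ring
  have hD1 : ∀ I, energy (D1 I) v ≤ p ^ (2 * s) * (X ^ k * L * J1) := by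
    intro I
    by_cases hI : Function.Injective I
    · obtain ⟨e, he⟩ := exists_equiv_extending I hI
      refine le_trans ?_ hstd
      refine energy_le_of_injOn
        (fun x => (fun i => x (e (Sum.inl i)), fun i => x (e (Sum.inr i)))) ?_ ?_ ?_
      · intro x hx
        simp only [D1, hD, mem_filter, Fintype.mem_piFinset] at hx
        simp only [mem_product, distinctTuples, mem_filter, Fintype.mem_piFinset, he]
        exact ⟨⟨fun i => hx.1 _, fun i j hij h => hij (hx.2 h)⟩, fun i => hx.1 _⟩
      · intro x _ y _ h
        simp only [Prod.mk.injEq] at h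
        funext i
        rw [← e.apply_symm_apply i]
        rcases e.symm i with j | j
        · exact congrFun h.1 j
        · exact congrFun h.2 j
      · intro x _ y _ h
        have hs : ∀ x : Fin (k + s) → ℤ, pairVec (k := k)
            (fun i => x (e (Sum.inl i)), fun i => x (e (Sum.inr i))) = v x := by
          intro x
          simp only [hv, pairVec, ← e.sum_comp, Fintype.sum_sum_type]
        rw [hs, hs, h]
    · have : D1 I = ∅ := by
        refine filter_eq_empty_iff.mpr fun x _ h => hI fun i j hij => h ?_
        simp [hij]
      rw [this]
      simp [energy]
  have hD2 : ∀ t, energy (D2 t) v ≤ p * J2 := by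
    intro t
    refine (energy_piFinset_le k (fun i => t.1 (t.2 i)) B).trans ?_
    calc _ ≤ ∑ _b : ZMod p, J2 := sum_le_sum fun b _ => vinE_residue_le k X p hp.pos b
      _ = _ := by rw [sum_const, card_univ, ZMod.card, smul_eq_mul]
  have hU1 : energy (univ.biUnion D1) v ≤
      ((k + s) ^ k) * ((k + s) ^ k * (p ^ (2 * s) * (X ^ k * L * J1))) := by
    refine (energy_le_card_mul_sum _ v univ D1 fun x hx => mem_biUnion.mp hx).trans ?_
    rw [card_univ, Fintype.card_fun, Fintype.card_fin, Fintype.card_fin]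
    refine Nat.mul_le_mul_left _ ((sum_le_card_nsmul _ _ _ fun I _ => hD1 I).trans ?_)
    rw [card_univ, Fintype.card_fun, Fintype.card_fin, Fintype.card_fin, smul_eq_mul]
  have hU2 : energy (univ.biUnion D2) v ≤
      (p ^ k * k ^ (k + s)) * ((p ^ k * k ^ (k + s)) * (p * J2)) := by
    have hc : Fintype.card ((Fin k → ZMod p) × (Fin (k + s) → Fin k)) = p ^ k * k ^ (k + s) := by
      simp [ZMod.card]
    refine (energy_le_card_mul_sum _ v univ D2 fun x hx => mem_biUnion.mp hx).trans ?_
    rw [card_univ, hc]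
    refine Nat.mul_le_mul_left _ ((sum_le_card_nsmul _ _ _ fun t _ => hD2 t).trans ?_)
    rw [card_univ, hc, smul_eq_mul]
  have hfin : energy D v ≤ #(univ : Finset Bool) * ∑ t : Bool,
      energy (if t then univ.biUnion D1 else univ.biUnion D2) v := by
    refine energy_le_card_mul_sum D v univ _ fun x hx => ?_
    rcases exists_comp_injective_or_factor k (fun i => (x i : ZMod p)) with ⟨I, hI⟩ | ⟨e, g, h⟩
    · exact ⟨true, mem_univ _, mem_biUnion.mpr ⟨I, mem_univ _, mem_filter.mpr ⟨hx, hI⟩⟩⟩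
    · refine ⟨false, mem_univ _, mem_biUnion.mpr ⟨(e, g), mem_univ _, ?_⟩⟩
      simp only [hD, D2, hB, Fintype.mem_piFinset, mem_filter] at hx ⊢
      exact fun i => ⟨hx i, h i⟩
  simp only [Fintype.sum_bool, card_univ, Fintype.card_bool, if_true, Bool.false_eq_true,
    if_false] at hfin
  calc vinE (Fin (k + s)) k A = energy D v := rfl
    _ ≤ _ := hfin
    _ ≤ 2 * (((k + s) ^ k) * ((k + s) ^ k * (p ^ (2 * s) * (X ^ k * L * J1))) +
        (p ^ k * k ^ (k + s)) * ((p ^ k * k ^ (k + s)) * (p * J2))) := by gcongr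
    _ = _ := by ring

lemma vinE_le_pow (s k X : ℕ) : vinE (Fin s) k (Ico (0 : ℤ) X) ≤ X ^ (2 * s) := by
  unfold vinE energy
  refine (card_filter_le _ _).trans ?_
  rw [card_product, Fintype.card_piFinset]
  simp [← pow_add, two_mul]

lemma cast_choose_two' (k : ℕ) : ((k * (k - 1) / 2 : ℕ) : ℝ) = k * (k - 1) / 2 := by
  rw [← Nat.choose_two_right, Nat.cast_choose_two]

lemma div_add_one_rpow_le {X p : ℕ} {a n : ℝ} (hp : 0 < p) (hX : 0 < X) (ha : 0 ≤ a)
    (han : a ≤ 2 * n) (h : 2 * n * p ≤ X) :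
    ((X / p + 1 : ℕ) : ℝ) ^ a ≤ 3 * ((X : ℝ) / p) ^ a := by
  have hp' : (0 : ℝ) < p := by exact_mod_cast hp
  have hX' : (0 : ℝ) < X := by exact_mod_cast hX
  have h1 : ((X / p + 1 : ℕ) : ℝ) ≤ (X / p : ℝ) * (1 + p / X) := by
    have : ((X / p : ℕ) : ℝ) ≤ (X : ℝ) / p := Nat.cast_div_le
    have e : (X / p : ℝ) * (1 + p / X) = X / p + 1 := by field_simp
    rw [e]; push_cast; linarith
  have h2 : (1 + p / X : ℝ) ^ a ≤ 3 := by
    calc (1 + p / X : ℝ) ^ a ≤ (Real.exp (p / X)) ^ a := by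
          refine Real.rpow_le_rpow (by positivity) ?_ ha
          rw [add_comm]; exact Real.add_one_le_exp _
      _ = Real.exp (p / X * a) := (Real.exp_mul _ _).symm
      _ ≤ Real.exp 1 := by
          apply Real.exp_le_exp.mpr
          rw [div_mul_eq_mul_div, div_le_one hX']
          nlinarith
      _ ≤ 3 := by linarith [Real.exp_one_lt_d9]
  calc ((X / p + 1 : ℕ) : ℝ) ^ a ≤ ((X / p : ℝ) * (1 + p / X)) ^ a :=
        Real.rpow_le_rpow (by positivity) h1 ha
    _ = (X / p : ℝ) ^ a * (1 + p / X) ^ a := Real.mul_rpow (by positivity) (by positivity)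
    _ ≤ (X / p : ℝ) ^ a * 3 := by gcongr
    _ = _ := mul_comm _ _

lemma main_term_exponent {k s : ℕ} (hk : 0 < k) {X p Z K η : ℝ} (hX0 : 0 < X) (hp0 : 0 < p)
    (hp4 : p ≤ 4 * Z) (hZ : Z = X ^ (1 / k : ℝ)) (hK : K = k * (k + 1) / 2) (hη : 0 ≤ η) (hηK : η ≤ K) :
    p ^ (2 * s) * X ^ k * p ^ (k * (k - 1) / 2) * (X / p) ^ (2 * s - K + η) ≤
      4 ^ (k ^ 2) * X ^ (2 * (s : ℝ) + 2 * k - K + η * (1 - 1 / k)) := by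
  have hk1 : (1 : ℝ) ≤ k := by exact_mod_cast hk
  have hZ0 : 0 < Z := by rw [hZ]; positivity
  have e2 : p ^ (2 * s) * X ^ k * p ^ (k * (k - 1) / 2) * (X / p) ^ (2 * s - K + η) =
      p ^ ((k : ℝ) ^ 2 - η) * X ^ (k + (2 * s - K + η)) := by
    rw [Real.div_rpow hX0.le hp0.le, Real.rpow_add hX0 (k : ℝ), Real.rpow_natCast,
      show (k : ℝ) ^ 2 - η = ((2 * s : ℕ) : ℝ) + ((k * (k - 1) / 2 : ℕ) : ℝ) - (2 * s - K + η) by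
        rw [cast_choose_two', hK]; push_cast; ring,
      Real.rpow_sub hp0, Real.rpow_add hp0 ((2 * s : ℕ) : ℝ), Real.rpow_natCast, Real.rpow_natCast]
    ring
  rw [e2]
  have hexp : 0 ≤ (k : ℝ) ^ 2 - η := by
    have : K ≤ (k : ℝ) ^ 2 := by rw [hK]; nlinarith
    linarith
  have h4 : (4 : ℝ) ^ ((k : ℝ) ^ 2 - η) ≤ 4 ^ (k ^ 2) := by
    rw [← Real.rpow_natCast 4 (k ^ 2)]
    refine Real.rpow_le_rpow_of_exponent_le (by norm_num) ?_
    push_cast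
    linarith
  calc p ^ ((k : ℝ) ^ 2 - η) * X ^ (k + (2 * s - K + η))
      ≤ (4 * Z) ^ ((k : ℝ) ^ 2 - η) * X ^ (k + (2 * s - K + η)) := by gcongr
    _ = 4 ^ ((k : ℝ) ^ 2 - η) * (Z ^ ((k : ℝ) ^ 2 - η) * X ^ (k + (2 * s - K + η))) := by
        rw [Real.mul_rpow (by norm_num) hZ0.le]; ring
    _ = 4 ^ ((k : ℝ) ^ 2 - η) * X ^ (2 * (s : ℝ) + 2 * k - K + η * (1 - 1 / k)) := by
        rw [hZ, ← Real.rpow_mul hX0.le, ← Real.rpow_add hX0]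
        congr 2
        field_simp
        ring
    _ ≤ _ := by gcongr

set_option maxHeartbeats 1000000 in
lemma vinE_step {k s : ℕ} (hk : 4 ≤ k) (hs : k ^ 2 ≤ s) (hn : k + s ≤ 12 * k ^ 2) {K η C C' : ℝ}
    (hK : K = k * (k + 1) / 2) (hη : 0 ≤ η) (hηK : η ≤ K) (hC : 0 ≤ C)
    (hJ : ∀ X : ℕ, 0 < X → (vinE (Fin s) k (Ico (0 : ℤ) X) : ℝ) ≤ C * (X : ℝ) ^ (2 * s - K + η))
    (hC1 : ((12 * k ^ 2 : ℝ) ^ k) ^ K ≤ C')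
    (hC2 : 12 * ((k + s : ℕ) : ℝ) ^ (2 * k) * k.factorial * 4 ^ (k ^ 2) * C ≤ C') :
    ∀ X : ℕ, 0 < X → (vinE (Fin (k + s)) k (Ico (0 : ℤ) X) : ℝ) ≤
      C' * (X : ℝ) ^ (2 * ((k + s : ℕ) : ℝ) - K + η * (1 - 1 / k)) := by
  have hk4 : (4 : ℝ) ≤ k := by exact_mod_cast hk
  have hsR : (k : ℝ) ^ 2 ≤ s := by exact_mod_cast hs
  have hnR : ((k + s : ℕ) : ℝ) ≤ 12 * k ^ 2 := by exact_mod_cast hn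
  set n : ℝ := ((k + s : ℕ) : ℝ) with hn_def
  have hns : n = k + s := by rw [hn_def]; push_cast; ring
  set a' : ℝ := 2 * n - K + η * (1 - 1 / k) with ha'
  set a : ℝ := 2 * s - K + η with ha
  have hk1 : (0 : ℝ) ≤ 1 - 1 / k := by
    rw [sub_nonneg, div_le_one (by linarith)]; linarith
  have hk1' : 1 - 1 / (k : ℝ) ≤ 1 := by
    have : (0 : ℝ) ≤ 1 / k := by positivity
    linarith
  have hηk : η * (1 - 1 / k) ≤ K := by nlinarith
  have hηk0 : 0 ≤ η * (1 - 1 / k) := by positivity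
  have ha0 : 0 ≤ a := by rw [ha, hK]; nlinarith
  have han : a ≤ 2 * n := by rw [ha, hns]; linarith
  have ha'n : a' ≤ 2 * n := by rw [ha']; linarith
  have hdeg : n + 2 * k + 1 ≤ a' := by rw [ha', hns, hK]; nlinarith
  have ha'0 : 0 ≤ a' := by rw [hns] at hdeg; linarith
  have hC'0 : 0 ≤ C' := le_trans (by positivity) hC1
  have hK0 : 0 ≤ K := hη.trans hηK
  intro X
  induction X using Nat.strong_induction_on with
  | _ X ih =>
  intro hX
  have hX1 : (1 : ℝ) ≤ X := by exact_mod_cast hX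
  have hX0 : (0 : ℝ) < X := by linarith
  set Q : ℝ := 12 * k ^ 2 with hQ
  have hQ192 : 192 ≤ Q := by rw [hQ]; nlinarith
  rcases le_or_gt (X : ℝ) (Q ^ k) with hsmall | hlarge
  · calc (vinE (Fin (k + s)) k (Ico (0 : ℤ) X) : ℝ) ≤ (X : ℝ) ^ (2 * (k + s)) := by
          exact_mod_cast vinE_le_pow (k + s) k X
      _ = (X : ℝ) ^ (2 * n) := by rw [← Real.rpow_natCast]; push_cast [hn_def]; rfl
      _ ≤ (X : ℝ) ^ (K + a') := Real.rpow_le_rpow_of_exponent_le hX1 (by rw [ha']; linarith)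
      _ = (X : ℝ) ^ K * (X : ℝ) ^ a' := Real.rpow_add hX0 _ _
      _ ≤ (Q ^ k) ^ K * (X : ℝ) ^ a' := by gcongr
      _ ≤ _ := by gcongr
  · set Z : ℝ := (X : ℝ) ^ (1 / k : ℝ) with hZ
    have hZ0 : 0 < Z := Real.rpow_pos_of_pos hX0 _
    have hZk : Z ^ k = X := by
      rw [hZ, ← Real.rpow_natCast, ← Real.rpow_mul hX0.le, one_div, inv_mul_cancel₀ (by linarith),
        Real.rpow_one]
    have hQZ : Q ≤ Z := by
      by_contra! h
      have : Z ^ k < Q ^ k := pow_lt_pow_left₀ h hZ0.le (by omega)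
      linarith
    obtain ⟨p, hp, hp1, hp2⟩ := Nat.exists_prime_lt_and_le_two_mul ⌈Z⌉₊
      (Nat.ceil_pos.mpr hZ0).ne'
    have hpZ : Z ≤ p := (Nat.le_ceil Z).trans (by exact_mod_cast hp1.le)
    have hp4 : (p : ℝ) ≤ 4 * Z := by
      have h1 : (p : ℝ) ≤ 2 * (⌈Z⌉₊ : ℝ) := by exact_mod_cast hp2
      have h2 := Nat.ceil_lt_add_one hZ0.le
      linarith
    have hp0 : (0 : ℝ) < p := by linarith
    have hkp : k < p := by
      have : (k : ℝ) < p := by nlinarith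
      exact_mod_cast this
    have hXp : X ≤ p ^ k := by
      have : (X : ℝ) ≤ (p : ℝ) ^ k := by rw [← hZk]; gcongr
      exact_mod_cast this
    have hnp : 2 * n * p ≤ X := by
      have h1 : Z ^ 3 ≤ X := by
        rw [← hZk]; exact pow_le_pow_right₀ (by linarith) (by omega)
      have h2 : n ≤ Z := hnR.trans hQZ
      have h3 : 0 ≤ n := by rw [hn_def]; positivity
      calc 2 * n * p ≤ 2 * Z * (4 * Z) := by gcongr
        _ ≤ Z * Z ^ 2 := by nlinarith [sq_nonneg Z]
        _ = Z ^ 3 := by ring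
        _ ≤ X := h1
    have hrec := vinE_recursion (s := s) hp (by omega) hkp hXp
    have hX'lt : X / p + 1 < X := by
      have h1 : X / p ≤ X / 2 := Nat.div_le_div_left hp.two_le (by norm_num)
      have h2 : 3 ≤ X := by
        have : (3 : ℝ) ≤ X := by
          have h1 : Z ^ 1 ≤ X := by
            rw [← hZk]; exact pow_le_pow_right₀ (by linarith) (by omega)
          linarith
        exact_mod_cast this
      omega
    have hJ1 := hJ (X / p + 1) (Nat.succ_pos _)
    have hJ2 := ih (X / p + 1) hX'lt (Nat.succ_pos _)
    have hb1 := div_add_one_rpow_le hp.pos hX ha0 han hnp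
    have hb2 := div_add_one_rpow_le hp.pos hX ha'0 ha'n hnp
    have hrecR : (vinE (Fin (k + s)) k (Ico (0 : ℤ) X) : ℝ) ≤
      2 * n ^ (2 * k) * p ^ (2 * s) * X ^ k * (k.factorial * p ^ (k * (k - 1) / 2)) *
        vinE (Fin s) k (Ico (0 : ℤ) (X / p + 1 : ℕ)) +
      2 * (p ^ k * k ^ (k + s)) ^ 2 * p * vinE (Fin (k + s)) k (Ico (0 : ℤ) (X / p + 1 : ℕ)) := by
      rw [hn_def]; exact_mod_cast hrec
    have hA : 2 * n ^ (2 * k) * p ^ (2 * s) * X ^ k * (k.factorial * p ^ (k * (k - 1) / 2)) *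
        (C * (3 * ((X : ℝ) / p) ^ a)) ≤ C' / 2 * (X : ℝ) ^ a' := by
      have e1 := main_term_exponent (s := s) (by omega : 0 < k) hX0 hp0 hp4 hZ hK hη hηK
      rw [← ha, show 2 * (s : ℝ) + 2 * k - K + η * (1 - 1 / k) = a' by rw [ha', hns]; ring] at e1
      calc _ = 6 * n ^ (2 * k) * k.factorial * C *
            ((p : ℝ) ^ (2 * s) * X ^ k * p ^ (k * (k - 1) / 2) * ((X : ℝ) / p) ^ a) := by ring
        _ ≤ 6 * n ^ (2 * k) * k.factorial * C * (4 ^ (k ^ 2) * (X : ℝ) ^ a') := by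
            have : 0 ≤ n := by rw [hn_def]; positivity
            gcongr
        _ = (12 * n ^ (2 * k) * k.factorial * 4 ^ (k ^ 2) * C) / 2 * (X : ℝ) ^ a' := by ring
        _ ≤ _ := by gcongr
    have hB : 2 * (p ^ k * k ^ (k + s)) ^ 2 * p * (C' * (3 * ((X : ℝ) / p) ^ a')) ≤
        C' / 2 * (X : ℝ) ^ a' := by
      have e1 : 12 * ((p : ℝ) ^ k * k ^ (k + s)) ^ 2 * p ≤ (p : ℝ) ^ a' := by
        have e2 : 12 * ((k : ℝ) ^ (k + s)) ^ 2 ≤ (p : ℝ) ^ (k + s) := by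
          calc 12 * ((k : ℝ) ^ (k + s)) ^ 2 ≤ 12 ^ (k + s) * ((k : ℝ) ^ (k + s)) ^ 2 := by
                gcongr
                exact le_self_pow₀ (by norm_num) (by omega)
            _ = Q ^ (k + s) := by rw [hQ]; ring
            _ ≤ _ := by gcongr; exact hQZ.trans hpZ
        calc 12 * ((p : ℝ) ^ k * k ^ (k + s)) ^ 2 * p
            = (12 * ((k : ℝ) ^ (k + s)) ^ 2) * (p : ℝ) ^ (2 * k + 1) := by ring
          _ ≤ (p : ℝ) ^ (k + s) * (p : ℝ) ^ (2 * k + 1) := by gcongr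
          _ = (p : ℝ) ^ (n + 2 * k + 1) := by
              rw [← pow_add, ← Real.rpow_natCast, hn_def]; push_cast; congr 1; ring
          _ ≤ _ := Real.rpow_le_rpow_of_exponent_le (by linarith) hdeg
      rw [Real.div_rpow hX0.le hp0.le]
      have hpa : 0 < (p : ℝ) ^ a' := Real.rpow_pos_of_pos hp0 _
      calc _ = C' / 2 * (X : ℝ) ^ a' * ((12 * ((p : ℝ) ^ k * k ^ (k + s)) ^ 2 * p) / (p : ℝ) ^ a') := by
            field_simp; ring
        _ ≤ C' / 2 * (X : ℝ) ^ a' * 1 := by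
            gcongr
            exact (div_le_one hpa).mpr e1
        _ = _ := mul_one _
    have hn0 : 0 ≤ n := by rw [hn_def]; positivity
    calc _ ≤ _ := hrecR
      _ ≤ 2 * n ^ (2 * k) * p ^ (2 * s) * X ^ k * (k.factorial * p ^ (k * (k - 1) / 2)) *
            (C * (3 * ((X : ℝ) / p) ^ a)) +
          2 * (p ^ k * k ^ (k + s)) ^ 2 * p * (C' * (3 * ((X : ℝ) / p) ^ a')) := by
          gcongr
          · exact hJ1.trans (by gcongr)
          · exact hJ2.trans (by gcongr)
      _ ≤ C' / 2 * (X : ℝ) ^ a' + C' / 2 * (X : ℝ) ^ a' := add_le_add hA hB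
      _ = _ := by ring

/-- Vinogradov's mean value theorem. -/
theorem vinE_bound {k : ℕ} (hk : 4 ≤ k) (r : ℕ) (hr : r ≤ 10 * k) (X : ℕ) (hX : 0 < X) :
    (vinE (Fin (r * k + k ^ 2)) k (Ico (0 : ℤ) X) : ℝ) ≤
      (12 * k ^ 2 : ℝ) ^ (k ^ 3 * (r + 1)) *
        (X : ℝ) ^ (2 * ((r * k + k ^ 2 : ℕ) : ℝ) - k * (k + 1) / 2 +
          k * (k + 1) / 2 * (1 - 1 / (k : ℝ)) ^ r) := by
  have hk4 : (4 : ℝ) ≤ k := by exact_mod_cast hk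
  have hQ : (1 : ℝ) ≤ 12 * k ^ 2 := by nlinarith
  have hk1 : (0 : ℝ) ≤ 1 - 1 / k := by
    rw [sub_nonneg, div_le_one (by linarith)]; linarith
  have hk1' : 1 - 1 / (k : ℝ) ≤ 1 := by
    have : (0 : ℝ) ≤ 1 / k := by positivity
    linarith
  induction r generalizing X with
  | zero =>
    have h1 : (vinE (Fin (0 * k + k ^ 2)) k (Ico (0 : ℤ) X) : ℝ) ≤
        (X : ℝ) ^ (2 * (0 * k + k ^ 2)) := by exact_mod_cast vinE_le_pow (0 * k + k ^ 2) k X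
    refine h1.trans ?_
    rw [← Real.rpow_natCast]
    have : (2 * ((0 * k + k ^ 2 : ℕ) : ℝ) - k * (k + 1) / 2 +
          k * (k + 1) / 2 * (1 - 1 / (k : ℝ)) ^ 0) = ((2 * (0 * k + k ^ 2) : ℕ) : ℝ) := by
      push_cast; ring
    rw [this]
    exact le_mul_of_one_le_left (by positivity) (one_le_pow₀ hQ)
  | succ r ih =>
    have hstep := vinE_step (k := k) (s := r * k + k ^ 2) hk (by nlinarith) (by nlinarith)
      (K := k * (k + 1) / 2) (η := k * (k + 1) / 2 * (1 - 1 / (k : ℝ)) ^ r)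
      (C := (12 * k ^ 2 : ℝ) ^ (k ^ 3 * (r + 1)))
      (C' := (12 * k ^ 2 : ℝ) ^ (k ^ 3 * (r + 1 + 1))) rfl (by positivity)
      (mul_le_of_le_one_right (by positivity) (pow_le_one₀ hk1 hk1')) (by positivity)
      (fun X hX => ih (by omega) X hX) ?_ ?_ X hX
    · have e : k + (r * k + k ^ 2) = (r + 1) * k + k ^ 2 := by ring
      rw [e] at hstep
      convert hstep using 3
      ring
    · rw [← Real.rpow_natCast _ k, ← Real.rpow_natCast _ (k ^ 3 * (r + 1 + 1)),
        ← Real.rpow_mul (by linarith)]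
      refine Real.rpow_le_rpow_of_exponent_le hQ ?_
      push_cast
      have h1 : (k : ℝ) * (k * (k + 1) / 2) ≤ k ^ 3 := by nlinarith [sq_nonneg (k : ℝ)]
      have h2 : (k : ℝ) ^ 3 ≤ k ^ 3 * (r + 1 + 1) := by
        have : (0 : ℝ) ≤ k ^ 3 := by positivity
        nlinarith [(Nat.cast_nonneg r : (0 : ℝ) ≤ r)]
      exact h1.trans h2
    · have h1 : ((k + (r * k + k ^ 2) : ℕ) : ℝ) ≤ 12 * k ^ 2 := by
        have : k + (r * k + k ^ 2) ≤ 12 * k ^ 2 := by nlinarith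
        exact_mod_cast this
      have h2 : (k.factorial : ℝ) ≤ (12 * k ^ 2) ^ k := by
        have h3 : (k.factorial : ℝ) ≤ (k : ℝ) ^ k := by exact_mod_cast Nat.factorial_le_pow k
        refine h3.trans ?_
        gcongr
        nlinarith
      have h3 : (4 : ℝ) ^ (k ^ 2) ≤ (12 * k ^ 2) ^ (k ^ 2) := by gcongr; nlinarith
      have h4 : (12 : ℝ) ≤ (12 * k ^ 2) ^ 1 := by nlinarith
      set Q : ℝ := 12 * k ^ 2
      calc 12 * ((k + (r * k + k ^ 2) : ℕ) : ℝ) ^ (2 * k) * k.factorial * 4 ^ (k ^ 2) *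
            Q ^ (k ^ 3 * (r + 1))
          ≤ Q ^ 1 * Q ^ (2 * k) * Q ^ k * Q ^ (k ^ 2) * Q ^ (k ^ 3 * (r + 1)) := by gcongr
        _ = Q ^ (1 + 2 * k + k + k ^ 2 + k ^ 3 * (r + 1)) := by ring
        _ ≤ _ := by
          refine pow_le_pow_right₀ hQ ?_
          have : 1 + 2 * k + k + k ^ 2 ≤ k ^ 3 := by nlinarith
          nlinarith

/-- The exponential `e(x) = exp(2πix)`. -/
noncomputable def expTwoPiI (x : ℝ) : ℂ := Complex.exp ((2 * Real.pi * x : ℝ) * Complex.I)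

lemma norm_expTwoPiI (x : ℝ) : ‖expTwoPiI x‖ = 1 := Complex.norm_exp_ofReal_mul_I _

lemma expTwoPiI_add (x y : ℝ) : expTwoPiI (x + y) = expTwoPiI x * expTwoPiI y := by
  rw [expTwoPiI, expTwoPiI, expTwoPiI, ← Complex.exp_add]
  congr 1
  push_cast
  ring

lemma expTwoPiI_zero : expTwoPiI 0 = 1 := by simp [expTwoPiI]

lemma expTwoPiI_sum {ι : Type*} (s : Finset ι) (f : ι → ℝ) :
    expTwoPiI (∑ i ∈ s, f i) = ∏ i ∈ s, expTwoPiI (f i) := by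
  classical
  induction s using Finset.induction_on with
  | empty => simp [expTwoPiI_zero]
  | insert a s ha ih => rw [sum_insert ha, prod_insert ha, expTwoPiI_add, ih]

/-- The character `g ↦ e(∑ α_j h_j g_j)`. -/
noncomputable def biChar {k : ℕ} (α : Fin k → ℝ) (h : Fin k → ℤ) : AddChar (Fin k → ℤ) ℂ where
  toFun g := expTwoPiI (∑ j, α j * h j * g j)
  map_zero_eq_one' := by simp [expTwoPiI_zero]
  map_add_eq_mul' x y := by
    rw [← expTwoPiI_add, ← sum_add_distrib]
    congr 1
    refine sum_congr rfl fun j _ => ?_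
    push_cast [Pi.add_apply]
    ring

lemma biChar_apply {k : ℕ} (α : Fin k → ℝ) (h g : Fin k → ℤ) :
    biChar α h g = expTwoPiI (∑ j, α j * h j * g j) := rfl

lemma biChar_comm {k : ℕ} (α : Fin k → ℝ) (h g : Fin k → ℤ) : biChar α h g = biChar α g h := by
  rw [biChar_apply, biChar_apply]
  congr 1
  exact sum_congr rfl fun j _ => by ring

lemma norm_biChar {k : ℕ} (α : Fin k → ℝ) (h g : Fin k → ℤ) : ‖biChar α h g‖ = 1 :=
  norm_expTwoPiI _

/-- Difference of the power-sum vectors of two tuples. -/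
def diffVec (k : ℕ) {s : ℕ} (q : (Fin s → ℤ) × (Fin s → ℤ)) : Fin k → ℤ :=
  ∑ i, powVec k (q.1 i) - ∑ i, powVec k (q.2 i)

lemma norm_sum_pow_eq {k : ℕ} (ψ : AddChar (Fin k → ℤ) ℂ) (hψ : ∀ u, ‖ψ u‖ = 1) (s : ℕ)
    (A : Finset ℤ) : ((‖∑ x ∈ A, ψ (powVec k x)‖ ^ (2 * s) : ℝ) : ℂ) =
      ∑ q ∈ (Fintype.piFinset fun _ : Fin s => A) ×ˢ (Fintype.piFinset fun _ : Fin s => A),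
        ψ (diffVec k q) := by
  have h1 := sum_piFinset_addChar ψ fun _ : Fin s => A
  rw [prod_const, card_univ, Fintype.card_fin] at h1
  rw [mul_comm 2 s, pow_mul, ← norm_pow, ← h1, Complex.ofReal_pow, ← Complex.mul_conj', map_sum,
    sum_mul_sum, sum_product]
  refine sum_congr rfl fun x _ => sum_congr rfl fun y _ => ?_
  rw [diffVec, sub_eq_add_neg, AddChar.map_add_eq_mul, AddChar.map_neg_eq_inv,
    Complex.inv_eq_conj (hψ _)]

lemma sum_diffVec_le {k s : ℕ} (A : Finset ℤ) (F : (Fin k → ℤ) → ℝ) (hF : ∀ h, 0 ≤ F h)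
    (H : Finset (Fin k → ℤ))
    (hH : ∀ q ∈ (Fintype.piFinset fun _ : Fin s => A) ×ˢ (Fintype.piFinset fun _ : Fin s => A),
      diffVec k q ∈ H) :
    ∑ q ∈ (Fintype.piFinset fun _ : Fin s => A) ×ˢ (Fintype.piFinset fun _ : Fin s => A),
      F (diffVec k q) ≤ vinE (Fin s) k A * ∑ h ∈ H, F h := by
  rw [← sum_fiberwise_of_maps_to hH, mul_sum]
  refine sum_le_sum fun h _ => ?_
  rw [sum_congr rfl fun q hq => by rw [(mem_filter.mp hq).2], sum_const, nsmul_eq_mul]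
  refine mul_le_mul_of_nonneg_right ?_ (hF h)
  exact Nat.cast_le.mpr (card_sub_eq_le_energy (Fintype.piFinset fun _ : Fin s => A)
    (fun x => ∑ i, powVec k (x i)) h)

lemma diffVec_mem_box {k s P : ℕ} {q : (Fin s → ℤ) × (Fin s → ℤ)}
    (hq : q ∈ (Fintype.piFinset fun _ : Fin s => Ico (0 : ℤ) P) ×ˢ
      (Fintype.piFinset fun _ : Fin s => Ico (0 : ℤ) P)) :
    diffVec k q ∈ Fintype.piFinset fun j : Fin k =>
      Icc (-((s * P ^ (j.1 + 1) : ℕ) : ℤ)) ((s * P ^ (j.1 + 1) : ℕ) : ℤ) := by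
  rw [mem_product, Fintype.mem_piFinset, Fintype.mem_piFinset] at hq
  rw [Fintype.mem_piFinset]
  intro j
  have key : ∀ x : Fin s → ℤ, (∀ i, x i ∈ Ico (0 : ℤ) P) →
      0 ≤ ∑ i, x i ^ (j.1 + 1) ∧ ∑ i, x i ^ (j.1 + 1) ≤ ((s * P ^ (j.1 + 1) : ℕ) : ℤ) := by
    intro x hx
    simp only [mem_Ico] at hx
    refine ⟨sum_nonneg fun i _ => pow_nonneg (hx i).1 _, ?_⟩
    refine (sum_le_card_nsmul _ _ ((P : ℤ) ^ (j.1 + 1)) fun i _ =>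
      pow_le_pow_left₀ (hx i).1 (hx i).2.le _).trans ?_
    simp
  have h1 := key _ hq.1
  have h2 := key _ hq.2
  simp only [diffVec, Pi.sub_apply, Finset.sum_apply, powVec, mem_Icc]
  constructor <;> linarith

theorem bilinear_bound (k : ℕ) {s P : ℕ} (hs : 0 < s) (α : Fin k → ℝ) :
    ‖∑ y ∈ Ico (0 : ℤ) P, ∑ x ∈ Ico (0 : ℤ) P,
      expTwoPiI (∑ j : Fin k, α j * y ^ (j.1 + 1) * x ^ (j.1 + 1))‖ ^ (2 * s * (2 * s)) ≤
    (P : ℝ) ^ ((2 * s - 1) * (4 * s)) * (vinE (Fin s) k (Ico (0 : ℤ) P) : ℝ) ^ 2 *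
      ∏ j : Fin k, ∑ g ∈ Icc (-((s * P ^ (j.1 + 1) : ℕ) : ℤ)) ((s * P ^ (j.1 + 1) : ℕ) : ℤ),
        ‖∑ h ∈ Icc (-((s * P ^ (j.1 + 1) : ℕ) : ℤ)) ((s * P ^ (j.1 + 1) : ℕ) : ℤ),
          expTwoPiI (α j * h * g)‖ := by
  classical
  set A := Ico (0 : ℤ) P with hA
  have hAc : #A = P := by simp [hA]
  set J : ℝ := (vinE (Fin s) k A : ℝ) with hJ
  set U := (Fintype.piFinset fun _ : Fin s => A) ×ˢ (Fintype.piFinset fun _ : Fin s => A) with hU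
  have hUc : #U = P ^ (2 * s) := by
    rw [hU, card_product, Fintype.card_piFinset]
    simp [hAc, ← pow_add, two_mul]
  set I : Fin k → Finset ℤ := fun j =>
    Icc (-((s * P ^ (j.1 + 1) : ℕ) : ℤ)) ((s * P ^ (j.1 + 1) : ℕ) : ℤ) with hI
  set H := Fintype.piFinset I with hH
  have hUH : ∀ q ∈ U, diffVec k q ∈ H := fun q hq => diffVec_mem_box hq
  obtain ⟨m, hm⟩ : ∃ m, 2 * s = m + 1 := ⟨2 * s - 1, by omega⟩
  set T : (Fin k → ℤ) → ℂ := fun h => ∑ y ∈ A, biChar α h (powVec k y) with hT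
  have hS : ∑ y ∈ A, ∑ x ∈ A, expTwoPiI (∑ j : Fin k, α j * y ^ (j.1 + 1) * x ^ (j.1 + 1)) =
      ∑ y ∈ A, ∑ x ∈ A, biChar α (powVec k y) (powVec k x) := by
    simp only [biChar_apply, powVec]
    push_cast
    rfl
  rw [hS]
  have step1 : ‖∑ y ∈ A, ∑ x ∈ A, biChar α (powVec k y) (powVec k x)‖ ^ (2 * s) ≤
      (P : ℝ) ^ m * ∑ q ∈ U, ‖T (diffVec k q)‖ := by
    calc _ ≤ (∑ y ∈ A, ‖∑ x ∈ A, biChar α (powVec k y) (powVec k x)‖) ^ (2 * s) := by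
          gcongr; exact norm_sum_le _ _
      _ ≤ (P : ℝ) ^ m * ∑ y ∈ A, ‖∑ x ∈ A, biChar α (powVec k y) (powVec k x)‖ ^ (2 * s) := by
          rw [hm, ← hAc]
          exact pow_sum_le_card_mul_sum_pow (fun _ _ => norm_nonneg _) m
      _ ≤ _ := by
          refine mul_le_mul_of_nonneg_left ?_ (by positivity)
          have e : ((∑ y ∈ A, ‖∑ x ∈ A, biChar α (powVec k y) (powVec k x)‖ ^ (2 * s) : ℝ) : ℂ) =
              ∑ q ∈ U, T (diffVec k q) := by
            rw [Complex.ofReal_sum, sum_congr rfl fun y _ =>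
              norm_sum_pow_eq (biChar α (powVec k y)) (norm_biChar _ _) s A, sum_comm]
            exact sum_congr rfl fun q _ => sum_congr rfl fun y _ => biChar_comm _ _ _
          have e2 := congrArg norm e
          rw [Complex.norm_real, Real.norm_of_nonneg (by positivity)] at e2
          rw [e2]
          exact norm_sum_le _ _
  have step2 : (∑ q ∈ U, ‖T (diffVec k q)‖) ^ (2 * s) ≤
      ((P : ℝ) ^ (2 * s)) ^ m * (J * ∑ h ∈ H, ‖T h‖ ^ (2 * s)) := by
    calc _ ≤ ((P : ℝ) ^ (2 * s)) ^ m * ∑ q ∈ U, ‖T (diffVec k q)‖ ^ (2 * s) := by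
          have := pow_sum_le_card_mul_sum_pow (s := U) (f := fun q => ‖T (diffVec k q)‖)
            (fun _ _ => norm_nonneg _) m
          rw [hUc, ← hm] at this
          exact_mod_cast this
      _ ≤ _ := by
          refine mul_le_mul_of_nonneg_left ?_ (by positivity)
          exact sum_diffVec_le A (fun h => ‖T h‖ ^ (2 * s)) (fun h => by positivity) H hUH
  have step3 : ∑ h ∈ H, ‖T h‖ ^ (2 * s) ≤
      J * ∏ j, ∑ g ∈ I j, ‖∑ h ∈ I j, expTwoPiI (α j * h * g)‖ := by
    have e : ((∑ h ∈ H, ‖T h‖ ^ (2 * s) : ℝ) : ℂ) = ∑ q ∈ U, ∑ h ∈ H, biChar α h (diffVec k q) := by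
      rw [Complex.ofReal_sum, sum_congr rfl fun h _ =>
        norm_sum_pow_eq (biChar α h) (norm_biChar _ _) s A, sum_comm]
    have e2 := congrArg norm e
    rw [Complex.norm_real, Real.norm_of_nonneg (by positivity)] at e2
    rw [e2]
    calc _ ≤ ∑ q ∈ U, ‖∑ h ∈ H, biChar α h (diffVec k q)‖ := norm_sum_le _ _
      _ ≤ J * ∑ g ∈ H, ‖∑ h ∈ H, biChar α h g‖ :=
          sum_diffVec_le A (fun g => ‖∑ h ∈ H, biChar α h g‖) (fun g => norm_nonneg _) H hUH
      _ = _ := by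
          congr 1
          rw [hH, prod_univ_sum]
          refine sum_congr rfl fun g _ => ?_
          rw [← norm_prod, prod_univ_sum]
          congr 1
          refine sum_congr rfl fun h _ => ?_
          rw [biChar_apply, expTwoPiI_sum]
  have hmm : (2 * s - 1) * (4 * s) = m * (2 * s) + 2 * s * m := by
    have : 2 * s - 1 = m := by omega
    rw [this]; ring
  calc _ = (‖∑ y ∈ A, ∑ x ∈ A, biChar α (powVec k y) (powVec k x)‖ ^ (2 * s)) ^ (2 * s) :=
        pow_mul _ _ _
    _ ≤ ((P : ℝ) ^ m * ∑ q ∈ U, ‖T (diffVec k q)‖) ^ (2 * s) := by gcongr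
    _ = (P : ℝ) ^ (m * (2 * s)) * (∑ q ∈ U, ‖T (diffVec k q)‖) ^ (2 * s) := by
        rw [mul_pow, ← pow_mul]
    _ ≤ (P : ℝ) ^ (m * (2 * s)) * (((P : ℝ) ^ (2 * s)) ^ m * (J *
          (J * ∏ j, ∑ g ∈ I j, ‖∑ h ∈ I j, expTwoPiI (α j * h * g)‖))) := by
        refine mul_le_mul_of_nonneg_left (step2.trans ?_) (by positivity)
        exact mul_le_mul_of_nonneg_left (mul_le_mul_of_nonneg_left step3 (by positivity))
          (by positivity)
    _ = _ := by
        rw [hmm, pow_add, pow_mul _ (2 * s) m]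
        ring

lemma expTwoPiI_intCast (m : ℤ) : expTwoPiI m = 1 := by
  rw [expTwoPiI]
  convert Complex.exp_int_mul_two_pi_mul_I m using 2
  push_cast
  ring

lemma four_mul_abs_sub_round_le (β : ℝ) : 4 * |β - round β| ≤ ‖expTwoPiI β - 1‖ := by
  set t := β - round β with ht
  have h1 : expTwoPiI β = expTwoPiI t := by
    have : β = t + (round β : ℤ) := by rw [ht]; ring
    conv_lhs => rw [this, expTwoPiI_add, expTwoPiI_intCast, mul_one]
  have h2 : |t| ≤ 1 / 2 := abs_sub_round β
  rw [h1, expTwoPiI, mul_comm _ Complex.I, Complex.norm_exp_I_mul_ofReal_sub_one, Real.norm_eq_abs, abs_mul,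
    abs_two]
  have h3 : 2 / Real.pi * (Real.pi * |t|) ≤ Real.sin (Real.pi * |t|) :=
    Real.mul_le_sin (by positivity) (by nlinarith [Real.pi_pos])
  have h4 : |Real.sin (2 * Real.pi * t / 2)| = |Real.sin (Real.pi * |t|)| := by
    rw [show 2 * Real.pi * t / 2 = Real.pi * t by ring]
    rcases abs_cases t with ⟨h, -⟩ | ⟨h, -⟩ <;> rw [h]
    rw [mul_neg, Real.sin_neg, abs_neg]
  rw [h4]
  have h5 : 2 / Real.pi * (Real.pi * |t|) = 2 * |t| := by field_simp
  have := le_abs_self (Real.sin (Real.pi * |t|))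
  linarith

lemma norm_sum_Icc_expTwoPiI_le (β : ℝ) (G : ℕ) :
    ‖∑ h ∈ Icc (-(G : ℤ)) G, expTwoPiI (β * h)‖ * ‖expTwoPiI β - 1‖ ≤ 2 := by
  have key : ∀ n : ℕ, (∑ h ∈ Icc (-(G : ℤ)) (-(G : ℤ) + n), expTwoPiI (β * h)) *
      (expTwoPiI β - 1) = expTwoPiI (β * (-(G : ℤ) + n + 1 : ℤ)) - expTwoPiI (β * (-(G : ℤ) : ℤ)) := by
    intro n
    induction n with
    | zero =>
      simp only [Nat.cast_zero, add_zero, Icc_self, sum_singleton]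
      rw [mul_sub, mul_one, ← expTwoPiI_add]
      congr 2
      push_cast; ring
    | succ n ih =>
      have : Icc (-(G : ℤ)) (-(G : ℤ) + (n + 1 : ℕ)) =
          insert (-(G : ℤ) + n + 1) (Icc (-(G : ℤ)) (-(G : ℤ) + n)) := by
        ext x; simp only [mem_Icc, mem_insert]; push_cast; omega
      rw [this, sum_insert (by rw [mem_Icc]; omega), add_mul, ih, mul_sub, mul_one, ← expTwoPiI_add,
        show β * ((-(G : ℤ) + n + 1 : ℤ) : ℝ) + β =
          β * ((-(G : ℤ) + (n + 1 : ℕ) + 1 : ℤ) : ℝ) by push_cast; ring]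
      ring
  have h := key (2 * G)
  rw [show -(G : ℤ) + (2 * G : ℕ) = G by push_cast; ring] at h
  rw [← norm_mul, h]
  refine (norm_sub_le _ _).trans ?_
  rw [norm_expTwoPiI, norm_expTwoPiI]
  norm_num

lemma card_round_close_le {α δ : ℝ} (hα : 0 < α) (hδ : 0 ≤ δ) (G : ℕ) :
    (#(filter (fun g : ℤ => |α * g - round (α * g)| ≤ δ) (Icc (-(G : ℤ)) G)) : ℝ) ≤
      (2 * α * G + 3) * (2 * δ / α + 1) := by
  set S := filter (fun g : ℤ => |α * g - round (α * g)| ≤ δ) (Icc (-(G : ℤ)) G) with hS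
  set M : ℤ := ⌈α * G⌉ with hM
  have hM0 : 0 ≤ M := Int.ceil_nonneg (by positivity)
  have hb : 0 ≤ 2 * δ / α + 1 := by positivity
  have hmaps : ∀ g ∈ S, round (α * g) ∈ Icc (-M) M := by
    intro g hg
    have h1 := (mem_filter.mp hg).1
    rw [mem_Icc] at h1
    have h2 : α * g ≤ M := by
      have : (g : ℝ) ≤ G := by exact_mod_cast h1.2
      exact (mul_le_mul_of_nonneg_left this hα.le).trans (Int.le_ceil _)
    have h3 : -(M : ℝ) ≤ α * g := by
      have : -(G : ℝ) ≤ g := by exact_mod_cast h1.1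
      have h4 := mul_le_mul_of_nonneg_left this hα.le
      have h5 := Int.le_ceil (α * G)
      rw [← hM] at h5
      linarith
    rw [mem_Icc, round_eq]
    constructor
    · rw [Int.le_floor]; push_cast; linarith
    · rw [← Int.lt_add_one_iff, Int.floor_lt]; push_cast; linarith
  have hfib : ∀ m ∈ Icc (-M) M, (#(filter (fun g : ℤ => round (α * g) = m) S) : ℝ) ≤ 2 * δ / α + 1 := by
    intro m _
    rcases Finset.eq_empty_or_nonempty (filter (fun g : ℤ => round (α * g) = m) S) with h | ⟨g0, hg0⟩
    · rw [h]; simpa using hb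
    have hsub : ∀ g ∈ (filter (fun g : ℤ => round (α * g) = m) S),
        g ∈ Icc ⌈(m - δ) / α⌉ ⌊(m + δ) / α⌋ := by
      intro g hg
      rw [mem_filter, hS, mem_filter] at hg
      have h1 := hg.1.2
      rw [hg.2, abs_le] at h1
      rw [mem_Icc, Int.ceil_le, Int.le_floor, div_le_iff₀ hα, le_div_iff₀ hα]
      constructor <;> linarith
    have h0 := mem_Icc.mp (hsub g0 hg0)
    have hcard := card_le_card (fun g hg => hsub g hg :
      (filter (fun g : ℤ => round (α * g) = m) S) ⊆ Icc ⌈(m - δ) / α⌉ ⌊(m + δ) / α⌋)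
    rw [Int.card_Icc] at hcard
    have h2 : ((⌊(m + δ) / α⌋ + 1 - ⌈(m - δ) / α⌉).toNat : ℝ) =
        ((⌊(m + δ) / α⌋ + 1 - ⌈(m - δ) / α⌉ : ℤ) : ℝ) := by
      have : ((⌊(m + δ) / α⌋ + 1 - ⌈(m - δ) / α⌉).toNat : ℤ) =
        ⌊(m + δ) / α⌋ + 1 - ⌈(m - δ) / α⌉ := Int.toNat_of_nonneg (by omega)
      exact_mod_cast this
    have h3 : (#(filter (fun g : ℤ => round (α * g) = m) S) : ℝ) ≤
        ((⌊(m + δ) / α⌋ + 1 - ⌈(m - δ) / α⌉).toNat : ℝ) := by exact_mod_cast hcard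
    rw [h2] at h3
    push_cast at h3
    have h4 := Int.floor_le ((m + δ) / α)
    have h5 := Int.le_ceil ((m - δ) / α)
    have h6 : (m + δ) / α - (m - δ) / α = 2 * δ / α := by ring
    linarith
  have hS1 : (#S : ℝ) = ∑ m ∈ Icc (-M) M, (#(filter (fun g : ℤ => round (α * g) = m) S) : ℝ) := by
    exact_mod_cast card_eq_sum_card_fiberwise hmaps
  rw [hS1]
  refine (sum_le_sum hfib).trans ?_
  rw [sum_const, nsmul_eq_mul, Int.card_Icc]
  refine mul_le_mul_of_nonneg_right ?_ hb
  have h2 : ((M + 1 - -M).toNat : ℝ) = ((2 * M + 1 : ℤ) : ℝ) := by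
    have : ((M + 1 - -M).toNat : ℤ) = 2 * M + 1 := by omega
    exact_mod_cast this
  rw [h2]
  have := Int.ceil_lt_add_one (α * G)
  rw [← hM] at this
  push_cast
  linarith

lemma sum_norm_sum_expTwoPiI_le_trivial (α : ℝ) {G : ℕ} (hG : 0 < G) :
    ∑ g ∈ Icc (-(G : ℤ)) G, ‖∑ h ∈ Icc (-(G : ℤ)) G, expTwoPiI (α * h * g)‖ ≤
      9 * (G : ℝ) ^ 2 := by
  have hc : (#(Icc (-(G : ℤ)) G) : ℝ) = 2 * G + 1 := by
    rw [Int.card_Icc]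
    have : (((G : ℤ) + 1 - -(G : ℤ)).toNat : ℤ) = 2 * G + 1 := by omega
    exact_mod_cast this
  have h1 : ∀ g ∈ Icc (-(G : ℤ)) G, ‖∑ h ∈ Icc (-(G : ℤ)) G, expTwoPiI (α * h * g)‖ ≤ 2 * G + 1 := by
    intro g _
    refine (norm_sum_le _ _).trans ?_
    simp [norm_expTwoPiI, ← hc]
  refine (sum_le_card_nsmul _ _ _ h1).trans ?_
  have : (1 : ℝ) ≤ G := by exact_mod_cast hG
  rw [nsmul_eq_mul, hc]
  nlinarith

lemma sum_norm_sum_expTwoPiI_le_of_pos {α : ℝ} (hα : 0 < α) (hα1 : α ≤ 1) {G : ℕ} (hG : 0 < G) :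
    ∑ g ∈ Icc (-(G : ℤ)) G, ‖∑ h ∈ Icc (-(G : ℤ)) G, expTwoPiI (α * h * g)‖ ≤
      30 * (G : ℝ) ^ 2 * (√α + 1 / (G * √α)) := by
  have hG1 : (1 : ℝ) ≤ G := by exact_mod_cast hG
  have hs0 : 0 < √α := Real.sqrt_pos.mpr hα
  have hs1 : √α ≤ 1 := Real.sqrt_le_one.mpr hα1
  have hss : √α * √α = α := Real.mul_self_sqrt hα.le
  have hc : (#(Icc (-(G : ℤ)) G) : ℝ) = 2 * G + 1 := by
    rw [Int.card_Icc]
    have : (((G : ℤ) + 1 - -(G : ℤ)).toNat : ℤ) = 2 * G + 1 := by omega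
    exact_mod_cast this
  rw [← sum_filter_add_sum_filter_not _ (fun g : ℤ => |α * g - round (α * g)| ≤ √α)]
  have h1 : ∑ g ∈ filter (fun g : ℤ => |α * g - round (α * g)| ≤ √α) (Icc (-(G : ℤ)) G),
      ‖∑ h ∈ Icc (-(G : ℤ)) G, expTwoPiI (α * h * g)‖ ≤
      ((2 * α * G + 3) * (2 * √α / α + 1)) * (2 * G + 1) := by
    refine (sum_le_card_nsmul _ _ (2 * G + 1 : ℝ) fun g _ => ?_).trans ?_
    · refine (norm_sum_le _ _).trans ?_
      simp [norm_expTwoPiI, ← hc]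
    · rw [nsmul_eq_mul]
      exact mul_le_mul_of_nonneg_right (card_round_close_le hα hs0.le G) (by positivity)
  have h2 : ∑ g ∈ filter (fun g : ℤ => ¬ |α * g - round (α * g)| ≤ √α) (Icc (-(G : ℤ)) G),
      ‖∑ h ∈ Icc (-(G : ℤ)) G, expTwoPiI (α * h * g)‖ ≤ (2 * G + 1) * (1 / (2 * √α)) := by
    refine (sum_le_card_nsmul _ _ (1 / (2 * √α)) fun g hg => ?_).trans ?_
    · have h3 := (mem_filter.mp hg).2
      push Not at h3
      have h4 := norm_sum_Icc_expTwoPiI_le (α * g) G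
      have h5 := four_mul_abs_sub_round_le (α * g)
      have h6 : ∀ h ∈ Icc (-(G : ℤ)) G, expTwoPiI (α * h * g) = expTwoPiI (α * g * h) :=
        fun h _ => by congr 1; ring
      rw [sum_congr rfl h6, le_div_iff₀ (by positivity)]
      have h7 : ‖∑ h ∈ Icc (-(G : ℤ)) G, expTwoPiI (α * g * h)‖ * (4 * √α) ≤ 2 :=
        (mul_le_mul_of_nonneg_left (by linarith) (norm_nonneg _)).trans h4
      linarith
    · rw [nsmul_eq_mul, ← hc]
      refine mul_le_mul_of_nonneg_right ?_ (by positivity)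
      exact_mod_cast card_filter_le _ _
  refine (add_le_add h1 h2).trans ?_
  have e1 : 2 * √α / α + 1 ≤ 3 / √α := by
    rw [show 2 * √α / α = 2 / √α by rw [div_eq_div_iff hα.ne' hs0.ne', mul_assoc, hss], ← sub_nonneg]
    rw [show 3 / √α - (2 / √α + 1) = (1 - √α) / √α by field_simp; ring]
    exact div_nonneg (by linarith) hs0.le
  calc (2 * α * G + 3) * (2 * √α / α + 1) * (2 * G + 1) + (2 * G + 1) * (1 / (2 * √α))
      ≤ (2 * α * G + 3) * (3 / √α) * (2 * G + 1) + (2 * G + 1) * (1 / (2 * √α)) := by gcongr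
    _ = (2 * G + 1) * (6 * α * G + 19 / 2) / √α := by field_simp; ring
    _ ≤ (3 * G) * (10 * α * G + 10) / √α := by
        gcongr
        · linarith
        · norm_num
        · norm_num
    _ = 30 * (G : ℝ) ^ 2 * (√α + 1 / (G * √α)) := by
        have hG0 : (G : ℝ) ≠ 0 := by linarith
        field_simp
        nlinarith [Real.sq_sqrt hα.le]

lemma sum_norm_sum_expTwoPiI_le {α : ℝ} (hα : α ≠ 0) (hα1 : |α| ≤ 1) {G : ℕ} (hG : 0 < G) :
    ∑ g ∈ Icc (-(G : ℤ)) G, ‖∑ h ∈ Icc (-(G : ℤ)) G, expTwoPiI (α * h * g)‖ ≤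
      30 * (G : ℝ) ^ 2 * (√|α| + 1 / (G * √|α|)) := by
  refine le_trans (le_of_eq ?_) (sum_norm_sum_expTwoPiI_le_of_pos (abs_pos.mpr hα) hα1 hG)
  rcases abs_cases α with ⟨h, -⟩ | ⟨h, -⟩
  · rw [h]
  · rw [h]
    refine sum_bij (fun g _ => -g) ?_ (by simp) ?_ ?_
    · intro g hg; rw [mem_Icc] at hg ⊢; omega
    · intro g hg; exact ⟨-g, by rw [mem_Icc] at hg ⊢; omega, by simp⟩
    · intro g _
      congr 1
      refine sum_congr rfl fun h _ => ?_
      congr 1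
      push_cast; ring

lemma one_sub_inv_pow_le {k : ℕ} (hk : 4 ≤ k) : (1 - 1 / (k : ℝ)) ^ (10 * k) ≤ 1 / 10000 := by
  have hk0 : (0 : ℝ) < k := by positivity
  have h1 : 1 - 1 / (k : ℝ) ≤ Real.exp (-(1 / k)) := by
    have := Real.add_one_le_exp (-(1 / (k : ℝ)))
    linarith
  have h0 : 0 ≤ 1 - 1 / (k : ℝ) := by
    rw [sub_nonneg, div_le_one hk0]
    exact_mod_cast (by omega : 1 ≤ k)
  refine (pow_le_pow_left₀ h0 h1 _).trans ?_
  rw [← Real.exp_nat_mul, show ((10 * k : ℕ) : ℝ) * -(1 / k) = -((10 : ℕ) * 1) by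
    push_cast; field_simp, Real.exp_neg, Real.exp_nat_mul, one_div]
  refine inv_anti₀ (by norm_num) ?_
  have h2 : (2.7182818283 : ℝ) ≤ Real.exp 1 := Real.exp_one_gt_d9.le
  calc (10000 : ℝ) ≤ 2.7182818283 ^ 10 := by norm_num
    _ ≤ _ := pow_le_pow_left₀ (by norm_num) h2 _

lemma prod_sum_norm_le {k s P : ℕ} (hs : 0 < s) (hP : 0 < P) (α : Fin k → ℝ) (J : Finset (Fin k))
    {η : ℝ} (hJ0 : ∀ j ∈ J, α j ≠ 0) (hJ1 : ∀ j ∈ J, |α j| ≤ 1)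
    (hJη : ∀ j ∈ J, √|α j| + 1 / ((s * P ^ (j.1 + 1) : ℕ) * √|α j|) ≤ η) :
    ∏ j, ∑ g ∈ Icc (-((s * P ^ (j.1 + 1) : ℕ) : ℤ)) (s * P ^ (j.1 + 1) : ℕ),
      ‖∑ h ∈ Icc (-((s * P ^ (j.1 + 1) : ℕ) : ℤ)) (s * P ^ (j.1 + 1) : ℕ),
        expTwoPiI (α j * h * g)‖ ≤
      (30 * (s : ℝ) ^ 2) ^ k * (P : ℝ) ^ (k * (k + 1)) * η ^ #J := by
  have hG : ∀ j : Fin k, 0 < s * P ^ (j.1 + 1) := fun j => by positivity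
  have h1 : ∀ j : Fin k, ∑ g ∈ Icc (-((s * P ^ (j.1 + 1) : ℕ) : ℤ)) (s * P ^ (j.1 + 1) : ℕ),
      ‖∑ h ∈ Icc (-((s * P ^ (j.1 + 1) : ℕ) : ℤ)) (s * P ^ (j.1 + 1) : ℕ),
        expTwoPiI (α j * h * g)‖ ≤
      (30 * (s : ℝ) ^ 2 * (P : ℝ) ^ (2 * (j.1 + 1))) * (if j ∈ J then η else 1) := by
    intro j
    split_ifs with hj
    · refine (sum_norm_sum_expTwoPiI_le (hJ0 j hj) (hJ1 j hj) (hG j)).trans ?_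
      have := hJη j hj
      have e : 30 * ((s * P ^ (j.1 + 1) : ℕ) : ℝ) ^ 2 = 30 * (s : ℝ) ^ 2 * (P : ℝ) ^ (2 * (j.1 + 1)) := by
        push_cast; ring
      rw [e]
      gcongr
    · refine (sum_norm_sum_expTwoPiI_le_trivial (α j) (hG j)).trans ?_
      push_cast
      rw [mul_one, show 9 * ((s : ℝ) * (P : ℝ) ^ (j.1 + 1)) ^ 2 =
        9 * ((s : ℝ) ^ 2 * (P : ℝ) ^ (2 * (j.1 + 1))) by ring]
      have : 0 ≤ (s : ℝ) ^ 2 * (P : ℝ) ^ (2 * (j.1 + 1)) := by positivity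
      linarith
  refine (prod_le_prod (fun j _ => sum_nonneg fun _ _ => norm_nonneg _) fun j _ => h1 j).trans ?_
  rw [prod_mul_distrib, prod_mul_distrib, prod_const, card_univ, Fintype.card_fin,
    prod_pow_eq_pow_sum, prod_ite_mem, univ_inter, prod_const]
  have : ∑ j : Fin k, 2 * (j.1 + 1) = k * (k + 1) := by
    rw [Fin.sum_univ_eq_sum_range (fun j => 2 * (j + 1)) k, ← mul_sum, sum_add_distrib]
    have := Finset.sum_range_id_mul_two k
    simp only [sum_const, card_range, smul_eq_mul, mul_one]
    rcases k with _ | k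
    · simp
    · simp only [Nat.add_sub_cancel] at this
      nlinarith
  rw [this]

lemma norm_bilinear_pow_le {k P : ℕ} (hk : 4 ≤ k) (hP : 0 < P) (α : Fin k → ℝ)
    (J : Finset (Fin k)) {η : ℝ} (hJ0 : ∀ j ∈ J, α j ≠ 0) (hJ1 : ∀ j ∈ J, |α j| ≤ 1)
    (hJη : ∀ j ∈ J, √|α j| + 1 / ((11 * k ^ 2 * P ^ (j.1 + 1) : ℕ) * √|α j|) ≤ η) (hη : 0 ≤ η) :
    ‖∑ y ∈ Ico (0 : ℤ) P, ∑ x ∈ Ico (0 : ℤ) P,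
      expTwoPiI (∑ j, α j * y ^ (j.1 + 1) * x ^ (j.1 + 1))‖ ^ (484 * k ^ 4) ≤
      ((P : ℝ) ^ 2 * (12 * k ^ 2)) ^ (484 * k ^ 4) *
        ((12 * (k : ℝ) ^ 2) ^ (- (484 * (k : ℝ) ^ 4 - 26 * (k : ℝ) ^ 4)) *
        (P : ℝ) ^ ((k : ℝ) * (k + 1) / 10000) * η ^ #J) := by
  have hP1 : (1 : ℝ) ≤ P := by exact_mod_cast hP
  have hP0 : (0 : ℝ) < P := by positivity
  have hk4 : (4 : ℝ) ≤ k := by exact_mod_cast hk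
  set s := 11 * k ^ 2 with hs
  have hs0 : 0 < s := by positivity
  have hrs : 10 * k * k + k ^ 2 = s := by rw [hs]; ring
  have h1 := bilinear_bound k hs0 (P := P) α
  have h2 := vinE_bound hk (10 * k) le_rfl P hP
  rw [hrs] at h2
  have h3 := prod_sum_norm_le hs0 hP α J hJ0 hJ1 hJη
  rw [show 2 * s * (2 * s) = 484 * k ^ 4 by rw [hs]; ring] at h1
  set K : ℝ := 12 * (k : ℝ) ^ 2 with hK
  have hK1 : 1 ≤ K := by rw [hK]; nlinarith
  have h2' : (vinE (Fin s) k (Ico (0 : ℤ) P) : ℝ) ≤ K ^ ((11 : ℝ) * k ^ 4) *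
      (P : ℝ) ^ (2 * (s : ℝ) - k * (k + 1) / 2 + k * (k + 1) / 2 * (1 / 10000)) := by
    refine h2.trans ?_
    refine mul_le_mul ?_ ?_ (by positivity) (by positivity)
    · rw [← Real.rpow_natCast]
      refine Real.rpow_le_rpow_of_exponent_le hK1 ?_
      push_cast
      nlinarith [pow_pos (by linarith : (0 : ℝ) < k) 3]
    · refine Real.rpow_le_rpow_of_exponent_le hP1 ?_
      have := one_sub_inv_pow_le hk
      gcongr
  have hK30 : (30 * (s : ℝ) ^ 2) ^ k ≤ K ^ ((4 : ℝ) * k ^ 4) := by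
    have e1 : 30 * (s : ℝ) ^ 2 ≤ K ^ 4 := by
      rw [hs, hK]; push_cast
      have : (1 : ℝ) ≤ k ^ 4 := one_le_pow₀ (by linarith)
      have h4 : (0 : ℝ) < k ^ 4 := by positivity
      calc (30 * (11 * (k : ℝ) ^ 2) ^ 2 : ℝ) = 3630 * (k : ℝ) ^ 4 * 1 := by ring
        _ ≤ 20736 * (k : ℝ) ^ 4 * (k : ℝ) ^ 4 := by gcongr; norm_num
        _ = _ := by ring
    calc (30 * (s : ℝ) ^ 2) ^ k ≤ (K ^ 4) ^ k := by gcongr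
      _ = K ^ ((4 * k : ℕ) : ℝ) := by rw [Real.rpow_natCast, pow_mul]
      _ ≤ _ := by
        refine Real.rpow_le_rpow_of_exponent_le hK1 ?_
        push_cast
        have : (1 : ℝ) ≤ k ^ 3 := one_le_pow₀ (by linarith)
        nlinarith
  refine h1.trans ?_
  calc (P : ℝ) ^ ((2 * s - 1) * (4 * s)) * (vinE (Fin s) k (Ico (0 : ℤ) P) : ℝ) ^ 2 * _
      ≤ (P : ℝ) ^ ((2 * s - 1) * (4 * s)) * (K ^ ((11 : ℝ) * k ^ 4) *
      (P : ℝ) ^ (2 * (s : ℝ) - k * (k + 1) / 2 + k * (k + 1) / 2 * (1 / 10000))) ^ 2 *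
      (K ^ ((4 : ℝ) * k ^ 4) * (P : ℝ) ^ (k * (k + 1)) * η ^ #J) := by
        gcongr
        refine h3.trans ?_
        gcongr
    _ = ((P : ℝ) ^ ((2 * s - 1) * (4 * s)) * ((P : ℝ) ^ (2 * (s : ℝ) - k * (k + 1) / 2 + k * (k + 1) / 2 * (1 / 10000))) ^ 2 * (P : ℝ) ^ (k * (k + 1))) *
      ((K ^ ((11 : ℝ) * k ^ 4)) ^ 2 * K ^ ((4 : ℝ) * k ^ 4)) * η ^ #J := by ring
    _ = _ := by
      have eP : (P : ℝ) ^ ((2 * s - 1) * (4 * s)) * ((P : ℝ) ^ (2 * (s : ℝ) - k * (k + 1) / 2 + k * (k + 1) / 2 * (1 / 10000))) ^ 2 * (P : ℝ) ^ (k * (k + 1)) =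
        ((P : ℝ) ^ 2) ^ (484 * k ^ 4) * (P : ℝ) ^ ((k : ℝ) * (k + 1) / 10000) := by
        rw [← Real.rpow_natCast, ← Real.rpow_natCast (_ ^ _) 2, ← Real.rpow_natCast _ (k * (k + 1)),
          ← pow_mul, ← Real.rpow_natCast _ (2 * _), ← Real.rpow_mul hP0.le, ← Real.rpow_add hP0,
          ← Real.rpow_add hP0, ← Real.rpow_add hP0]
        congr 1
        have hc : ((2 * s - 1 : ℕ) : ℝ) = 2 * (s : ℝ) - 1 := by
          rw [Nat.cast_sub (by omega)]; push_cast; ring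
        have hsr : (s : ℝ) = 11 * (k : ℝ) ^ 2 := by rw [hs]; push_cast; ring
        rw [Nat.cast_mul (2 * s - 1), hc]
        push_cast
        rw [hsr]
        ring
      have eK : (K ^ ((11 : ℝ) * k ^ 4)) ^ 2 * K ^ ((4 : ℝ) * k ^ 4) =
        K ^ (484 * k ^ 4) * K ^ (- (484 * (k : ℝ) ^ 4 - 26 * (k : ℝ) ^ 4)) := by
        have hK0 : 0 < K := by linarith
        rw [← Real.rpow_natCast (_ ^ _) 2, ← Real.rpow_natCast _ (484 * _), ← Real.rpow_mul hK0.le,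
          ← Real.rpow_add hK0, ← Real.rpow_add hK0]
        congr 1
        push_cast
        ring
      rw [eP, eK, mul_pow]
      ring

lemma phase_coeff_le {κ q : ℕ} {N n t : ℝ} (hN : 1 ≤ N) (hn : N ≤ n)
    (ht : t ≤ N ^ ((κ : ℝ) + 1)) (hq : 2 * κ + 1 ≤ q) :
    t / (2 * Real.pi * q * n ^ q) ≤ N ^ (-(κ : ℝ)) := by
  have hN0 : 0 < N := by linarith
  have hq1 : (1 : ℝ) ≤ q := by exact_mod_cast (by omega : 1 ≤ q)
  have h1 : N ^ (2 * κ + 1) ≤ n ^ q :=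
    (pow_le_pow_right₀ hN hq).trans (pow_le_pow_left₀ hN0.le hn q)
  have h2 : N ^ (2 * κ + 1) ≤ 2 * Real.pi * q * n ^ q := by
    have h3 : 1 ≤ 2 * Real.pi * q := by nlinarith [Real.pi_gt_three]
    nlinarith [pow_pos hN0 (2 * κ + 1)]
  have h4 : (0 : ℝ) < N ^ (2 * κ + 1) := by positivity
  calc t / (2 * Real.pi * q * n ^ q) ≤ N ^ ((κ : ℝ) + 1) / N ^ (2 * κ + 1) := by gcongr
    _ = N ^ (-(κ : ℝ)) := by
      rw [← Real.rpow_natCast N (2 * κ + 1), ← Real.rpow_sub hN0]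
      congr 1; push_cast; ring

lemma le_phase_coeff {κ q s P : ℕ} {N n t : ℝ} (hκ : 1 ≤ κ) (hN : 1 ≤ N) (hn : N ≤ n) (hn2 : n ≤ 2 * N)
    (ht : N ^ ((κ : ℝ) - 1 / 3) ≤ t) (hq0 : 1 ≤ q) (hq : q ≤ 3 * κ)
    (hP : N ^ ((2 : ℝ) / 5) / 2 ≤ P) (hs : 2 * Real.pi * q ≤ (s : ℝ) ^ 2) :
    (N ^ ((κ : ℝ) / 30) / 32 ^ κ) ^ 2 ≤ ((s * P ^ q : ℕ) : ℝ) ^ 2 * (t / (2 * Real.pi * q * n ^ q)) := by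
  have hN0 : 0 < N := by linarith
  have hn0 : 0 < n := by linarith
  have hq1 : (1 : ℝ) ≤ q := by exact_mod_cast hq0
  have hq2 : (q : ℝ) ≤ 3 * κ := by exact_mod_cast hq
  have hκ1 : (1 : ℝ) ≤ κ := by exact_mod_cast hκ
  have hd : 0 < 2 * Real.pi * q := by positivity
  have ht0 : 0 < t := lt_of_lt_of_le (by positivity) ht
  calc (N ^ ((κ : ℝ) / 30) / 32 ^ κ) ^ 2 = N ^ ((κ : ℝ) / 15) / 1024 ^ κ := by
        rw [div_pow, ← Real.rpow_natCast (N ^ _) 2, ← Real.rpow_mul hN0.le, ← pow_mul, mul_comm κ 2,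
          pow_mul]
        norm_num
        congr 1; ring
    _ ≤ N ^ (4 * (q : ℝ) / 5 + ((κ : ℝ) - 1 / 3) - q) / 512 ^ κ := by
        gcongr
        · linarith
        · norm_num
    _ = N ^ (4 * (q : ℝ) / 5 + ((κ : ℝ) - 1 / 3) - q) / 8 ^ (3 * κ) := by rw [pow_mul]; norm_num
    _ ≤ N ^ (4 * (q : ℝ) / 5 + ((κ : ℝ) - 1 / 3) - q) / 8 ^ q := by
        gcongr
        norm_num
    _ = ((N ^ ((2 : ℝ) / 5) / 2) ^ q) ^ 2 * (N ^ ((κ : ℝ) - 1 / 3) / (2 * N) ^ q) := by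
        rw [Real.rpow_sub hN0, Real.rpow_add hN0, div_pow, div_pow, ← pow_mul, ← pow_mul,
          ← Real.rpow_natCast (N ^ _) (q * 2), ← Real.rpow_mul hN0.le, mul_pow,
          show (8 : ℝ) = 2 ^ 3 by norm_num, ← pow_mul, Real.rpow_natCast N q,
          show 2 / 5 * ((q * 2 : ℕ) : ℝ) = 4 * (q : ℝ) / 5 by push_cast; ring]
        field_simp
        ring
    _ ≤ ((P : ℝ) ^ q) ^ 2 * (t / n ^ q) := by gcongr
    _ ≤ (P ^ q : ℝ) ^ 2 * (t / n ^ q) * ((s : ℝ) ^ 2 / (2 * Real.pi * q)) := by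
        refine le_mul_of_one_le_right (by positivity) ?_
        rwa [one_le_div hd]
    _ = _ := by push_cast; field_simp

lemma sqrt_phase_coeff_le {κ q s P : ℕ} {N n t : ℝ} (hκ : 1 ≤ κ) (hN : 1 ≤ N) (hn : N ≤ n)
    (hn2 : n ≤ 2 * N) (ht : N ^ ((κ : ℝ) - 1 / 3) ≤ t) (ht' : t ≤ N ^ ((κ : ℝ) + 1))
    (hq0 : 2 * κ + 1 ≤ q) (hq : q ≤ 3 * κ)
    (hP : N ^ ((2 : ℝ) / 5) / 2 ≤ P) (hs : 2 * Real.pi * q ≤ (s : ℝ) ^ 2) :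
    √(t / (2 * Real.pi * q * n ^ q)) + 1 / (((s * P ^ q : ℕ) : ℝ) * √(t / (2 * Real.pi * q * n ^ q)))
      ≤ 64 ^ κ * N ^ (-((κ : ℝ) / 30)) := by
  have hN0 : 0 < N := by linarith
  have ht0 : 0 < t := lt_of_lt_of_le (by positivity) ht
  have hκ1 : (1 : ℝ) ≤ κ := by exact_mod_cast hκ
  have h1 := phase_coeff_le hN hn ht' hq0
  have h2 := le_phase_coeff hκ hN hn hn2 ht (by omega) hq hP hs
  set a := t / (2 * Real.pi * q * n ^ q)
  have e1 : √a ≤ 1 * N ^ (-((κ : ℝ) / 30)) := by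
    rw [one_mul]
    refine Real.sqrt_le_iff.mpr ⟨by positivity, h1.trans ?_⟩
    rw [← Real.rpow_natCast (N ^ _) 2, ← Real.rpow_mul hN0.le]
    refine Real.rpow_le_rpow_of_exponent_le hN ?_
    push_cast
    linarith
  have h3 : N ^ ((κ : ℝ) / 30) / 32 ^ κ ≤ ((s * P ^ q : ℕ) : ℝ) * √a := by
    have h4 := Real.sqrt_le_sqrt h2
    rwa [Real.sqrt_sq (by positivity), Real.sqrt_mul (by positivity), Real.sqrt_sq (by positivity)]
      at h4
  have e2 : 1 / (((s * P ^ q : ℕ) : ℝ) * √a) ≤ 32 ^ κ * N ^ (-((κ : ℝ) / 30)) := by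
    refine (one_div_le_one_div_of_le (by positivity) h3).trans (le_of_eq ?_)
    rw [Real.rpow_neg hN0.le]
    field_simp
  have e3 : (1 : ℝ) + 32 ^ κ ≤ 64 ^ κ := by
    have : (1 : ℝ) ≤ 32 ^ κ := one_le_pow₀ (by norm_num)
    have h2 : (2 : ℝ) ≤ 2 ^ κ := by
      calc (2 : ℝ) = 2 ^ 1 := by norm_num
        _ ≤ 2 ^ κ := pow_le_pow_right₀ (by norm_num) hκ
    have h64 : (64 : ℝ) ^ κ = 32 ^ κ * 2 ^ κ := by rw [← mul_pow]; norm_num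
    rw [h64]; nlinarith
  calc _ ≤ 1 * N ^ (-((κ : ℝ) / 30)) + 32 ^ κ * N ^ (-((κ : ℝ) / 30)) := add_le_add e1 e2
    _ = (1 + 32 ^ κ) * N ^ (-((κ : ℝ) / 30)) := by ring
    _ ≤ _ := by gcongr

lemma vin_saving_exponent {κ P : ℕ} {N : ℝ} (hκ : 1 ≤ κ) (hN : 1 ≤ N) (hP0 : 0 < P)
    (hP : (P : ℝ) ≤ N ^ ((2 : ℝ) / 5)) :
    (12 * ((15 * κ : ℕ) : ℝ) ^ 2) ^ (-(484 * ((15 * κ : ℕ) : ℝ) ^ 4 - 26 * ((15 * κ : ℕ) : ℝ) ^ 4)) *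
      (P : ℝ) ^ (((15 * κ : ℕ) : ℝ) * (((15 * κ : ℕ) : ℝ) + 1) / 10000) *
        (64 ^ κ * N ^ (-((κ : ℝ) / 30))) ^ κ ≤ N ^ (-((κ : ℝ) ^ 2 / 50)) := by
  have hN0 : 0 < N := by linarith
  have hκ1 : (1 : ℝ) ≤ κ := by exact_mod_cast hκ
  have hK : (64 : ℝ) ≤ 12 * ((15 * κ : ℕ) : ℝ) ^ 2 := by push_cast; nlinarith
  set K : ℝ := 12 * ((15 * κ : ℕ) : ℝ) ^ 2
  have hK0 : 0 < K := by linarith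
  have e1 : K ^ (-(484 * ((15 * κ : ℕ) : ℝ) ^ 4 - 26 * ((15 * κ : ℕ) : ℝ) ^ 4)) ≤ K ^ (-((κ : ℝ) ^ 2)) := by
    refine Real.rpow_le_rpow_of_exponent_le (by linarith) ?_
    push_cast
    nlinarith [pow_le_pow_right₀ hκ1 (by norm_num : 2 ≤ 4)]
  have e2 : (P : ℝ) ^ (((15 * κ : ℕ) : ℝ) * (((15 * κ : ℕ) : ℝ) + 1) / 10000) ≤
      N ^ ((κ : ℝ) ^ 2 / 100) := by
    calc _ ≤ (N ^ ((2 : ℝ) / 5)) ^ (((15 * κ : ℕ) : ℝ) * (((15 * κ : ℕ) : ℝ) + 1) / 10000) := by gcongr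
      _ = N ^ ((2 : ℝ) / 5 * (((15 * κ : ℕ) : ℝ) * (((15 * κ : ℕ) : ℝ) + 1) / 10000)) := by
        rw [Real.rpow_mul hN0.le]
      _ ≤ _ := by
        refine Real.rpow_le_rpow_of_exponent_le hN ?_
        push_cast
        nlinarith
  have e3 : (64 ^ κ * N ^ (-((κ : ℝ) / 30))) ^ κ ≤ K ^ ((κ : ℝ) ^ 2) * N ^ (-((κ : ℝ) ^ 2 / 30)) := by
    rw [mul_pow, ← pow_mul, ← Real.rpow_natCast (N ^ _), ← Real.rpow_mul hN0.le]
    refine mul_le_mul ?_ (le_of_eq (by congr 1; ring)) (by positivity) (by positivity)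
    rw [← Real.rpow_natCast]
    calc (64 : ℝ) ^ ((κ * κ : ℕ) : ℝ) ≤ K ^ ((κ * κ : ℕ) : ℝ) := by gcongr
      _ = _ := by congr 1; push_cast; ring
  calc _ ≤ K ^ (-((κ : ℝ) ^ 2)) * N ^ ((κ : ℝ) ^ 2 / 100) *
        (K ^ ((κ : ℝ) ^ 2) * N ^ (-((κ : ℝ) ^ 2 / 30))) := by gcongr
    _ = (K ^ (-((κ : ℝ) ^ 2)) * K ^ ((κ : ℝ) ^ 2)) * (N ^ ((κ : ℝ) ^ 2 / 100) *
         N ^ (-((κ : ℝ) ^ 2 / 30))) := by ring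
    _ = N ^ ((κ : ℝ) ^ 2 / 100 + -((κ : ℝ) ^ 2 / 30)) := by
      rw [← Real.rpow_add hK0, ← Real.rpow_add hN0]; simp
    _ ≤ _ := by
      refine Real.rpow_le_rpow_of_exponent_le hN ?_
      nlinarith

lemma norm_bilinear_phase_le {κ P : ℕ} {N n t : ℝ} (hκ : 1 ≤ κ) (hN : 1 ≤ N) (hn : N ≤ n)
    (hn2 : n ≤ 2 * N) (ht : N ^ ((κ : ℝ) - 1 / 3) ≤ t) (ht' : t ≤ N ^ ((κ : ℝ) + 1)) (hP0 : 0 < P)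
    (hP : N ^ ((2 : ℝ) / 5) / 2 ≤ P) (hP' : (P : ℝ) ≤ N ^ ((2 : ℝ) / 5)) :
    ‖∑ y ∈ Ico (0 : ℤ) P, ∑ x ∈ Ico (0 : ℤ) P,
      expTwoPiI (∑ j : Fin (15 * κ), (-1) ^ (j.1 + 1) * (t / (2 * Real.pi * (j.1 + 1 : ℕ) * n ^ (j.1 + 1))) *
        y ^ (j.1 + 1) * x ^ (j.1 + 1))‖ ≤
      (P : ℝ) ^ 2 * (2700 * (κ : ℝ) ^ 2) * N ^ (-(1 / (1225125000 * (κ : ℝ) ^ 2))) := by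
  have hN0 : 0 < N := by linarith
  have hn0 : 0 < n := by linarith
  have ht0 : 0 < t := lt_of_lt_of_le (by positivity) ht
  have hκ1 : (1 : ℝ) ≤ κ := by exact_mod_cast hκ
  set α : Fin (15 * κ) → ℝ :=
    fun j => (-1) ^ (j.1 + 1) * (t / (2 * Real.pi * (j.1 + 1 : ℕ) * n ^ (j.1 + 1))) with hα
  have habs : ∀ j, |α j| = t / (2 * Real.pi * (j.1 + 1 : ℕ) * n ^ (j.1 + 1)) := by
    intro j
    rw [hα, abs_mul, abs_pow, abs_neg, abs_one, one_pow, one_mul, abs_of_nonneg (by positivity)]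
  set J : Finset (Fin (15 * κ)) := (Finset.Ico (2 * κ) (3 * κ)).attachFin
    (fun a ha => by rw [Finset.mem_Ico] at ha; omega) with hJ
  have hJc : #J = κ := by rw [hJ, card_attachFin, Nat.card_Ico]; omega
  have hJm : ∀ j ∈ J, 2 * κ + 1 ≤ j.1 + 1 ∧ j.1 + 1 ≤ 3 * κ := by
    intro j hj
    rw [hJ, mem_attachFin, Finset.mem_Ico] at hj
    omega
  have h := norm_bilinear_pow_le (by omega : 4 ≤ 15 * κ) hP0 α J
    (η := 64 ^ κ * N ^ (-((κ : ℝ) / 30))) ?_ ?_ ?_ (by positivity)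
  · rw [hJc] at h
    have h2 := h.trans (mul_le_mul_of_nonneg_left (vin_saving_exponent hκ hN hP0 hP') (by positivity))
    set M := 484 * (15 * κ) ^ 4 with hM
    have hM0 : M ≠ 0 := by positivity
    refine le_of_pow_le_pow_left₀ hM0 (by positivity) (h2.trans (le_of_eq ?_))
    rw [mul_pow _ (N ^ _) M, ← Real.rpow_natCast (N ^ _) M, ← Real.rpow_mul hN0.le]
    congr 1
    · congr 1; push_cast; ring
    · congr 1
      rw [hM]; push_cast; field_simp; norm_num
  · intro j _
    rw [← abs_pos, habs]
    positivity
  · intro j hj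
    rw [habs]
    refine (phase_coeff_le hN hn ht' (hJm j hj).1).trans ?_
    exact Real.rpow_le_one_of_one_le_of_nonpos hN (by linarith)
  · intro j hj
    rw [habs]
    refine sqrt_phase_coeff_le hκ hN hn hn2 ht ht' (hJm j hj).1 (hJm j hj).2 hP ?_
    have h1 : ((j.1 + 1 : ℕ) : ℝ) ≤ 3 * κ := by exact_mod_cast (hJm j hj).2
    push_cast at h1 ⊢
    have h2 := Real.pi_lt_four
    calc 2 * Real.pi * ((j.1 : ℝ) + 1) ≤ 2 * 4 * (3 * κ) := by gcongr
      _ ≤ 24 * (κ : ℝ) ^ 4 := by nlinarith [le_self_pow₀ hκ1 (by norm_num : 4 ≠ 0)]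
      _ ≤ _ := by nlinarith [pow_pos (by linarith : (0 : ℝ) < κ) 4]

lemma norm_expTwoPiI_sub_le (a b : ℝ) : ‖expTwoPiI a - expTwoPiI b‖ ≤ 2 * Real.pi * |a - b| := by
  have h : expTwoPiI a = expTwoPiI b * expTwoPiI (a - b) := by rw [← expTwoPiI_add]; congr 1; ring
  rw [h, show expTwoPiI b * expTwoPiI (a - b) - expTwoPiI b =
    expTwoPiI b * (expTwoPiI (a - b) - 1) by ring, norm_mul, norm_expTwoPiI, one_mul, expTwoPiI,
    mul_comm _ Complex.I]
  refine (Real.norm_exp_I_mul_ofReal_sub_one_le).trans (le_of_eq ?_)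
  rw [Real.norm_eq_abs, abs_mul, abs_of_pos Real.two_pi_pos]

lemma abs_log_one_add_add_sum_le {u : ℝ} (hu0 : 0 ≤ u) (hu : u ≤ 1 / 2) (k : ℕ) :
    |Real.log (1 + u) + ∑ j ∈ range k, (-1) ^ (j + 1) * u ^ (j + 1) / (j + 1)| ≤
      2 * u ^ (k + 1) := by
  have h := Real.abs_log_sub_add_sum_range_le (x := -u) (by rw [abs_neg, abs_of_nonneg hu0]; linarith) k
  rw [abs_neg, abs_of_nonneg hu0, sub_neg_eq_add, add_comm] at h
  have e : ∀ j ∈ range k, (-u) ^ (j + 1) / ((j : ℝ) + 1) = (-1) ^ (j + 1) * u ^ (j + 1) / (j + 1) :=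
    fun j _ => by rw [neg_pow u]
  rw [sum_congr rfl e] at h
  refine h.trans ?_
  rw [div_le_iff₀ (by linarith)]
  nlinarith [pow_nonneg hu0 (k + 1)]

lemma norm_sum_Ioc_sub_sum_shift_le (φ : ℝ → ℂ) (hφ : ∀ x, ‖φ x‖ ≤ 1) {N N' : ℕ} (hN : N ≤ N')
    (h : ℕ) : ‖∑ n ∈ Ioc N N', φ n - ∑ n ∈ Ioc N N', φ (n + h)‖ ≤ 2 * h := by
  induction h with
  | zero => simp
  | succ h ih =>
    have tel : ∀ M, N ≤ M → ∑ n ∈ Ioc N M, φ (n + (h + 1 : ℕ)) - ∑ n ∈ Ioc N M, φ (n + h) =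
        φ (M + (h + 1 : ℕ)) - φ (N + (h + 1 : ℕ)) := by
      intro M hM
      induction M, hM using Nat.le_induction with
      | base => simp
      | succ M hM ih2 =>
        rw [← Finset.insert_Ioc_right_eq_Ioc_add_one hM, sum_insert (by simp), sum_insert (by simp)]
        rw [show φ ((M + 1 : ℕ) + (h + 1 : ℕ)) + ∑ n ∈ Ioc N M, φ (n + (h + 1 : ℕ)) -
          (φ ((M + 1 : ℕ) + h) + ∑ n ∈ Ioc N M, φ (n + h)) =
          φ ((M + 1 : ℕ) + (h + 1 : ℕ)) - φ ((M + 1 : ℕ) + h) +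
          (∑ n ∈ Ioc N M, φ (n + (h + 1 : ℕ)) - ∑ n ∈ Ioc N M, φ (n + h)) by ring, ih2]
        rw [show (((M + 1 : ℕ) : ℝ) + h) = (M : ℝ) + (h + 1 : ℕ) by push_cast; ring]
        ring
    have h1 := tel N' hN
    have h2 : ‖φ (N' + (h + 1 : ℕ)) - φ (N + (h + 1 : ℕ))‖ ≤ 2 := by
      refine (norm_sub_le _ _).trans ?_
      linarith [hφ (N' + (h + 1 : ℕ)), hφ (N + (h + 1 : ℕ))]
    calc _ = ‖(∑ n ∈ Ioc N N', φ n - ∑ n ∈ Ioc N N', φ (n + h)) -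
          (∑ n ∈ Ioc N N', φ (n + (h + 1 : ℕ)) - ∑ n ∈ Ioc N N', φ (n + h))‖ := by congr 1; ring
      _ ≤ 2 * h + 2 := by rw [h1] at *; exact (norm_sub_le _ _).trans (add_le_add ih h2)
      _ = _ := by push_cast; ring

/-- The phase `z ↦ z ^ (-it)`. -/
noncomputable def logPhase (t z : ℝ) : ℂ := expTwoPiI (-(t / (2 * Real.pi)) * Real.log z)

lemma norm_logPhase (t z : ℝ) : ‖logPhase t z‖ = 1 := norm_expTwoPiI _

lemma norm_logPhase_add_sub_le {t n x y : ℝ} (ht : 0 ≤ t) (hn : 0 < n) (h0 : 0 ≤ y * x)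
    (h1 : y * x / n ≤ 1 / 2) (k : ℕ) :
    ‖logPhase t (n + y * x) - logPhase t n * expTwoPiI (∑ j : Fin k, (-1) ^ (j.1 + 1) *
      (t / (2 * Real.pi * (j.1 + 1 : ℕ) * n ^ (j.1 + 1))) * y ^ (j.1 + 1) * x ^ (j.1 + 1))‖ ≤
      2 * t * (y * x / n) ^ (k + 1) := by
  have hu0 : 0 ≤ y * x / n := by positivity
  have h2 := abs_log_one_add_add_sum_le hu0 h1 k
  rw [logPhase, logPhase, ← expTwoPiI_add]
  refine (norm_expTwoPiI_sub_le _ _).trans ?_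
  have e1 : Real.log (n + y * x) = Real.log n + Real.log (1 + y * x / n) := by
    rw [← Real.log_mul hn.ne' (by positivity)]
    congr 1; field_simp
  have e2 : ∑ j : Fin k, (-1 : ℝ) ^ (j.1 + 1) *
      (t / (2 * Real.pi * (j.1 + 1 : ℕ) * n ^ (j.1 + 1))) * y ^ (j.1 + 1) * x ^ (j.1 + 1) =
      (t / (2 * Real.pi)) * ∑ j ∈ range k, (-1) ^ (j + 1) * (y * x / n) ^ (j + 1) / (j + 1) := by
    rw [Fin.sum_univ_eq_sum_range (fun j => (-1 : ℝ) ^ (j + 1) *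
      (t / (2 * Real.pi * (j + 1 : ℕ) * n ^ (j + 1))) * y ^ (j + 1) * x ^ (j + 1)) k, mul_sum]
    refine sum_congr rfl fun j _ => ?_
    rw [div_pow, mul_pow]
    push_cast
    field_simp
  rw [e2, e1, show -(t / (2 * Real.pi)) * (Real.log n + Real.log (1 + y * x / n)) -
    (-(t / (2 * Real.pi)) * Real.log n + (t / (2 * Real.pi)) * ∑ j ∈ range k, (-1) ^ (j + 1) * (y * x / n) ^ (j + 1) / (j + 1)) =
    -((t / (2 * Real.pi)) * (Real.log (1 + y * x / n) + ∑ j ∈ range k, (-1) ^ (j + 1) * (y * x / n) ^ (j + 1) / (j + 1))) by ring,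
    abs_neg, abs_mul, abs_of_nonneg (by positivity)]
  calc _ = t * |Real.log (1 + y * x / n) + ∑ j ∈ range k, (-1) ^ (j + 1) * (y * x / n) ^ (j + 1) / (j + 1)| := by
        field_simp
    _ ≤ t * (2 * (y * x / n) ^ (k + 1)) := by gcongr
    _ = _ := by ring

lemma taylor_error_le {κ P : ℕ} {N n t x y : ℝ} (hκ : 1 ≤ κ) (hN : 32 ≤ N) (hn : N ≤ n)
    (ht' : t ≤ N ^ ((κ : ℝ) + 1)) (hP' : (P : ℝ) ≤ N ^ ((2 : ℝ) / 5))
    (hx : 0 ≤ x) (hx' : x ≤ P) (hy : 0 ≤ y) (hy' : y ≤ P) :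
    y * x / n ≤ 1 / 2 ∧ 2 * t * (y * x / n) ^ (15 * κ + 1) ≤ 2 * N ^ (-(1 : ℝ)) := by
  have hN0 : 0 < N := by linarith
  have hn0 : 0 < n := by linarith
  have hκ1 : (1 : ℝ) ≤ κ := by exact_mod_cast hκ
  have h1 : y * x / n ≤ N ^ (-(1 / 5 : ℝ)) := by
    calc y * x / n ≤ N ^ ((2 : ℝ) / 5) * N ^ ((2 : ℝ) / 5) / N := by
          gcongr <;> linarith
      _ = _ := by
        rw [← Real.rpow_add hN0]
        nth_rw 2 [← Real.rpow_one N]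
        rw [← Real.rpow_sub hN0]
        norm_num
  have h0 : 0 ≤ y * x / n := by positivity
  constructor
  · refine h1.trans ?_
    calc N ^ (-(1 / 5 : ℝ)) ≤ 32 ^ (-(1 / 5 : ℝ)) :=
          Real.rpow_le_rpow_of_nonpos (by norm_num) hN (by norm_num)
      _ = 1 / 2 := by
        rw [show (32 : ℝ) = 2 ^ (5 : ℝ) by norm_num, ← Real.rpow_mul (by norm_num)]
        norm_num
  · calc 2 * t * (y * x / n) ^ (15 * κ + 1) ≤
          2 * N ^ ((κ : ℝ) + 1) * (N ^ (-(1 / 5 : ℝ))) ^ (15 * κ + 1) := by gcongr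
      _ = 2 * N ^ ((κ : ℝ) + 1 + -(1 / 5 : ℝ) * (15 * κ + 1 : ℕ)) := by
        rw [Real.rpow_add hN0 ((κ : ℝ) + 1), Real.rpow_mul hN0.le, Real.rpow_natCast]; ring
      _ ≤ _ := by
        gcongr
        · linarith
        · push_cast; linarith

lemma norm_double_sum_logPhase_le {κ P : ℕ} {N n t : ℝ} (hκ : 1 ≤ κ) (hN : 32 ≤ N) (hn : N ≤ n)
    (hn2 : n ≤ 2 * N) (ht : N ^ ((κ : ℝ) - 1 / 3) ≤ t) (ht' : t ≤ N ^ ((κ : ℝ) + 1)) (hP0 : 0 < P)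
    (hP : N ^ ((2 : ℝ) / 5) / 2 ≤ P) (hP' : (P : ℝ) ≤ N ^ ((2 : ℝ) / 5)) :
    ‖∑ y ∈ Ico (0 : ℤ) P, ∑ x ∈ Ico (0 : ℤ) P, logPhase t (n + y * x)‖ ≤
      (P : ℝ) ^ 2 * (2702 * (κ : ℝ) ^ 2) * N ^ (-(1 / (1225125000 * (κ : ℝ) ^ 2))) := by
  have hN0 : 0 < N := by linarith
  have hn0 : 0 < n := by linarith
  have hκ1 : (1 : ℝ) ≤ κ := by exact_mod_cast hκ
  have ht0 : 0 < t := lt_of_lt_of_le (by positivity) ht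
  have h1 := norm_bilinear_phase_le hκ (by linarith) hn hn2 ht ht' hP0 hP hP'
  set F : ℤ → ℤ → ℂ := fun y x => expTwoPiI (∑ j : Fin (15 * κ), (-1) ^ (j.1 + 1) *
    (t / (2 * Real.pi * (j.1 + 1 : ℕ) * n ^ (j.1 + 1))) * y ^ (j.1 + 1) * x ^ (j.1 + 1)) with hF
  have h2 : ∀ y ∈ Ico (0 : ℤ) P, ∀ x ∈ Ico (0 : ℤ) P,
      ‖logPhase t (n + y * x) - logPhase t n * F y x‖ ≤ 2 * N ^ (-(1 : ℝ)) := by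
    intro y hy x hx
    rw [mem_Ico] at hx hy
    have hx0 : (0 : ℝ) ≤ x := by exact_mod_cast hx.1
    have hy0 : (0 : ℝ) ≤ y := by exact_mod_cast hy.1
    have hx1 : (x : ℝ) ≤ P := by exact_mod_cast hx.2.le
    have hy1 : (y : ℝ) ≤ P := by exact_mod_cast hy.2.le
    obtain ⟨e1, e2⟩ := taylor_error_le hκ hN hn ht' hP' hx0 hx1 hy0 hy1
    exact (norm_logPhase_add_sub_le ht0.le hn0 (by positivity) e1 (15 * κ)).trans e2
  have h3 : ‖∑ y ∈ Ico (0 : ℤ) P, ∑ x ∈ Ico (0 : ℤ) P, logPhase t (n + y * x) -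
      logPhase t n * ∑ y ∈ Ico (0 : ℤ) P, ∑ x ∈ Ico (0 : ℤ) P, F y x‖ ≤
      (P : ℝ) ^ 2 * (2 * N ^ (-(1 : ℝ))) := by
    simp_rw [mul_sum, ← sum_sub_distrib]
    refine (norm_sum_le_of_le _ fun y hy => norm_sum_le_of_le _ fun x hx => h2 y hy x hx).trans ?_
    simp only [sum_const, Int.card_Ico, nsmul_eq_mul, sub_zero, Int.toNat_natCast]
    rw [sq, mul_assoc]
  have h4 : N ^ (-(1 : ℝ)) ≤ N ^ (-(1 / (1225125000 * (κ : ℝ) ^ 2))) := by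
    refine Real.rpow_le_rpow_of_exponent_le (by linarith) ?_
    rw [neg_le_neg_iff, div_le_one (by positivity)]
    nlinarith
  have h5 : ‖logPhase t n * ∑ y ∈ Ico (0 : ℤ) P, ∑ x ∈ Ico (0 : ℤ) P, F y x‖ ≤
      (P : ℝ) ^ 2 * (2700 * (κ : ℝ) ^ 2) * N ^ (-(1 / (1225125000 * (κ : ℝ) ^ 2))) := by
    rw [norm_mul, norm_logPhase, one_mul]
    exact h1
  have h6 := norm_le_norm_sub_add (∑ y ∈ Ico (0 : ℤ) P, ∑ x ∈ Ico (0 : ℤ) P, logPhase t (n + y * x))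
    (logPhase t n * ∑ y ∈ Ico (0 : ℤ) P, ∑ x ∈ Ico (0 : ℤ) P, F y x)
  have h7 : (P : ℝ) ^ 2 * (2 * N ^ (-(1 : ℝ))) ≤
      (P : ℝ) ^ 2 * (2 * (κ : ℝ) ^ 2 * N ^ (-(1 / (1225125000 * (κ : ℝ) ^ 2)))) := by
    gcongr
    nlinarith
  linarith

lemma norm_sum_logPhase_le_of_double_sum {N N' P : ℕ} {t D : ℝ} (hN : N ≤ N') (hN' : N' ≤ 2 * N)
    (hP : 0 < P) (hD : ∀ n ∈ Ioc N N', ‖∑ y ∈ Ico (0 : ℤ) P, ∑ x ∈ Ico (0 : ℤ) P,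
      logPhase t (n + y * x)‖ ≤ (P : ℝ) ^ 2 * D) (hD0 : 0 ≤ D) :
    ‖∑ n ∈ Ioc N N', logPhase t n‖ ≤ N * D + 2 * (P : ℝ) ^ 2 := by
  set S := ∑ n ∈ Ioc N N', logPhase t n
  have hP0 : (0 : ℝ) < P := by exact_mod_cast hP
  have h1 : ∀ y ∈ Ico (0 : ℤ) P, ∀ x ∈ Ico (0 : ℤ) P,
      ‖S - ∑ n ∈ Ioc N N', logPhase t (n + y * x)‖ ≤ 2 * (P : ℝ) ^ 2 := by
    intro y hy x hx
    rw [mem_Ico] at hx hy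
    lift x to ℕ using hx.1
    lift y to ℕ using hy.1
    have := norm_sum_Ioc_sub_sum_shift_le (logPhase t) (fun z => (norm_logPhase t z).le) hN (y * x)
    push_cast at this ⊢
    refine this.trans ?_
    have hx1 : (x : ℝ) ≤ P := by exact_mod_cast hx.2.le
    have hy1 : (y : ℝ) ≤ P := by exact_mod_cast hy.2.le
    rw [sq]
    gcongr
  have h2 : ‖(P : ℂ) ^ 2 * S - ∑ n ∈ Ioc N N', ∑ y ∈ Ico (0 : ℤ) P, ∑ x ∈ Ico (0 : ℤ) P,
      logPhase t (n + y * x)‖ ≤ (P : ℝ) ^ 2 * (2 * (P : ℝ) ^ 2) := by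
    have e : (P : ℂ) ^ 2 * S - ∑ n ∈ Ioc N N', ∑ y ∈ Ico (0 : ℤ) P, ∑ x ∈ Ico (0 : ℤ) P,
      logPhase t (n + y * x) = ∑ y ∈ Ico (0 : ℤ) P, ∑ x ∈ Ico (0 : ℤ) P,
        (S - ∑ n ∈ Ioc N N', logPhase t (n + y * x)) := by
      rw [sum_comm (s := Ioc N N')]
      simp_rw [sum_comm (s := Ioc N N')]
      simp_rw [sum_sub_distrib]
      congr 1
      simp only [sum_const, Int.card_Ico, nsmul_eq_mul, sub_zero, Int.toNat_natCast]
      ring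
    rw [e]
    refine (norm_sum_le_of_le _ fun y hy => norm_sum_le_of_le _ fun x hx => h1 y hy x hx).trans ?_
    simp only [sum_const, Int.card_Ico, nsmul_eq_mul, sub_zero, Int.toNat_natCast]
    exact le_of_eq (by ring)
  have h3 : ‖∑ n ∈ Ioc N N', ∑ y ∈ Ico (0 : ℤ) P, ∑ x ∈ Ico (0 : ℤ) P,
      logPhase t (n + y * x)‖ ≤ N * ((P : ℝ) ^ 2 * D) := by
    refine (norm_sum_le_of_le _ hD).trans ?_
    rw [sum_const, Nat.card_Ioc, nsmul_eq_mul]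
    gcongr
    omega
  have h4 := norm_le_norm_sub_add ((P : ℂ) ^ 2 * S) (∑ n ∈ Ioc N N', ∑ y ∈ Ico (0 : ℤ) P,
    ∑ x ∈ Ico (0 : ℤ) P, logPhase t (n + y * x))
  have h5 : ‖(P : ℂ) ^ 2 * S‖ = (P : ℝ) ^ 2 * ‖S‖ := by simp
  rw [h5] at h4
  have h6 : (P : ℝ) ^ 2 * ‖S‖ ≤ (P : ℝ) ^ 2 * (N * D + 2 * (P : ℝ) ^ 2) := by
    linarith
  exact le_of_mul_le_mul_left h6 (by positivity)

/-- Vinogradov's bound for the zeta sums `∑ n ^ (-it)` over dyadic blocks. -/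
theorem norm_sum_logPhase_le {κ N N' : ℕ} {t : ℝ} (hκ : 1 ≤ κ) (hN : 1 ≤ N) (hNN' : N ≤ N')
    (hN' : N' ≤ 2 * N) (ht : (N : ℝ) ^ ((κ : ℝ) - 1 / 3) ≤ t) (ht' : t ≤ (N : ℝ) ^ ((κ : ℝ) + 1)) :
    ‖∑ n ∈ Ioc N N', logPhase t n‖ ≤
      2704 * (κ : ℝ) ^ 2 * N * (N : ℝ) ^ (-(1 / (1225125000 * (κ : ℝ) ^ 2))) := by
  have hN1 : (1 : ℝ) ≤ N := by exact_mod_cast hN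
  have hN0 : (0 : ℝ) < N := by linarith
  have hκ1 : (1 : ℝ) ≤ κ := by exact_mod_cast hκ
  have hexp : (1 / (1225125000 * (κ : ℝ) ^ 2)) ≤ 1 / 5 := by
    rw [div_le_div_iff₀ (by positivity) (by norm_num)]; nlinarith
  rcases le_or_gt 32 N with h32 | h32
  · have h32' : (32 : ℝ) ≤ N := by exact_mod_cast h32
    set Q := (N : ℝ) ^ ((2 : ℝ) / 5) with hQ
    have hQ1 : 1 ≤ Q := Real.one_le_rpow hN1 (by norm_num)
    set P := ⌊Q⌋₊ with hP
    have hP0 : 0 < P := Nat.floor_pos.mpr hQ1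
    have hP1 : (1 : ℝ) ≤ P := by exact_mod_cast hP0
    have hP2 : (P : ℝ) ≤ Q := Nat.floor_le (by linarith)
    have hP3 : Q / 2 ≤ P := by
      have := Nat.lt_floor_add_one Q
      rw [← hP] at this
      linarith
    have h := norm_sum_logPhase_le_of_double_sum (t := t)
      (D := 2702 * (κ : ℝ) ^ 2 * (N : ℝ) ^ (-(1 / (1225125000 * (κ : ℝ) ^ 2)))) hNN' hN' hP0 ?_
      (by positivity)
    · refine h.trans ?_
      have h2 : (P : ℝ) ^ 2 ≤ N * (N : ℝ) ^ (-(1 / (1225125000 * (κ : ℝ) ^ 2))) := by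
        calc (P : ℝ) ^ 2 ≤ Q ^ 2 := by gcongr
          _ = (N : ℝ) ^ (1 + -(1 / 5 : ℝ)) := by
            rw [hQ, ← Real.rpow_natCast (_ ^ _) 2, ← Real.rpow_mul hN0.le]; norm_num
          _ ≤ (N : ℝ) ^ (1 + -(1 / (1225125000 * (κ : ℝ) ^ 2))) := by
            refine Real.rpow_le_rpow_of_exponent_le hN1 ?_
            linarith
          _ = _ := by rw [Real.rpow_add hN0, Real.rpow_one]
      have h3 : 0 ≤ N * (N : ℝ) ^ (-(1 / (1225125000 * (κ : ℝ) ^ 2))) := by positivity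
      nlinarith [mul_le_mul_of_nonneg_right (one_le_pow₀ hκ1 : 1 ≤ (κ : ℝ) ^ 2) h3]
    · intro n hn
      rw [mem_Ioc] at hn
      have := norm_double_sum_logPhase_le hκ h32' (n := n) (by exact_mod_cast hn.1.le)
        (by exact_mod_cast hn.2.trans hN') ht ht' hP0 hP3 hP2
      rwa [← mul_assoc]
  · have h1 : ‖∑ n ∈ Ioc N N', logPhase t n‖ ≤ N := by
      refine (norm_sum_le_of_le (f := fun n : ℕ => logPhase t n) _
        (fun n _ => (norm_logPhase t n).le)).trans ?_
      rw [sum_const, Nat.card_Ioc, nsmul_eq_mul, mul_one]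
      exact_mod_cast (by omega : N' - N ≤ N)
    have h2 : (1 / 2 : ℝ) ≤ (N : ℝ) ^ (-(1 / (1225125000 * (κ : ℝ) ^ 2))) := by
      calc (1 / 2 : ℝ) = 32 ^ (-(1 / 5 : ℝ)) := by
            rw [show (32 : ℝ) = 2 ^ (5 : ℝ) by norm_num, ← Real.rpow_mul (by norm_num)]
            norm_num
        _ ≤ (N : ℝ) ^ (-(1 / 5 : ℝ)) :=
          Real.rpow_le_rpow_of_nonpos hN0 (by exact_mod_cast h32.le) (by norm_num)
        _ ≤ _ := Real.rpow_le_rpow_of_exponent_le hN1 (by linarith)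
    refine h1.trans ?_
    calc (N : ℝ) = 2 * 1 * N * (1 / 2) := by ring
      _ ≤ 2704 * (κ : ℝ) ^ 2 * N * (N : ℝ) ^ (-(1 / (1225125000 * (κ : ℝ) ^ 2))) := by
        gcongr
        · norm_num
        · exact one_le_pow₀ hκ1

lemma norm_sum_logPhase_le_exp {N N' : ℕ} {t : ℝ} (ht : 3 ≤ t) (hN : 1 ≤ N) (hNN' : N ≤ N')
    (hN' : N' ≤ 2 * N) (hNt : (N : ℝ) ≤ t ^ (3 / 2 : ℝ)) :
    ‖∑ n ∈ Ioc N N', logPhase t n‖ ≤ 15000 * Real.log t ^ 2 * N *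
      Real.exp (-(1 / 3000000000) * Real.log N ^ 3 / Real.log t ^ 2) := by
  have ht0 : 0 < t := by linarith
  have hL1 : 1 ≤ Real.log t := by
    rw [Real.le_log_iff_exp_le ht0]
    linarith [Real.exp_one_lt_d9]
  set L := Real.log t with hL
  rcases hN.eq_or_lt with rfl | hN2
  · have h1 : ‖∑ n ∈ Ioc 1 N', logPhase t n‖ ≤ 1 := by
      refine (norm_sum_le_of_le (f := fun n : ℕ => logPhase t n) _
        (fun n _ => (norm_logPhase t n).le)).trans ?_
      rw [sum_const, Nat.card_Ioc, nsmul_eq_mul, mul_one]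
      exact_mod_cast (by omega : N' - 1 ≤ 1)
    refine h1.trans ?_
    simp only [Nat.cast_one, Real.log_one]
    norm_num
    nlinarith
  · have hN1 : (1 : ℝ) < N := by exact_mod_cast hN2
    have hN0 : (0 : ℝ) < N := by linarith
    set u := Real.log N with hu
    have hu2 : Real.log 2 ≤ u := Real.log_le_log (by norm_num) (by exact_mod_cast hN2)
    have hlog2 := Real.log_two_gt_d9
    have hu0 : 0 < u := by linarith
    have huL : u ≤ 3 / 2 * L := by
      have := Real.log_le_log hN0 hNt
      rwa [Real.log_rpow ht0] at this
    set κ := max 1 ⌊L / u⌋₊ with hκ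
    have hLu : 2 / 3 ≤ L / u := by rw [le_div_iff₀ hu0]; linarith
    have hκ1 : 1 ≤ κ := le_max_left _ _
    have hκ1' : (1 : ℝ) ≤ κ := by exact_mod_cast hκ1
    have hup : (κ : ℝ) - 1 / 3 ≤ L / u ∧ (κ : ℝ) ≤ 3 / 2 * (L / u) := by
      rcases le_total 1 ⌊L / u⌋₊ with h | h
      · have h2 : (κ : ℝ) = ⌊L / u⌋₊ := by rw [hκ, max_eq_right h]
        have h3 := Nat.floor_le (by linarith : 0 ≤ L / u)
        rw [h2]; constructor <;> linarith
      · have h2 : (κ : ℝ) = 1 := by rw [hκ, max_eq_left h]; simp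
        rw [h2]; constructor <;> linarith
    have hlow : L / u ≤ κ + 1 := by
      have h1 := (Nat.lt_floor_add_one (L / u)).le
      have h2 : (⌊L / u⌋₊ : ℝ) ≤ κ := by exact_mod_cast le_max_right _ _
      linarith
    have ht1 : (N : ℝ) ^ ((κ : ℝ) - 1 / 3) ≤ t := by
      rw [← Real.log_le_log_iff (by positivity) ht0, Real.log_rpow hN0]
      have := hup.1
      rwa [le_div_iff₀ hu0] at this
    have ht2 : t ≤ (N : ℝ) ^ ((κ : ℝ) + 1) := by
      rw [← Real.log_le_log_iff ht0 (by positivity), Real.log_rpow hN0]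
      rwa [div_le_iff₀ hu0] at hlow
    refine (norm_sum_logPhase_le hκ1 hN hNN' hN' ht1 ht2).trans ?_
    have hκ2 : (κ : ℝ) ^ 2 ≤ 9 / 4 * (L / u) ^ 2 := by
      have := pow_le_pow_left₀ (by linarith) hup.2 2
      linarith [mul_pow (3 / 2 : ℝ) (L / u) 2]
    have hLu2 : (L / u) ^ 2 ≤ 21 / 10 * L ^ 2 := by
      rw [div_pow, div_le_iff₀ (by positivity)]
      have : 1 / 2.1 ≤ u ^ 2 := by nlinarith
      nlinarith [sq_nonneg L]
    have e1 : 2704 * (κ : ℝ) ^ 2 ≤ 15000 * L ^ 2 := by nlinarith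
    have e2 : (N : ℝ) ^ (-(1 / (1225125000 * (κ : ℝ) ^ 2))) ≤
        Real.exp (-(1 / 3000000000) * u ^ 3 / L ^ 2) := by
      rw [Real.rpow_def_of_pos hN0, Real.exp_le_exp, ← hu]
      have h1 : 1225125000 * (κ : ℝ) ^ 2 ≤ 3000000000 * (L / u) ^ 2 := by
        nlinarith [sq_nonneg (L / u)]
      have h2 : 1 / (3000000000 * (L / u) ^ 2) ≤ 1 / (1225125000 * (κ : ℝ) ^ 2) :=
        one_div_le_one_div_of_le (by positivity) h1
      have h3 : -(1 / 3000000000) * u ^ 3 / L ^ 2 = u * -(1 / (3000000000 * (L / u) ^ 2)) := by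
        field_simp
      rw [h3]
      gcongr
    gcongr

lemma norm_sum_mul_le_of_antitone {w : ℕ → ℝ} {a : ℕ → ℂ} {N N' : ℕ} {D : ℝ} (hNN' : N ≤ N')
    (hw : ∀ n, N ≤ n → w (n + 1) ≤ w n) (hw0 : ∀ n, N ≤ n → 0 ≤ w n)
    (hD : ∀ M, N ≤ M → M ≤ N' → ‖∑ n ∈ Ioc N M, a n‖ ≤ D) :
    ‖∑ n ∈ Ioc N N', (w n : ℂ) * a n‖ ≤ w N * D := by
  have key : ∀ M, N ≤ M → M ≤ N' →
      ‖∑ n ∈ Ioc N M, (w n : ℂ) * a n - w M * ∑ n ∈ Ioc N M, a n‖ ≤ (w N - w M) * D := by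
    intro M hM
    induction M, hM using Nat.le_induction with
    | base => simp
    | succ M hM ih =>
      intro hM'
      have ih := ih (by omega)
      have hins : Ioc N (M + 1) = insert (M + 1) (Ioc N M) :=
        (Finset.insert_Ioc_right_eq_Ioc_add_one hM).symm
      rw [hins, sum_insert (by simp), sum_insert (by simp)]
      have e : (w (M + 1) : ℂ) * a (M + 1) + ∑ n ∈ Ioc N M, (w n : ℂ) * a n -
          w (M + 1) * (a (M + 1) + ∑ n ∈ Ioc N M, a n) =
          (∑ n ∈ Ioc N M, (w n : ℂ) * a n - w M * ∑ n ∈ Ioc N M, a n) +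
            ((w M - w (M + 1) : ℝ) : ℂ) * ∑ n ∈ Ioc N M, a n := by push_cast; ring
      rw [e]
      refine (norm_add_le _ _).trans ?_
      have h1 : ‖((w M - w (M + 1) : ℝ) : ℂ) * ∑ n ∈ Ioc N M, a n‖ ≤ (w M - w (M + 1)) * D := by
        rw [norm_mul, Complex.norm_real, Real.norm_of_nonneg (by linarith [hw M hM])]
        exact mul_le_mul_of_nonneg_left (hD M hM (by omega)) (by linarith [hw M hM])
      linarith
  have h1 := key N' hNN' le_rfl
  have h2 : ‖(w N' : ℂ) * ∑ n ∈ Ioc N N', a n‖ ≤ w N' * D := by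
    rw [norm_mul, Complex.norm_real, Real.norm_of_nonneg (hw0 N' hNN')]
    exact mul_le_mul_of_nonneg_left (hD N' hNN' le_rfl) (hw0 N' hNN')
  have h3 := norm_le_norm_sub_add (∑ n ∈ Ioc N N', (w n : ℂ) * a n) (w N' * ∑ n ∈ Ioc N N', a n)
  linarith

lemma natCast_cpow_neg_eq {n : ℕ} (hn : n ≠ 0) (σ t : ℝ) :
    (n : ℂ) ^ (-((σ : ℂ) + t * Complex.I)) = ((n : ℝ) ^ (-σ) : ℝ) * logPhase t n := by
  have hn0 : (0 : ℝ) < n := by positivity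
  rw [neg_add, Complex.cpow_add _ _ (by exact_mod_cast hn)]
  congr 1
  · rw [Complex.ofReal_cpow hn0.le]; push_cast; rfl
  · rw [logPhase, expTwoPiI, Complex.cpow_def_of_ne_zero (by exact_mod_cast hn),
      ← Complex.ofReal_natCast, ← Complex.ofReal_log hn0.le]
    congr 1
    have : (Real.pi : ℂ) ≠ 0 := by exact_mod_cast Real.pi_ne_zero
    push_cast
    field_simp

/-- Optimising `θ u - c u³ / L²` over `u`. -/
lemma mul_sub_cube_le {θ c u L : ℝ} (hθ : 0 ≤ θ) (hc : 0 < c) (hu : 0 ≤ u) (hL : 0 < L) :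
    θ * u - c * u ^ 3 / L ^ 2 ≤ θ ^ (3 / 2 : ℝ) * L / √c := by
  have hsc : 0 < √c := Real.sqrt_pos.mpr hc
  have h32 : θ ^ (3 / 2 : ℝ) = θ * √θ := by
    rw [show (3 / 2 : ℝ) = 1 + 1 / 2 by norm_num, Real.rpow_add' hθ (by norm_num), Real.rpow_one,
      Real.sqrt_eq_rpow]
  rw [h32]
  have hs : 0 ≤ √θ := Real.sqrt_nonneg θ
  rcases le_total (u * √c) (√θ * L) with h | h
  · have h1 : θ * u ≤ θ * √θ * L / √c := by
      rw [le_div_iff₀ hsc]; nlinarith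
    have : 0 ≤ c * u ^ 3 / L ^ 2 := by positivity
    linarith
  · have h1 := pow_le_pow_left₀ (by positivity) h 2
    rw [mul_pow, mul_pow, Real.sq_sqrt hθ, Real.sq_sqrt hc.le] at h1
    have h2 : θ * u ≤ c * u ^ 3 / L ^ 2 := by
      rw [le_div_iff₀ (by positivity)]; nlinarith
    have : 0 ≤ θ * √θ * L / √c := by positivity
    linarith

lemma norm_sum_cpow_block_le {N N' : ℕ} {t σ θ : ℝ} (ht : 3 ≤ t) (hN : 1 ≤ N) (hNN' : N ≤ N')
    (hN' : N' ≤ 2 * N) (hNt : (N : ℝ) ≤ t ^ (3 / 2 : ℝ)) (hσ : 0 ≤ σ) (hθ : 0 ≤ θ)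
    (hσθ : 1 - σ ≤ θ) :
    ‖∑ n ∈ Ioc N N', (n : ℂ) ^ (-((σ : ℂ) + t * Complex.I))‖ ≤
      15000 * Real.log t ^ 2 * Real.exp (60000 * θ ^ (3 / 2 : ℝ) * Real.log t) := by
  have hN0 : (0 : ℝ) < N := by exact_mod_cast hN
  have hN1 : (1 : ℝ) ≤ N := by exact_mod_cast hN
  have hL0 : 0 < Real.log t := Real.log_pos (by linarith)
  have e : ∑ n ∈ Ioc N N', (n : ℂ) ^ (-((σ : ℂ) + t * Complex.I)) =
      ∑ n ∈ Ioc N N', (((n : ℝ) ^ (-σ) : ℝ) : ℂ) * logPhase t n := by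
    refine sum_congr rfl fun n hn => natCast_cpow_neg_eq ?_ σ t
    rw [mem_Ioc] at hn; omega
  rw [e]
  refine (norm_sum_mul_le_of_antitone (w := fun n => (n : ℝ) ^ (-σ)) (a := fun n => logPhase t n)
    hNN' ?_ ?_ (fun M hM hM' => norm_sum_logPhase_le_exp ht hN hM (hM'.trans hN') hNt)).trans ?_
  · intro n hn
    have : (0 : ℝ) < n := by exact_mod_cast (by omega : 0 < n)
    exact Real.rpow_le_rpow_of_nonpos this (by push_cast; linarith) (by linarith)
  · intro n hn; positivity
  · have hu0 : 0 ≤ Real.log N := Real.log_nonneg hN1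
    have h1 : (N : ℝ) ^ (-σ) * N = Real.exp ((1 - σ) * Real.log N) := by
      nth_rw 2 [← Real.rpow_one (N : ℝ)]
      rw [← Real.rpow_add hN0, Real.rpow_def_of_pos hN0]
      congr 1; ring
    have h2 := mul_sub_cube_le hθ (c := 1 / 3000000000) (by norm_num) hu0 hL0
    have h3 : θ ^ (3 / 2 : ℝ) * Real.log t / √(1 / 3000000000) ≤
        60000 * θ ^ (3 / 2 : ℝ) * Real.log t := by
      have h4 : 1 / 60000 ≤ √(1 / 3000000000) := Real.le_sqrt_of_sq_le (by norm_num)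
      rw [div_le_iff₀ (by positivity)]
      have : 0 ≤ θ ^ (3 / 2 : ℝ) * Real.log t := by positivity
      nlinarith
    have h5 : (1 - σ) * Real.log N ≤ θ * Real.log N := by gcongr
    calc (N : ℝ) ^ (-σ) * (15000 * Real.log t ^ 2 * N *
          Real.exp (-(1 / 3000000000) * Real.log N ^ 3 / Real.log t ^ 2))
        = 15000 * Real.log t ^ 2 * (((N : ℝ) ^ (-σ) * N) *
          Real.exp (-(1 / 3000000000) * Real.log N ^ 3 / Real.log t ^ 2)) := by ring
      _ = 15000 * Real.log t ^ 2 * Real.exp ((1 - σ) * Real.log N +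
          -(1 / 3000000000) * Real.log N ^ 3 / Real.log t ^ 2) := by rw [h1, Real.exp_add]
      _ ≤ _ := by
        gcongr
        have h6 : -(1 / 3000000000) * Real.log N ^ 3 / Real.log t ^ 2 =
          -(1 / 3000000000 * Real.log N ^ 3 / Real.log t ^ 2) := by ring
        linarith

lemma norm_sum_cpow_le {X : ℕ} {t σ θ : ℝ} (ht : 3 ≤ t) (hXt : (X : ℝ) ≤ t ^ (3 / 2 : ℝ))
    (hσ : 0 ≤ σ) (hθ : 0 ≤ θ) (hσθ : 1 - σ ≤ θ) :
    ‖∑ n ∈ Ioc 0 X, (n : ℂ) ^ (-((σ : ℂ) + t * Complex.I))‖ ≤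
      100000 * Real.log t ^ 3 * Real.exp (60000 * θ ^ (3 / 2 : ℝ) * Real.log t) := by
  have ht0 : 0 < t := by linarith
  have hL1 : 1 ≤ Real.log t := by
    rw [Real.le_log_iff_exp_le ht0]
    linarith [Real.exp_one_lt_d9]
  set B := 15000 * Real.log t ^ 2 * Real.exp (60000 * θ ^ (3 / 2 : ℝ) * Real.log t) with hB
  have hB1 : 1 ≤ B := by
    have h1 : 1 ≤ Real.exp (60000 * θ ^ (3 / 2 : ℝ) * Real.log t) :=
      Real.one_le_exp (by positivity)
    have h2 : 1 ≤ Real.log t ^ 2 := one_le_pow₀ hL1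
    rw [hB]; nlinarith
  have key : ∀ i : ℕ, ∀ Y : ℕ, Y ≤ 2 ^ i → (Y : ℝ) ≤ t ^ (3 / 2 : ℝ) →
      ‖∑ n ∈ Ioc 0 Y, (n : ℂ) ^ (-((σ : ℂ) + t * Complex.I))‖ ≤ 1 + i * B := by
    intro i
    induction i with
    | zero =>
      intro Y hY _
      interval_cases Y <;> simp
    | succ i ih =>
      intro Y hY hYt
      rcases le_total Y (2 ^ i) with h | h
      · refine (ih Y h hYt).trans ?_
        push_cast; linarith
      · have h2i : ((2 ^ i : ℕ) : ℝ) ≤ t ^ (3 / 2 : ℝ) := le_trans (by exact_mod_cast h) hYt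
        have h1 := ih (2 ^ i) le_rfl h2i
        have h2 := norm_sum_cpow_block_le ht Nat.one_le_two_pow h (by rw [pow_succ] at hY; omega) h2i
          hσ hθ hσθ
        rw [← Ioc_union_Ioc_eq_Ioc (Nat.zero_le (2 ^ i)) h, sum_union
          (Finset.disjoint_left.mpr fun x hx hx' => by rw [mem_Ioc] at hx hx'; omega)]
        refine (norm_add_le _ _).trans ?_
        push_cast
        linarith
  rcases Nat.eq_zero_or_pos X with rfl | hX
  · simp only [Ioc_self, sum_empty, norm_zero]; positivity
  have h := key (Nat.log 2 X + 1) X (Nat.lt_pow_succ_log_self (by norm_num) X).le hXt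
  have h1 : (Nat.log 2 X : ℝ) ≤ 9 / 4 * Real.log t := by
    have h2 : ((2 ^ Nat.log 2 X : ℕ) : ℝ) ≤ t ^ (3 / 2 : ℝ) :=
      le_trans (by exact_mod_cast Nat.pow_log_le_self 2 hX.ne') hXt
    have h3 := Real.log_le_log (by positivity) h2
    rw [Real.log_rpow ht0] at h3
    push_cast at h3
    rw [Real.log_pow] at h3
    nlinarith [Real.log_two_gt_d9, (Nat.cast_nonneg (Nat.log 2 X) : (0 : ℝ) ≤ _)]
  refine h.trans ?_
  calc 1 + ((Nat.log 2 X + 1 : ℕ) : ℝ) * B ≤ B + (9 / 4 * Real.log t + 1) * B := by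
        push_cast; gcongr
    _ ≤ (100000 / 15000 * Real.log t) * B := by nlinarith
    _ = _ := by rw [hB]; ring

/-- The difference `(n+1)^{-s} - ∫_n^{n+1} x^{-s} dx`. -/
noncomputable def zetaTerm (n : ℕ) (s : ℂ) : ℂ :=
  ((n + 1 : ℕ) : ℂ) ^ (-s) - (((n + 1 : ℕ) : ℂ) ^ (1 - s) - (n : ℂ) ^ (1 - s)) / (1 - s)

lemma norm_cpow_neg_sub_le {n : ℕ} (hn : 1 ≤ n) {s : ℂ} (hs : 0 < s.re) {x : ℝ}
    (hx : x ∈ Set.Icc (n : ℝ) (n + 1)) :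
    ‖((n + 1 : ℕ) : ℂ) ^ (-s) - (x : ℂ) ^ (-s)‖ ≤ ‖s‖ * (n : ℝ) ^ (-s.re - 1) := by
  have hn0 : (0 : ℝ) < n := by exact_mod_cast hn
  have hs0 : s ≠ 0 := by rintro rfl; simp at hs
  have hd : ∀ y ∈ Set.Icc (n : ℝ) (n + 1), HasDerivWithinAt (fun y : ℝ => (y : ℂ) ^ (-s))
      (-s * (y : ℂ) ^ (-s - 1)) (Set.Icc (n : ℝ) (n + 1)) y := by
    intro y hy
    exact (hasDerivAt_ofReal_cpow_const (by linarith [hy.1])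
      (neg_ne_zero.mpr hs0)).hasDerivWithinAt
  have hb : ∀ y ∈ Set.Icc (n : ℝ) (n + 1), ‖-s * (y : ℂ) ^ (-s - 1)‖ ≤
      ‖s‖ * (n : ℝ) ^ (-s.re - 1) := by
    intro y hy
    have hy0 : 0 < y := by linarith [hy.1]
    rw [norm_mul, norm_neg, Complex.norm_cpow_eq_rpow_re_of_pos hy0]
    refine mul_le_mul_of_nonneg_left ?_ (norm_nonneg _)
    simp only [Complex.sub_re, Complex.neg_re, Complex.one_re]
    exact Real.rpow_le_rpow_of_nonpos hn0 hy.1 (by linarith)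
  have h := Convex.norm_image_sub_le_of_norm_hasDerivWithin_le hd hb (convex_Icc _ _) hx
    (Set.right_mem_Icc.mpr (by linarith))
  have e : (((n : ℝ) + 1 : ℝ) : ℂ) = ((n + 1 : ℕ) : ℂ) := by push_cast; rfl
  rw [e] at h
  refine h.trans (mul_le_of_le_one_right (by positivity) ?_)
  rw [Real.norm_of_nonneg (by linarith [hx.2])]
  linarith [hx.1]

lemma norm_zetaTerm_le {n : ℕ} (hn : 1 ≤ n) {s : ℂ} (hs : 0 < s.re) (hs1 : s ≠ 1) :
    ‖zetaTerm n s‖ ≤ ‖s‖ * (n : ℝ) ^ (-s.re - 1) := by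
  have hn0 : (0 : ℝ) < n := by exact_mod_cast hn
  have hs1' : 1 - s ≠ 0 := sub_ne_zero.mpr hs1.symm
  have hd : ∀ y ∈ Set.Icc (n : ℝ) (n + 1), HasDerivWithinAt
      (fun y : ℝ => (y : ℂ) * ((n + 1 : ℕ) : ℂ) ^ (-s) - (y : ℂ) ^ (1 - s) / (1 - s))
      (((n + 1 : ℕ) : ℂ) ^ (-s) - (y : ℂ) ^ (-s)) (Set.Icc (n : ℝ) (n + 1)) y := by
    intro y hy
    have h := hasDerivAt_ofReal_cpow_const' (x := y) (r := -s)
      (by linarith [hy.1]) (by simpa using hs1)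
    have h2 : HasDerivAt (fun y : ℝ => (y : ℂ) * ((n + 1 : ℕ) : ℂ) ^ (-s))
      (((n + 1 : ℕ) : ℂ) ^ (-s)) y := by
      simpa using (Complex.ofRealCLM.hasDerivAt (x := y)).mul_const (((n + 1 : ℕ) : ℂ) ^ (-s))
    rw [neg_add_eq_sub] at h
    exact (h2.sub h).hasDerivWithinAt
  have h := Convex.norm_image_sub_le_of_norm_hasDerivWithin_le hd
    (fun y hy => norm_cpow_neg_sub_le hn hs hy) (convex_Icc _ _)
    (Set.left_mem_Icc.mpr (by linarith)) (Set.right_mem_Icc.mpr (by linarith))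
  rw [show ‖(n : ℝ) + 1 - n‖ = 1 by simp, mul_one] at h
  refine le_trans (le_of_eq ?_) h
  rw [zetaTerm]
  congr 1
  push_cast
  field_simp
  ring

lemma differentiableAt_zetaTerm {n : ℕ} (hn : 1 ≤ n) {s : ℂ} (hs : s ≠ 1) :
    DifferentiableAt ℂ (zetaTerm n) s := by
  have h1 : (n : ℂ) ≠ 0 := by exact_mod_cast (by omega : n ≠ 0)
  have h2 : ((n + 1 : ℕ) : ℂ) ≠ 0 := by exact_mod_cast (by omega : n + 1 ≠ 0)
  have h3 : 1 - s ≠ 0 := sub_ne_zero.mpr hs.symm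
  unfold zetaTerm
  have e1 : DifferentiableAt ℂ (fun s => ((n + 1 : ℕ) : ℂ) ^ (-s)) s :=
    (differentiableAt_id.neg).const_cpow (Or.inl h2)
  have e2 : DifferentiableAt ℂ (fun s => ((n + 1 : ℕ) : ℂ) ^ (1 - s)) s :=
    ((differentiableAt_const _).sub differentiableAt_id).const_cpow (Or.inl h2)
  have e3 : DifferentiableAt ℂ (fun s => (n : ℂ) ^ (1 - s)) s :=
    ((differentiableAt_const _).sub differentiableAt_id).const_cpow (Or.inl h1)
  exact e1.sub ((e2.sub e3).div ((differentiableAt_const _).sub differentiableAt_id) h3)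

lemma sum_range_zetaTerm (X M : ℕ) {s : ℂ} (hs : s ≠ 1) :
    ∑ i ∈ range M, zetaTerm (X + i) s = ∑ i ∈ range M, ((X + i + 1 : ℕ) : ℂ) ^ (-s) -
      (((X + M : ℕ) : ℂ) ^ (1 - s) - (X : ℂ) ^ (1 - s)) / (1 - s) := by
  have h3 : 1 - s ≠ 0 := sub_ne_zero.mpr hs.symm
  induction M with
  | zero => simp
  | succ M ih =>
    rw [sum_range_succ, ih, sum_range_succ, zetaTerm]
    field_simp
    push_cast
    ring_nf

lemma tsum_zetaTerm_of_one_lt_re {X : ℕ} (hX : 1 ≤ X) {s : ℂ} (hs : 1 < s.re)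
    (hsum : Summable fun i => zetaTerm (X + i) s) :
    riemannZeta s = ∑ n ∈ Ioc 0 X, (n : ℂ) ^ (-s) - (X : ℂ) ^ (1 - s) / (1 - s) +
      ∑' i, zetaTerm (X + i) s := by
  have hs1 : s ≠ 1 := by rintro rfl; simp at hs
  have h1 : Tendsto (fun M => ∑ i ∈ range M, zetaTerm (X + i) s) atTop
      (nhds (∑' i, zetaTerm (X + i) s)) := hsum.hasSum.tendsto_sum_nat
  have hz : HasSum (fun n : ℕ => ((n + 1 : ℕ) : ℂ) ^ (-s)) (riemannZeta s) := by
    have h2 := zeta_eq_tsum_one_div_nat_add_one_cpow hs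
    have h3 : Summable fun n : ℕ => ((n + 1 : ℕ) : ℂ) ^ (-s) := by
      have := (summable_nat_add_iff 1).mpr (Complex.summable_one_div_nat_cpow.mpr hs)
      refine this.congr fun n => ?_
      rw [Complex.cpow_neg, one_div]
    rw [h2]
    convert h3.hasSum using 1
    refine tsum_congr fun n => ?_
    rw [Complex.cpow_neg, one_div]; push_cast; rfl
  have h4 : Tendsto (fun M => ∑ i ∈ range M, ((X + i + 1 : ℕ) : ℂ) ^ (-s)) atTop
      (nhds (riemannZeta s - ∑ n ∈ Ioc 0 X, (n : ℂ) ^ (-s))) := by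
    have h5 := (hasSum_nat_add_iff' X).mpr hz
    have e : ∑ i ∈ range X, ((i + 1 : ℕ) : ℂ) ^ (-s) = ∑ n ∈ Ioc 0 X, (n : ℂ) ^ (-s) := by
      rw [← Finset.Ico_add_one_add_one_eq_Ioc, range_eq_Ico, zero_add,
        Finset.sum_Ico_add' (fun n : ℕ => (n : ℂ) ^ (-s)) 0 X 1, zero_add]
    rw [e] at h5
    refine h5.tendsto_sum_nat.congr fun M => sum_congr rfl fun i _ => ?_
    rw [add_comm i X]
  have h5 : Tendsto (fun M : ℕ => ((X + M : ℕ) : ℂ) ^ (1 - s)) atTop (nhds 0) := by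
    rw [tendsto_zero_iff_norm_tendsto_zero]
    have h6 : Tendsto (fun M : ℕ => ((X + M : ℕ) : ℝ) ^ (-(s.re - 1))) atTop (nhds 0) := by
      refine (tendsto_rpow_neg_atTop (by linarith)).comp ?_
      exact tendsto_natCast_atTop_atTop.comp (tendsto_add_atTop_nat X |>.congr fun M => add_comm _ _)
    refine h6.congr fun M => ?_
    rw [Complex.norm_natCast_cpow_of_pos (by omega)]
    congr 1
    simp
  have h6 : Tendsto (fun M => ∑ i ∈ range M, zetaTerm (X + i) s) atTop
      (nhds ((riemannZeta s - ∑ n ∈ Ioc 0 X, (n : ℂ) ^ (-s)) -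
        (0 - (X : ℂ) ^ (1 - s)) / (1 - s))) := by
    simp_rw [sum_range_zetaTerm X _ hs1]
    exact h4.sub ((h5.sub tendsto_const_nhds).div_const _)
  have := tendsto_nhds_unique h1 h6
  rw [this]
  ring

lemma norm_zetaTerm_add_le {X : ℕ} (hX : 1 ≤ X) {s : ℂ} {r : ℝ} (hr : 5 / 4 ≤ r + 1)
    (hrs : r ≤ s.re) (hs1 : s ≠ 1) (i : ℕ) :
    ‖zetaTerm (X + i) s‖ ≤ ‖s‖ * (X : ℝ) ^ (-(r - 1 / 4)) * (((i + 1 : ℕ) : ℝ) ^ (5 / 4 : ℝ))⁻¹ := by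
  have hX0 : (0 : ℝ) < X := by exact_mod_cast hX
  have hXi : (1 : ℝ) ≤ (X + i : ℕ) := by exact_mod_cast (by omega : 1 ≤ X + i)
  refine (norm_zetaTerm_le (by omega) (by linarith) hs1).trans ?_
  rw [mul_assoc]
  refine mul_le_mul_of_nonneg_left ?_ (norm_nonneg _)
  calc ((X + i : ℕ) : ℝ) ^ (-s.re - 1) ≤ ((X + i : ℕ) : ℝ) ^ (-(r - 1 / 4) + -(5 / 4)) :=
        Real.rpow_le_rpow_of_exponent_le hXi (by linarith)
    _ = ((X + i : ℕ) : ℝ) ^ (-(r - 1 / 4)) * ((X + i : ℕ) : ℝ) ^ (-(5 / 4 : ℝ)) :=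
        Real.rpow_add (by linarith) _ _
    _ ≤ (X : ℝ) ^ (-(r - 1 / 4)) * ((i + 1 : ℕ) : ℝ) ^ (-(5 / 4 : ℝ)) := by
        gcongr ?_ * ?_
        · exact Real.rpow_le_rpow_of_nonpos hX0 (by push_cast; linarith [(Nat.cast_nonneg i : (0 : ℝ) ≤ i)]) (by linarith)
        · exact Real.rpow_le_rpow_of_nonpos (by positivity) (by exact_mod_cast (by omega : i + 1 ≤ X + i)) (by norm_num)
    _ = _ := by rw [Real.rpow_neg (Nat.cast_nonneg (i + 1)) (5 / 4)]

lemma summable_inv_add_one_rpow : Summable fun i : ℕ => (((i + 1 : ℕ) : ℝ) ^ (5 / 4 : ℝ))⁻¹ :=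
  (summable_nat_add_iff 1).mpr (Real.summable_nat_rpow_inv.mpr (by norm_num))

lemma riemannZeta_eq_sum_add_tsum {X : ℕ} (hX : 1 ≤ X) {s : ℂ} (hs : 1 / 2 < s.re)
    (hs3 : s.re < 3) (hs0 : 0 < s.im) :
    riemannZeta s = ∑ n ∈ Ioc 0 X, (n : ℂ) ^ (-s) - (X : ℂ) ^ (1 - s) / (1 - s) +
      ∑' i, zetaTerm (X + i) s := by
  set b := s.im + 1 with hb
  set U : Set ℂ := {z | 1 / 2 < z.re} ∩ {z | z.re < 3} ∩ {z | 0 < z.im} ∩ {z | z.im < b} with hU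
  have hUo : IsOpen U := by
    refine IsOpen.inter (IsOpen.inter (IsOpen.inter ?_ ?_) ?_) ?_
    · exact isOpen_lt continuous_const Complex.continuous_re
    · exact isOpen_lt Complex.continuous_re continuous_const
    · exact isOpen_lt continuous_const Complex.continuous_im
    · exact isOpen_lt Complex.continuous_im continuous_const
  have hUc : Convex ℝ U := by
    refine Convex.inter (Convex.inter (Convex.inter ?_ ?_) ?_) ?_
    · exact convex_halfSpace_re_gt _
    · exact convex_halfSpace_re_lt _
    · exact convex_halfSpace_im_gt _
    · exact convex_halfSpace_im_lt _
  have hU1 : ∀ z ∈ U, z ≠ 1 := by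
    rintro z hz rfl
    have := hz.1.2
    simp at this
  have hUn : ∀ z ∈ U, ‖z‖ ≤ 3 + b := by
    intro z hz
    refine (Complex.norm_le_abs_re_add_abs_im z).trans ?_
    have h1 : (1 : ℝ) / 2 < z.re := hz.1.1.1
    have h2 : z.re < 3 := hz.1.1.2
    have h3 : 0 < z.im := hz.1.2
    have h4 : z.im < b := hz.2
    rw [abs_of_pos (by linarith), abs_of_pos h3]
    linarith
  have hbound : ∀ i, ∀ z ∈ U, ‖zetaTerm (X + i) z‖ ≤
      (3 + b) * (X : ℝ) ^ (-((1 / 2 : ℝ) - 1 / 4)) * (((i + 1 : ℕ) : ℝ) ^ (5 / 4 : ℝ))⁻¹ := by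
    intro i z hz
    refine (norm_zetaTerm_add_le hX (by norm_num) (le_of_lt hz.1.1.1) (hU1 z hz) i).trans ?_
    have := hUn z hz
    gcongr
  have hsum : Summable fun i : ℕ =>
      (3 + b) * (X : ℝ) ^ (-((1 / 2 : ℝ) - 1 / 4)) * (((i + 1 : ℕ) : ℝ) ^ (5 / 4 : ℝ))⁻¹ :=
    summable_inv_add_one_rpow.mul_left _
  have hF : DifferentiableOn ℂ (fun z => ∑' i, zetaTerm (X + i) z) U :=
    Complex.differentiableOn_tsum_of_summable_norm hsum
      (fun i z hz => (differentiableAt_zetaTerm (by omega) (hU1 z hz)).differentiableWithinAt) hUo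
      hbound
  have hX0 : (X : ℂ) ≠ 0 := by exact_mod_cast (by omega : X ≠ 0)
  have hG : DifferentiableOn ℂ (fun z => ∑ n ∈ Ioc 0 X, (n : ℂ) ^ (-z) - (X : ℂ) ^ (1 - z) / (1 - z) +
      ∑' i, zetaTerm (X + i) z) U := by
    refine DifferentiableOn.add (fun z hz => DifferentiableAt.differentiableWithinAt ?_) hF
    refine DifferentiableAt.sub ?_ ?_
    · refine DifferentiableAt.fun_sum fun n hn => ?_
      rw [mem_Ioc] at hn
      exact (differentiableAt_id.neg).const_cpow (Or.inl (by exact_mod_cast (by omega : n ≠ 0)))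
    · refine DifferentiableAt.div ?_ ((differentiableAt_const _).sub differentiableAt_id)
        (sub_ne_zero.mpr (hU1 z hz).symm)
      exact ((differentiableAt_const _).sub differentiableAt_id).const_cpow (Or.inl hX0)
  have hZ : DifferentiableOn ℂ riemannZeta U := fun z hz =>
    (differentiableAt_riemannZeta (hU1 z hz)).differentiableWithinAt
  set z0 : ℂ := ⟨2, s.im / 2⟩ with hz0
  have hz0U : z0 ∈ U := by
    refine ⟨⟨⟨?_, ?_⟩, ?_⟩, ?_⟩ <;> simp only [Set.mem_ofPred_eq, hz0, hb] <;> linarith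
  have hsU : s ∈ U := ⟨⟨⟨hs, hs3⟩, hs0⟩, by simp [hb]⟩
  have hev : riemannZeta =ᶠ[nhds z0] (fun z => ∑ n ∈ Ioc 0 X, (n : ℂ) ^ (-z) -
      (X : ℂ) ^ (1 - z) / (1 - z) + ∑' i, zetaTerm (X + i) z) := by
    have h1 : ∀ᶠ z in nhds z0, 1 < z.re :=
      (isOpen_lt continuous_const Complex.continuous_re).mem_nhds
        (by simp only [Set.mem_ofPred_eq, hz0]; norm_num)
    filter_upwards [h1, hUo.mem_nhds hz0U] with z hz hzU
    exact tsum_zetaTerm_of_one_lt_re hX hz (Summable.of_norm_bounded hsum fun i => hbound i z hzU)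
  exact (hZ.analyticOnNhd hUo).eqOn_of_preconnected_of_eventuallyEq (hG.analyticOnNhd hUo)
    hUc.isPreconnected hz0U hev hsU

/-- The Korobov–Vinogradov bound for `ζ` to the left of the line `Re s = 1`. -/
theorem exists_norm_riemannZeta_le : ∃ C : ℝ, 1 ≤ C ∧ ∀ t σ θ : ℝ, 3 ≤ t → 15 / 16 ≤ σ → σ < 3 →
    0 ≤ θ → 1 - σ ≤ θ → ‖riemannZeta (σ + t * Complex.I)‖ ≤
      C * Real.log t ^ 3 * Real.exp (60000 * θ ^ (3 / 2 : ℝ) * Real.log t) := by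
  set Z := ∑' i : ℕ, (((i + 1 : ℕ) : ℝ) ^ (5 / 4 : ℝ))⁻¹ with hZ
  have hZ0 : 0 ≤ Z := tsum_nonneg fun i => by positivity
  refine ⟨100000 + 1 + 8 * Z, by linarith, fun t σ θ ht hσ hσ3 hθ hσθ => ?_⟩
  have ht0 : 0 < t := by linarith
  set Y := t ^ (3 / 2 : ℝ) with hY
  have hY1 : 1 ≤ Y := Real.one_le_rpow (by linarith) (by norm_num)
  set X := ⌊Y⌋₊ with hX
  have hX1 : 1 ≤ X := Nat.floor_pos.mpr hY1
  have hXY : (X : ℝ) ≤ Y := Nat.floor_le (by linarith)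
  have hYX : Y / 2 ≤ X := by
    have h1 := Nat.lt_floor_add_one Y
    rw [← hX] at h1
    have h2 : (1 : ℝ) ≤ X := by exact_mod_cast hX1
    linarith
  have hX0 : (0 : ℝ) < X := by exact_mod_cast hX1
  set s : ℂ := σ + t * Complex.I with hs
  have hre : s.re = σ := by simp [hs]
  have him : s.im = t := by simp [hs]
  have hs1 : s ≠ 1 := by
    intro h
    rw [h] at him
    simp at him
    linarith
  have hsn : ‖s‖ ≤ 2 * t := by
    refine (Complex.norm_le_abs_re_add_abs_im s).trans ?_
    rw [hre, him, abs_of_pos (by linarith), abs_of_pos ht0]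
    linarith
  have hbd := fun i => norm_zetaTerm_add_le hX1 (s := s) (r := 15 / 16) (by norm_num)
    (by rw [hre]; exact hσ) hs1 i
  have hL1 : 1 ≤ Real.log t := by
    rw [Real.le_log_iff_exp_le ht0]
    linarith [Real.exp_one_lt_d9]
  have hE : 1 ≤ Real.log t ^ 3 * Real.exp (60000 * θ ^ (3 / 2 : ℝ) * Real.log t) :=
    one_le_mul_of_one_le_of_one_le (one_le_pow₀ hL1) (Real.one_le_exp (by positivity))
  have h1 := norm_sum_cpow_le ht hXY (by linarith : 0 ≤ σ) hθ hσθ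
  rw [← hs] at h1
  have h2 : ‖(X : ℂ) ^ (1 - s) / (1 - s)‖ ≤ 1 := by
    rw [norm_div, Complex.norm_natCast_cpow_of_pos (by omega), Complex.sub_re, Complex.one_re, hre]
    have h3 : t ≤ ‖1 - s‖ := by
      refine le_trans ?_ (Complex.abs_im_le_norm _)
      rw [Complex.sub_im, him]; simp [abs_of_pos ht0]
    rw [div_le_one (by linarith)]
    refine le_trans ?_ h3
    have hX1' : (1 : ℝ) ≤ X := by exact_mod_cast hX1
    calc (X : ℝ) ^ (1 - σ) ≤ (X : ℝ) ^ (1 / 16 : ℝ) :=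
          Real.rpow_le_rpow_of_exponent_le hX1' (by linarith)
      _ ≤ Y ^ (1 / 16 : ℝ) := by gcongr
      _ = t ^ (3 / 32 : ℝ) := by rw [hY, ← Real.rpow_mul ht0.le]; norm_num
      _ ≤ t ^ (1 : ℝ) := Real.rpow_le_rpow_of_exponent_le (by linarith) (by norm_num)
      _ = t := Real.rpow_one t
  have h3 : ‖∑' i, zetaTerm (X + i) s‖ ≤ 8 * Z := by
    have h4 := tsum_of_norm_bounded (summable_inv_add_one_rpow.mul_left
      (‖s‖ * (X : ℝ) ^ (-((15 / 16 : ℝ) - 1 / 4)))).hasSum hbd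
    refine h4.trans ?_
    rw [tsum_mul_left, ← hZ]
    refine mul_le_mul_of_nonneg_right ?_ hZ0
    calc ‖s‖ * (X : ℝ) ^ (-((15 / 16 : ℝ) - 1 / 4)) ≤ 2 * t * (Y / 2) ^ (-((15 / 16 : ℝ) - 1 / 4)) := by
          refine mul_le_mul hsn ?_ (by positivity) (by positivity)
          exact Real.rpow_le_rpow_of_nonpos (by linarith) hYX (by norm_num)
      _ = 2 * 2 ^ (11 / 16 : ℝ) * (t ^ (1 : ℝ) * t ^ (-(33 / 32) : ℝ)) := by
          rw [Real.div_rpow (by linarith) (by norm_num), hY, ← Real.rpow_mul ht0.le, Real.rpow_one,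
            Real.rpow_neg (by norm_num : (0 : ℝ) ≤ 2)]
          norm_num
          ring
      _ ≤ 2 * 2 ^ (2 : ℝ) * 1 := by
          gcongr
          · norm_num
          · norm_num
          · rw [← Real.rpow_add ht0]
            exact Real.rpow_le_one_of_one_le_of_nonpos (by linarith) (by norm_num)
      _ = 8 := by norm_num
  rw [riemannZeta_eq_sum_add_tsum hX1 (by rw [hre]; linarith) (by rw [hre]; exact hσ3)
    (by rw [him]; exact ht0)]
  refine (norm_add_le _ _).trans ((add_le_add_left (norm_sub_le _ _) _).trans ?_)
  set E := Real.log t ^ 3 * Real.exp (60000 * θ ^ (3 / 2 : ℝ) * Real.log t) with hEd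
  have e1 : (100000 + 1 + 8 * Z) * Real.log t ^ 3 * Real.exp (60000 * θ ^ (3 / 2 : ℝ) * Real.log t) =
    (100000 + 1 + 8 * Z) * E := by rw [hEd]; ring
  have e2 : 100000 * Real.log t ^ 3 * Real.exp (60000 * θ ^ (3 / 2 : ℝ) * Real.log t) =
    100000 * E := by rw [hEd]; ring
  rw [e1]
  rw [e2] at h1
  nlinarith

lemma exists_eq_mul_exp_of_ne_zero {f : ℂ → ℂ} {r : ℝ} (hr : 0 < r)
    (hf : DifferentiableOn ℂ f (Metric.ball 0 r)) (h0 : ∀ z ∈ Metric.ball 0 r, f z ≠ 0) :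
    ∃ g : ℂ → ℂ, g 0 = 0 ∧ DifferentiableOn ℂ g (Metric.ball 0 r) ∧
      (∀ z ∈ Metric.ball 0 r, HasDerivAt g (deriv f z / f z) z) ∧
      ∀ z ∈ Metric.ball 0 r, f z = f 0 * Complex.exp (g z) := by
  have ho : IsOpen (Metric.ball (0 : ℂ) r) := Metric.isOpen_ball
  have hd : DifferentiableOn ℂ (fun z => deriv f z / f z) (Metric.ball 0 r) :=
    (hf.deriv ho).div hf h0
  obtain ⟨g, hg0, hg⟩ := (hd.isExactOn_ball).with_val_at 0 0
  refine ⟨g, hg0, fun z hz => (hg z hz).differentiableAt.differentiableWithinAt, hg, fun z hz => ?_⟩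
  have h1 : ∀ z ∈ Metric.ball (0 : ℂ) r, HasDerivAt (fun z => f z * Complex.exp (-g z)) 0 z := by
    intro z hz
    have h2 := ((hf.differentiableAt (ho.mem_nhds hz)).hasDerivAt.mul (hg z hz).neg.cexp)
    refine h2.congr_deriv ?_
    have e : f z * (deriv f z / f z) = deriv f z := mul_div_cancel₀ _ (h0 z hz)
    linear_combination -Complex.exp (-g z) * e
  have h3 := (convex_ball (0 : ℂ) r).is_const_of_fderivWithin_eq_zero (𝕜 := ℂ)
    (f := fun z => f z * Complex.exp (-g z))
    (fun z hz => (h1 z hz).differentiableAt.differentiableWithinAt)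
    (fun z hz => by
      rw [fderivWithin_of_isOpen ho hz]
      simpa using (h1 z hz).hasFDerivAt.fderiv) hz (Metric.mem_ball_self hr)
  simp only [hg0, neg_zero, Complex.exp_zero, mul_one] at h3
  rw [← h3, mul_assoc, ← Complex.exp_add]
  simp

lemma exists_eq_mul_exp_of_norm_le {f : ℂ → ℂ} {r M : ℝ} (hr : 0 < r)
    (hf : DifferentiableOn ℂ f (Metric.ball 0 r)) (h0 : ∀ z ∈ Metric.ball 0 r, f z ≠ 0)
    (hM : ∀ z ∈ Metric.ball 0 r, ‖f z‖ ≤ M) :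
    ∃ g : ℂ → ℂ, DifferentiableOn ℂ g (Metric.ball 0 r) ∧ HasDerivAt g (deriv f 0 / f 0) 0 ∧
      (∀ z ∈ Metric.ball 0 r, f z = f 0 * Complex.exp (g z)) ∧
      ∀ z ∈ Metric.ball 0 r, ‖g z‖ ≤ 2 * (Real.log (M / ‖f 0‖) + 1) * ‖z‖ / (r - ‖z‖) := by
  obtain ⟨g, hg0, hgd, hg', hg⟩ := exists_eq_mul_exp_of_ne_zero hr hf h0
  have hmem : (0 : ℂ) ∈ Metric.ball (0 : ℂ) r := Metric.mem_ball_self hr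
  have hf0 : 0 < ‖f 0‖ := norm_pos_iff.mpr (h0 0 hmem)
  have hM0 : 0 < M := hf0.trans_le (hM 0 hmem)
  have hlog : 0 ≤ Real.log (M / ‖f 0‖) :=
    Real.log_nonneg ((one_le_div hf0).mpr (hM 0 hmem))
  refine ⟨g, hgd, hg' 0 hmem, hg, fun z hz => ?_⟩
  refine Complex.borelCaratheodory_zero (by linarith) hgd ?_ hr hz hg0
  intro w hw
  have h1 := hM w hw
  rw [hg w hw, norm_mul, Complex.norm_exp] at h1
  have h2 : Real.exp (g w).re ≤ M / ‖f 0‖ := by rwa [le_div_iff₀ hf0, mul_comm]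
  have h3 := (Real.le_log_iff_exp_le (by positivity)).mpr h2
  simp only [Set.mem_ofPred_eq]
  linarith

lemma norm_deriv_div_le {f : ℂ → ℂ} {r M : ℝ} (hr : 0 < r)
    (hf : DifferentiableOn ℂ f (Metric.ball 0 r)) (h0 : ∀ z ∈ Metric.ball 0 r, f z ≠ 0)
    (hM : ∀ z ∈ Metric.ball 0 r, ‖f z‖ ≤ M) :
    ‖deriv f 0 / f 0‖ ≤ 4 / r * (Real.log (M / ‖f 0‖) + 1) := by
  obtain ⟨g, hgd, hg', -, hg⟩ := exists_eq_mul_exp_of_norm_le hr hf h0 hM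
  rw [← hg'.deriv]
  have h2 : (0 : ℝ) < r / 2 := by linarith
  have h := Complex.norm_deriv_le_of_forall_mem_sphere_norm_le (f := g) (c := 0)
    (C := 2 * (Real.log (M / ‖f 0‖) + 1)) h2 ?_ ?_
  · refine h.trans (le_of_eq ?_)
    field_simp
    ring
  · refine (hgd.mono ?_).diffContOnCl
    rw [closure_ball _ h2.ne']
    exact Metric.closedBall_subset_ball (by linarith)
  · intro z hz
    rw [mem_sphere_zero_iff_norm] at hz
    refine (hg z (by rw [mem_ball_zero_iff, hz]; linarith)).trans (le_of_eq ?_)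
    rw [hz]
    field_simp
    ring

/-- Dividing out a zero by a Blaschke factor. -/
lemma exists_blaschke_div {f : ℂ → ℂ} {R R' M : ℝ} (hR : 0 < R) (hRR : R < R') {ρ : ℂ} (hρ : ‖ρ‖ < R)
    (hρ0 : ρ ≠ 0) (hf : DifferentiableOn ℂ f (Metric.ball 0 R')) (hfρ : f ρ = 0)
    (hM : ∀ z ∈ Metric.closedBall 0 R, ‖f z‖ ≤ M) :
    ∃ F : ℂ → ℂ, DifferentiableOn ℂ F (Metric.ball 0 R') ∧
      (∀ z ∈ Metric.closedBall 0 R, ‖F z‖ ≤ M) ∧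
      (∀ z ∈ Metric.closedBall 0 R, f z ≠ 0 → F z ≠ 0) ∧ ‖F 0‖ = R / ‖ρ‖ * ‖f 0‖ ∧
      (f 0 ≠ 0 → (deriv f 0 / f 0).re =
        (deriv F 0 / F 0).re - ρ.re * (1 / ‖ρ‖ ^ 2 - 1 / R ^ 2)) := by
  have hR0 : (R : ℂ) ≠ 0 := by exact_mod_cast hR.ne'
  have hball : Metric.ball (0 : ℂ) R' ∈ nhds ρ :=
    Metric.isOpen_ball.mem_nhds (by rw [mem_ball_zero_iff]; linarith)
  have hball0 : Metric.ball (0 : ℂ) R' ∈ nhds 0 :=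
    Metric.isOpen_ball.mem_nhds (by rw [mem_ball_zero_iff]; simp; linarith)
  have hden : ∀ z : ℂ, ‖z‖ ≤ R → (R : ℂ) ^ 2 - (starRingEnd ℂ) ρ * z ≠ 0 := by
    intro z hz h
    have h1 : ‖(R : ℂ) ^ 2‖ = ‖(starRingEnd ℂ) ρ * z‖ := by rw [sub_eq_zero.mp h]
    rw [norm_mul, RCLike.norm_conj, norm_pow, Complex.norm_of_nonneg hR.le] at h1
    have h3 : ‖ρ‖ * ‖z‖ ≤ ‖ρ‖ * R := mul_le_mul_of_nonneg_left hz (norm_nonneg _)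
    have h2 : ‖ρ‖ * R < R * R := mul_lt_mul_of_pos_right hρ hR
    nlinarith
  set G := dslope f ρ with hG
  have hGd : DifferentiableOn ℂ G (Metric.ball 0 R') :=
    (Complex.differentiableOn_dslope hball).mpr hf
  have hfG : ∀ z, f z = (z - ρ) * G z := by
    intro z
    have := sub_smul_dslope f ρ z
    rw [hfρ, sub_zero, smul_eq_mul] at this
    exact this.symm
  set F : ℂ → ℂ := fun z => G z * (((R : ℂ) ^ 2 - (starRingEnd ℂ) ρ * z) / R) with hF
  have hFd : DifferentiableOn ℂ F (Metric.ball 0 R') := by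
    refine hGd.mul (DifferentiableOn.div_const ?_ _)
    exact ((differentiable_const _).sub (differentiable_id.const_mul _)).differentiableOn
  have hFne : ∀ z ∈ Metric.closedBall (0 : ℂ) R, f z ≠ 0 → F z ≠ 0 := by
    intro z hz h
    rw [hfG z] at h
    exact mul_ne_zero (right_ne_zero_of_mul h)
      (div_ne_zero (hden z (mem_closedBall_zero_iff.mp hz)) hR0)
  have hsphere : ∀ z ∈ Metric.sphere (0 : ℂ) R, ‖F z‖ ≤ M := by
    intro z hz
    refine le_trans (le_of_eq ?_) (hM z (Metric.sphere_subset_closedBall hz))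
    have h1 := Complex.norm_canonicalFactor_eval_circle_eq_one
      (mem_ball_zero_iff.mpr hρ) hz
    rw [mem_sphere_zero_iff_norm] at hz
    have hzρ : z - ρ ≠ 0 := by
      intro h
      rw [sub_eq_zero.mp h] at hz
      linarith
    rw [Complex.canonicalFactor_apply] at h1
    have h2 : F z = f z * (((R : ℂ) ^ 2 - (starRingEnd ℂ) ρ * z) / (R * (z - ρ))) := by
      rw [hfG z, hF]
      field_simp
    rw [h2, norm_mul, h1, mul_one]
  refine ⟨F, hFd, ?_, hFne, ?_, ?_⟩
  · intro z hz
    refine Complex.norm_le_of_forall_mem_frontier_norm_le (U := Metric.ball 0 R)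
      Metric.isBounded_ball ?_ ?_ (by rwa [closure_ball _ hR.ne'])
    · refine (hFd.mono ?_).diffContOnCl
      rw [closure_ball _ hR.ne']
      exact Metric.closedBall_subset_ball hRR
    · rwa [frontier_ball _ hR.ne']
  · have h1 : F 0 = f 0 * (-(R / ρ)) := by
      rw [hfG 0, hF]
      field_simp
      simp
    rw [h1, norm_mul, norm_neg, norm_div, Complex.norm_of_nonneg hR.le, mul_comm]
  · intro hf0
    have hG0 : G 0 ≠ 0 := by
      rw [hfG 0] at hf0
      exact right_ne_zero_of_mul hf0
    have hGD : DifferentiableAt ℂ G 0 := hGd.differentiableAt hball0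
    have d1 : HasDerivAt f (1 * G 0 + (0 - ρ) * deriv G 0) 0 := by
      refine HasDerivAt.congr_of_eventuallyEq ?_ (Eventually.of_forall hfG)
      exact ((hasDerivAt_id (0 : ℂ)).sub_const ρ).mul hGD.hasDerivAt
    have d2 : HasDerivAt F (deriv G 0 * (((R : ℂ) ^ 2 - (starRingEnd ℂ) ρ * 0) / R) +
        G 0 * ((0 - (starRingEnd ℂ) ρ * 1) / R)) 0 := by
      refine hGD.hasDerivAt.mul (HasDerivAt.div_const ?_ _)
      exact (hasDerivAt_const _ _).sub ((hasDerivAt_id (0 : ℂ)).const_mul _)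
    have e : deriv f 0 / f 0 = deriv F 0 / F 0 - 1 / ρ + (starRingEnd ℂ) ρ / (R : ℂ) ^ 2 := by
      rw [d1.deriv, d2.deriv, hfG 0, hF]
      field_simp
      simp
      ring
    rw [e]
    have e2 : ((1 : ℂ) / ρ).re = ρ.re / ‖ρ‖ ^ 2 := by
      rw [one_div, Complex.inv_re, Complex.normSq_eq_norm_sq]
    have e3 : ((starRingEnd ℂ) ρ / (R : ℂ) ^ 2).re = ρ.re / R ^ 2 := by
      rw [← Complex.ofReal_pow, Complex.div_ofReal_re, Complex.conj_re]
    rw [Complex.add_re, Complex.sub_re, e2, e3]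
    ring

/-- An upper bound for `-Re (f'/f)(0)` when `f` has no zeros in a right half-disc. -/
lemma neg_re_deriv_div_le {f : ℂ → ℂ} {R R' r M : ℝ} (hr : 0 < r) (hrR : r < R) (hRR : R < R')
    (hf : DifferentiableOn ℂ f (Metric.ball 0 R')) (hf0 : f 0 ≠ 0)
    (hre : ∀ z ∈ Metric.closedBall 0 r, 0 ≤ z.re → f z ≠ 0)
    (hM : ∀ z ∈ Metric.closedBall 0 R, ‖f z‖ ≤ M) :
    -(deriv f 0 / f 0).re ≤ 4 / r * (Real.log (M / ‖f 0‖) + 1) := by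
  have hR : 0 < R := hr.trans hrR
  have h0R : (0 : ℂ) ∈ Metric.closedBall (0 : ℂ) R := Metric.mem_closedBall_self hR.le
  obtain ⟨n, hn⟩ : ∃ n : ℕ, M < (R / r) ^ n * ‖f 0‖ := by
    obtain ⟨n, hn⟩ := pow_unbounded_of_one_lt (M / ‖f 0‖) ((one_lt_div hr).mpr hrR)
    exact ⟨n, by rwa [div_lt_iff₀ (norm_pos_iff.mpr hf0)] at hn⟩
  induction n generalizing f with
  | zero =>
    exact absurd (hM 0 h0R) (by simpa using hn)
  | succ n ih =>
    by_cases hz : ∀ z ∈ Metric.ball (0 : ℂ) r, f z ≠ 0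
    · have h := norm_deriv_div_le hr
        (hf.mono (Metric.ball_subset_ball (by linarith))) hz
        (fun z hz => hM z (Metric.ball_subset_closedBall (Metric.ball_subset_ball hrR.le hz)))
      refine le_trans ?_ h
      exact (neg_le_abs _).trans (Complex.abs_re_le_norm _)
    · push Not at hz
      obtain ⟨ρ, hρ, hfρ⟩ := hz
      rw [mem_ball_zero_iff] at hρ
      have hρ0 : ρ ≠ 0 := by rintro rfl; exact hf0 hfρ
      have hρn : 0 < ‖ρ‖ := norm_pos_iff.mpr hρ0
      have hρre : ρ.re < 0 := by
        by_contra h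
        exact hre ρ (mem_closedBall_zero_iff.mpr hρ.le) (not_lt.mp h) hfρ
      obtain ⟨F, hFd, hFM, hFne, hF0, hFre⟩ :=
        exists_blaschke_div hR hRR (hρ.trans hrR) hρ0 hf hfρ hM
      have hfn : 0 < ‖f 0‖ := norm_pos_iff.mpr hf0
      have hge : R / r * ‖f 0‖ ≤ ‖F 0‖ := by
        rw [hF0]
        gcongr
      have hge1 : ‖f 0‖ ≤ ‖F 0‖ := by
        refine le_trans ?_ hge
        exact le_mul_of_one_le_left hfn.le ((one_lt_div hr).mpr hrR).le
      have h1 := ih hFd (hFne 0 h0R hf0)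
        (fun z hz h => hFne z (Metric.closedBall_subset_closedBall hrR.le hz) (hre z hz h)) hFM
        (by
          refine hn.trans_le ?_
          rw [pow_succ, mul_assoc]
          exact mul_le_mul_of_nonneg_left hge (by positivity))
      have hM0 : 0 < M := (hfn.trans_le hge1).trans_le (hFM 0 h0R)
      have h2 : Real.log (M / ‖F 0‖) ≤ Real.log (M / ‖f 0‖) :=
        Real.log_le_log (div_pos hM0 (hfn.trans_le hge1)) (by gcongr)
      have h3 : 4 / r * (Real.log (M / ‖F 0‖) + 1) ≤ 4 / r * (Real.log (M / ‖f 0‖) + 1) := by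
        gcongr
      rw [hFre hf0]
      have h4 : 0 ≤ 1 / ‖ρ‖ ^ 2 - 1 / R ^ 2 := by
        rw [sub_nonneg]
        gcongr
        linarith
      nlinarith

/-- The refinement of `neg_re_deriv_div_le` taking a real zero `-d` into account. -/
lemma neg_re_deriv_div_le_of_zero {f : ℂ → ℂ} {R R' r M d : ℝ} (hr : 0 < r) (hrR : r < R)
    (hRR : R < R') (hf : DifferentiableOn ℂ f (Metric.ball 0 R')) (hf0 : f 0 ≠ 0)
    (hre : ∀ z ∈ Metric.closedBall 0 r, 0 ≤ z.re → f z ≠ 0)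
    (hM : ∀ z ∈ Metric.closedBall 0 R, ‖f z‖ ≤ M) (hd : 0 < d) (hdR : d < R)
    (hfd : f (-d) = 0) :
    -(deriv f 0 / f 0).re ≤ 4 / r * (Real.log (M / ‖f 0‖) + 1) - (1 / d - d / R ^ 2) := by
  have hR : 0 < R := hr.trans hrR
  have h0R : (0 : ℂ) ∈ Metric.closedBall (0 : ℂ) R := Metric.mem_closedBall_self hR.le
  have hn : ‖(-d : ℂ)‖ = d := by rw [norm_neg, Complex.norm_of_nonneg hd.le]
  obtain ⟨F, hFd, hFM, hFne, hF0, hFre⟩ :=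
    exists_blaschke_div hR hRR (ρ := -d) (by rwa [hn]) (by simpa using hd.ne') hf hfd hM
  have hfn : 0 < ‖f 0‖ := norm_pos_iff.mpr hf0
  have hge1 : ‖f 0‖ ≤ ‖F 0‖ := by
    rw [hF0, hn]
    exact le_mul_of_one_le_left hfn.le ((one_lt_div hd).mpr hdR).le
  have h1 := neg_re_deriv_div_le hr hrR hRR hFd (hFne 0 h0R hf0)
    (fun z hz h => hFne z (Metric.closedBall_subset_closedBall hrR.le hz) (hre z hz h)) hFM
  have hM0 : 0 < M := (hfn.trans_le hge1).trans_le (hFM 0 h0R)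
  have h2 : Real.log (M / ‖F 0‖) ≤ Real.log (M / ‖f 0‖) :=
    Real.log_le_log (div_pos hM0 (hfn.trans_le hge1)) (by gcongr)
  have h3 : 4 / r * (Real.log (M / ‖F 0‖) + 1) ≤ 4 / r * (Real.log (M / ‖f 0‖) + 1) := by
    gcongr
  rw [hFre hf0, hn]
  have h4 : (-d : ℂ).re * (1 / d ^ 2 - 1 / R ^ 2) = -(1 / d - d / R ^ 2) := by
    rw [Complex.neg_re, Complex.ofReal_re]
    field_simp
  rw [h4]
  linarith

/-- The entire function `(s - 1) ζ(s)`. -/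
noncomputable def zetaMulSub : ℂ → ℂ := Function.update (fun s => (s - 1) * riemannZeta s) 1 1

lemma zetaMulSub_of_ne {s : ℂ} (hs : s ≠ 1) : zetaMulSub s = (s - 1) * riemannZeta s :=
  Function.update_of_ne hs _ _

lemma zetaMulSub_one : zetaMulSub 1 = 1 := Function.update_self _ _ _

lemma differentiable_zetaMulSub : Differentiable ℂ zetaMulSub := by
  rw [← differentiableOn_univ, ← Complex.differentiableOn_compl_singleton_and_continuousAt_iff
    (c := 1) univ_mem]
  constructor
  · intro s hs
    have hs1 : s ≠ 1 := hs.2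
    have h : DifferentiableAt ℂ (fun s => (s - 1) * riemannZeta s) s :=
      (differentiableAt_id.sub_const 1).mul (differentiableAt_riemannZeta hs1)
    refine (h.congr_of_eventuallyEq ?_).differentiableWithinAt
    filter_upwards [isOpen_ne.mem_nhds hs1] with z hz
    exact zetaMulSub_of_ne hz
  · rw [zetaMulSub, continuousAt_update_same]
    exact riemannZeta_residue_one

lemma zetaMulSub_ne_zero {s : ℂ} (hs : 1 ≤ s.re) : zetaMulSub s ≠ 0 := by
  rcases eq_or_ne s 1 with rfl | h
  · rw [zetaMulSub_one]; exact one_ne_zero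
  · rw [zetaMulSub_of_ne h]
    exact mul_ne_zero (sub_ne_zero.mpr h) (riemannZeta_ne_zero_of_one_le_re hs)

lemma riemannZeta_eq_zetaMulSub_div {s : ℂ} (hs : s ≠ 1) : riemannZeta s = zetaMulSub s / (s - 1) := by
  rw [zetaMulSub_of_ne hs, mul_div_cancel_left₀ _ (sub_ne_zero.mpr hs)]

lemma norm_LSeries_le_norm_riemannZeta {f : ℕ → ℂ} (hf : ∀ n, ‖f n‖ ≤ 1) {s : ℂ} (hs : 1 < s.re) :
    ‖LSeries f s‖ ≤ ‖riemannZeta (s.re : ℂ)‖ := by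
  have hsr : 1 < ((s.re : ℝ) : ℂ).re := by simpa using hs
  have h1 : HasSum (fun n : ℕ => 1 / ((n : ℝ)) ^ s.re) ‖riemannZeta (s.re : ℂ)‖ := by
    have h2 := Real.summable_one_div_nat_rpow.mpr hs
    have h3 : riemannZeta (s.re : ℂ) = ((∑' n : ℕ, 1 / (n : ℝ) ^ s.re : ℝ) : ℂ) := by
      rw [zeta_eq_tsum_one_div_nat_cpow hsr, Complex.ofReal_tsum]
      refine tsum_congr fun n => ?_
      rw [Complex.ofReal_div, Complex.ofReal_cpow (Nat.cast_nonneg n)]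
      simp
    rw [h3, Complex.norm_of_nonneg (tsum_nonneg fun n => by positivity)]
    exact h2.hasSum
  refine tsum_of_norm_bounded h1 fun n => ?_
  rcases Nat.eq_zero_or_pos n with rfl | hn
  · simp only [LSeries.term_zero, norm_zero]
    positivity
  · rw [LSeries.term_of_ne_zero hn.ne', norm_div, Complex.norm_natCast_cpow_of_pos hn]
    gcongr
    exact hf n

/-- `ζ(σ) ≪ 1/(σ-1)` for real `σ ∈ (1,3]`. -/
lemma exists_norm_riemannZeta_ofReal_le : ∃ C : ℝ, 1 ≤ C ∧ ∀ σ : ℝ, 1 < σ → σ ≤ 3 →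
    ‖riemannZeta (σ : ℂ)‖ ≤ C / (σ - 1) := by
  obtain ⟨C, hC⟩ := (isCompact_Icc (a := (1 : ℝ)) (b := 3)).exists_bound_of_continuousOn
    (f := fun σ : ℝ => zetaMulSub (σ : ℂ))
    (differentiable_zetaMulSub.continuous.comp Complex.continuous_ofReal).continuousOn
  refine ⟨max C 1, le_max_right _ _, fun σ h1 h3 => ?_⟩
  have hne : (σ : ℂ) ≠ 1 := by exact_mod_cast h1.ne'
  rw [riemannZeta_eq_zetaMulSub_div hne, norm_div]
  have : ‖(σ : ℂ) - 1‖ = σ - 1 := by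
    rw [← Complex.ofReal_one, ← Complex.ofReal_sub, Complex.norm_of_nonneg (by linarith)]
  rw [this]
  have h4 : 0 < σ - 1 := by linarith
  gcongr
  exact (hC σ ⟨h1.le, h3⟩).trans (le_max_left _ _)

lemma inv_riemannZeta_eq_LSeries {s : ℂ} (hs : 1 < s.re) :
    (riemannZeta s)⁻¹ = LSeries (fun n => ((ArithmeticFunction.moebius n : ℤ) : ℂ)) s := by
  have h := ArithmeticFunction.LSeries_zeta_mul_Lseries_moebius hs
  rw [ArithmeticFunction.LSeries_zeta_eq_riemannZeta hs] at h
  exact inv_eq_of_mul_eq_one_right h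

lemma norm_inv_riemannZeta_le {s : ℂ} (hs : 1 < s.re) :
    ‖(riemannZeta s)⁻¹‖ ≤ ‖riemannZeta (s.re : ℂ)‖ := by
  rw [inv_riemannZeta_eq_LSeries hs]
  refine norm_LSeries_le_norm_riemannZeta (fun n => ?_) hs
  rw [Complex.norm_intCast]
  exact_mod_cast ArithmeticFunction.abs_moebius_le_one

lemma exists_neg_re_deriv_riemannZeta_div_le : ∃ C : ℝ, 1 ≤ C ∧ ∀ σ : ℝ, 1 < σ → σ ≤ 2 →
    -(deriv riemannZeta σ / riemannZeta σ).re ≤ 1 / (σ - 1) + C := by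
  have hcont : ContinuousOn (fun σ : ℝ => deriv zetaMulSub (σ : ℂ) / zetaMulSub (σ : ℂ))
      (Set.Icc 1 2) := by
    refine ContinuousOn.div ?_ ?_ ?_
    · exact (((differentiable_zetaMulSub.contDiff (n := 1)).continuous_deriv le_rfl).comp
        Complex.continuous_ofReal).continuousOn
    · exact (differentiable_zetaMulSub.continuous.comp Complex.continuous_ofReal).continuousOn
    · intro σ hσ
      exact zetaMulSub_ne_zero (by simpa using hσ.1)
  obtain ⟨C, hC⟩ := (isCompact_Icc (a := (1 : ℝ)) (b := 2)).exists_bound_of_continuousOn hcont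
  refine ⟨max C 1, le_max_right _ _, fun σ h1 h2 => ?_⟩
  have hne : (σ : ℂ) ≠ 1 := by exact_mod_cast h1.ne'
  have hz : zetaMulSub σ ≠ 0 := zetaMulSub_ne_zero (by simpa using h1.le)
  have hs1 : (σ : ℂ) - 1 ≠ 0 := sub_ne_zero.mpr hne
  have hd : HasDerivAt riemannZeta
      ((deriv zetaMulSub σ * ((σ : ℂ) - 1) - zetaMulSub σ * 1) / ((σ : ℂ) - 1) ^ 2) σ := by
    have h := (differentiable_zetaMulSub (σ : ℂ)).hasDerivAt.div
      ((hasDerivAt_id (σ : ℂ)).sub_const 1) hs1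
    refine h.congr_of_eventuallyEq ?_
    filter_upwards [isOpen_ne.mem_nhds hne] with z hz
    exact riemannZeta_eq_zetaMulSub_div hz
  have e : deriv riemannZeta σ / riemannZeta σ =
      deriv zetaMulSub σ / zetaMulSub σ - ((1 / (σ - 1) : ℝ) : ℂ) := by
    rw [hd.deriv, riemannZeta_eq_zetaMulSub_div hne]
    push_cast
    field_simp
  rw [e, Complex.sub_re, Complex.ofReal_re]
  have h3 := (Complex.abs_re_le_norm _).trans (hC σ ⟨h1.le, h2⟩)
  have h4 := neg_le_abs (deriv zetaMulSub σ / zetaMulSub σ).re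
  have h5 := le_max_left C 1
  linarith

lemma re_three_add_four_mul_add_sq_nonneg {w : ℂ} (hw : ‖w‖ = 1) : 0 ≤ (3 + 4 * w + w ^ 2).re := by
  have h : w.re ^ 2 + w.im ^ 2 = 1 := by
    rw [← one_pow 2, ← hw, Complex.sq_norm, Complex.normSq_apply]; ring
  simp only [Complex.add_re, Complex.mul_re, pow_two, Complex.re_ofNat, Complex.im_ofNat]
  nlinarith [sq_nonneg (w.re + 1)]

lemma three_four_one_deriv_riemannZeta {σ : ℝ} (hσ : 1 < σ) (t : ℝ) :
    0 ≤ 3 * (-(deriv riemannZeta σ / riemannZeta σ).re) +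
      4 * (-(deriv riemannZeta (σ + t * Complex.I) / riemannZeta (σ + t * Complex.I)).re) +
      (-(deriv riemannZeta (σ + (2 * t : ℝ) * Complex.I) /
        riemannZeta (σ + (2 * t : ℝ) * Complex.I)).re) := by
  have hre : ∀ u : ℝ, 1 < ((σ : ℂ) + (u : ℂ) * Complex.I).re := fun u => by simpa using hσ
  set f : ℕ → ℂ := fun n => ((ArithmeticFunction.vonMangoldt n : ℝ) : ℂ) with hf
  have key : ∀ u : ℝ, HasSum (LSeries.term f (σ + u * Complex.I))
      (-(deriv riemannZeta (σ + u * Complex.I) / riemannZeta (σ + u * Complex.I))) := by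
    intro u
    have h := ArithmeticFunction.LSeries_vonMangoldt_eq_deriv_riemannZeta_div (hre u)
    rw [← neg_div, ← h]
    exact (ArithmeticFunction.LSeriesSummable_vonMangoldt (hre u)).LSeriesHasSum
  have h0 := key 0
  simp only [Complex.ofReal_zero, zero_mul, add_zero] at h0
  have hs := ((h0.mul_left 3).add ((key t).mul_left 4)).add (key (2 * t))
  have hs2 := Complex.reCLM.hasSum hs
  have hnn := hs2.nonneg (fun n => ?_)
  · simpa using hnn
  · simp only [Complex.reCLM_apply]
    rcases Nat.eq_zero_or_pos n with rfl | hn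
    · simp
    · have hn0 : (n : ℂ) ≠ 0 := by exact_mod_cast hn.ne'
      set w : ℂ := (n : ℂ) ^ (-(t * Complex.I)) with hw
      have hwn : ‖w‖ = 1 := by
        rw [hw, Complex.norm_natCast_cpow_of_pos hn]; simp
      have e0 : (n : ℂ) ^ (-(σ : ℂ)) = (((n : ℝ) ^ (-σ) : ℝ) : ℂ) := by
        rw [Complex.ofReal_cpow (Nat.cast_nonneg n)]; simp
      have e : ∀ s : ℂ, LSeries.term f s n = f n * (n : ℂ) ^ (-s) := by
        intro s
        rw [LSeries.term_of_ne_zero hn.ne', div_eq_mul_inv, Complex.cpow_neg]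
      have e1 : (n : ℂ) ^ (-((σ : ℂ) + t * Complex.I)) = (n : ℂ) ^ (-(σ : ℂ)) * w := by
        rw [hw, ← Complex.cpow_add _ _ hn0]; congr 1; ring
      have e2 : (n : ℂ) ^ (-((σ : ℂ) + (2 * t : ℝ) * Complex.I)) = (n : ℂ) ^ (-(σ : ℂ)) * w ^ 2 := by
        rw [hw, pow_two, ← Complex.cpow_add _ _ hn0, ← Complex.cpow_add _ _ hn0]; congr 1
        push_cast; ring
      rw [e, e, e, e1, e2, e0]
      have e3 : 3 * (f n * (((n : ℝ) ^ (-σ) : ℝ) : ℂ)) + 4 * (f n * ((((n : ℝ) ^ (-σ) : ℝ) : ℂ) * w)) +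
          f n * ((((n : ℝ) ^ (-σ) : ℝ) : ℂ) * w ^ 2) =
          ((ArithmeticFunction.vonMangoldt n * (n : ℝ) ^ (-σ) : ℝ) : ℂ) * (3 + 4 * w + w ^ 2) := by
        rw [hf]; push_cast; ring
      rw [e3, Complex.re_ofReal_mul]
      exact mul_nonneg (mul_nonneg ArithmeticFunction.vonMangoldt_nonneg (by positivity))
        (re_three_add_four_mul_add_sq_nonneg hwn)

lemma differentiableOn_riemannZeta_add {s₀ : ℂ} {R : ℝ} (h : R < s₀.im) :
    DifferentiableOn ℂ (fun z => riemannZeta (s₀ + z)) (Metric.ball 0 R) := by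
  intro z hz
  refine DifferentiableAt.differentiableWithinAt ?_
  have hne : s₀ + z ≠ 1 := by
    intro h1
    have h2 : s₀.im + z.im = 0 := by
      have := congrArg Complex.im h1
      simpa using this
    have h3 := Complex.abs_im_le_norm z
    rw [mem_ball_zero_iff] at hz
    have h4 := neg_abs_le z.im
    linarith
  exact (differentiableAt_riemannZeta hne).comp z ((differentiableAt_const _).add differentiableAt_id)

lemma norm_riemannZeta_add_le {φ θ H A : ℝ} (hθ1 : θ ≤ 1 / 16)
    (hz : ∀ t σ : ℝ, 3 ≤ t → t ≤ H → 1 - θ ≤ σ → σ < 3 →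
      ‖riemannZeta (σ + t * Complex.I)‖ ≤ Real.exp (A * φ))
    {x t : ℝ} (hx : 0 ≤ x) (hx1 : x ≤ 1 / 2) (ht : 4 ≤ t) (htH : t + 1 ≤ H) {z : ℂ} (hzn : ‖z‖ ≤ θ + x)
    (hz1 : ‖z‖ ≤ 1) :
    ‖riemannZeta (((1 + x : ℝ) : ℂ) + t * Complex.I + z)‖ ≤ Real.exp (A * φ) := by
  have h1 := Complex.abs_re_le_norm z
  have h2 := Complex.abs_im_le_norm z
  rw [abs_le] at h1 h2
  have h := hz (t + z.im) (1 + x + z.re) (by linarith) (by linarith) (by linarith) (by linarith)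
  convert h using 3
  apply Complex.ext <;> simp

lemma log_div_norm_add_one_le {A C₁ φ θ a m : ℝ} (hA : 1 ≤ A) (hφ : 1 ≤ φ)
    (hθ : 0 < θ) (hLφ : φ / θ ≤ Real.exp φ) (ha : 0 < a) (hC1 : 1 ≤ C₁) (haC : C₁ ≤ a * Real.exp φ)
    (hm : a * θ / φ / C₁ ≤ m) :
    Real.exp (-(2 * φ)) ≤ m ∧ Real.log (Real.exp (A * φ) / m) + 1 ≤ (A + 3) * φ := by
  have h1 : Real.exp (-(2 * φ)) ≤ m := by
    refine le_trans ?_ hm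
    rw [div_div, le_div_iff₀ (by positivity)]
    rw [div_le_iff₀ hθ] at hLφ
    calc Real.exp (-(2 * φ)) * (φ * C₁) ≤
          Real.exp (-(2 * φ)) * ((Real.exp φ * θ) * (a * Real.exp φ)) := by gcongr
      _ = a * θ * (Real.exp (-(2 * φ)) * (Real.exp φ * Real.exp φ)) := by ring
      _ = a * θ := by
        rw [← Real.exp_add, ← Real.exp_add, show -(2 * φ) + (φ + φ) = 0 by ring, Real.exp_zero,
          mul_one]
  refine ⟨h1, ?_⟩
  have hm0 : 0 < m := (Real.exp_pos _).trans_le h1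
  have h2 : Real.log (Real.exp (A * φ) / m) ≤ A * φ + 2 * φ := by
    rw [Real.log_div (Real.exp_ne_zero _) hm0.ne', Real.log_exp]
    have := (Real.le_log_iff_exp_le hm0).mpr h1
    linarith
  nlinarith

lemma norm_riemannZeta_ge {C₁ : ℝ} (hC1 : 1 ≤ C₁)
    (h1 : ∀ σ : ℝ, 1 < σ → σ ≤ 3 → ‖riemannZeta (σ : ℂ)‖ ≤ C₁ / (σ - 1)) {x : ℝ} (hx : 0 < x)
    (hx1 : x ≤ 1) (t : ℝ) : x / C₁ ≤ ‖riemannZeta (((1 + x : ℝ) : ℂ) + t * Complex.I)‖ := by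
  have hre : (((1 + x : ℝ) : ℂ) + t * Complex.I).re = 1 + x := by simp
  have h2 := norm_inv_riemannZeta_le (s := ((1 + x : ℝ) : ℂ) + t * Complex.I) (by rw [hre]; linarith)
  rw [hre] at h2
  have h3 := h2.trans (h1 (1 + x) (by linarith) (by linarith))
  rw [norm_inv, add_sub_cancel_left] at h3
  have h4 : 0 < ‖riemannZeta (((1 + x : ℝ) : ℂ) + t * Complex.I)‖ :=
    norm_pos_iff.mpr (riemannZeta_ne_zero_of_one_le_re (by rw [hre]; linarith))
  have h5 := inv_anti₀ (inv_pos.mpr h4) h3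
  rwa [inv_inv, inv_div] at h5

section Region

variable {A C₁ C₂ φ θ H a : ℝ}

lemma neg_re_deriv_riemannZeta_le (hA : 1 ≤ A) (hC1 : 1 ≤ C₁)
    (h1 : ∀ σ : ℝ, 1 < σ → σ ≤ 3 → ‖riemannZeta (σ : ℂ)‖ ≤ C₁ / (σ - 1))
    (hφ : 1 ≤ φ) (hθ : 0 < θ) (hθ1 : θ ≤ 1 / 16) (hLφ : φ / θ ≤ Real.exp φ) (ha : 0 < a)
    (ha1 : a ≤ 1) (haC : C₁ ≤ a * Real.exp φ)
    (hz : ∀ t σ : ℝ, 3 ≤ t → t ≤ H → 1 - θ ≤ σ → σ < 3 →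
      ‖riemannZeta (σ + t * Complex.I)‖ ≤ Real.exp (A * φ)) {t : ℝ} (ht : 4 ≤ t) (htH : t + 1 ≤ H) :
    -(deriv riemannZeta ((1 + a * θ / φ : ℝ) + t * Complex.I) /
      riemannZeta ((1 + a * θ / φ : ℝ) + t * Complex.I)).re ≤ 8 * (A + 3) * (φ / θ) ∧
    ∀ d : ℝ, 0 < d → d < θ → riemannZeta ((1 + a * θ / φ - d : ℝ) + t * Complex.I) = 0 →
      -(deriv riemannZeta ((1 + a * θ / φ : ℝ) + t * Complex.I) /
        riemannZeta ((1 + a * θ / φ : ℝ) + t * Complex.I)).re ≤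
          8 * (A + 3) * (φ / θ) - (1 / d - d / θ ^ 2) := by
  set x := a * θ / φ with hx
  have hx0 : 0 < x := by positivity
  have hxθ : x ≤ θ := by
    rw [hx, div_le_iff₀ (by linarith)]
    nlinarith
  set s₀ : ℂ := ((1 + x : ℝ) : ℂ) + t * Complex.I with hs₀
  have him : s₀.im = t := by simp [hs₀]
  have hre : s₀.re = 1 + x := by simp [hs₀]
  set f : ℂ → ℂ := fun z => riemannZeta (s₀ + z) with hf
  have hfd : DifferentiableOn ℂ f (Metric.ball 0 1) :=
    differentiableOn_riemannZeta_add (by rw [him]; linarith)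
  have hf0 : f 0 = riemannZeta s₀ := by simp [hf]
  have hdf : deriv f 0 = deriv riemannZeta s₀ := by
    have := deriv_comp_const_add (f := riemannZeta) (a := s₀) (x := 0)
    simpa [hf] using this
  have hm := norm_riemannZeta_ge hC1 h1 hx0 (by linarith) t
  rw [← hs₀] at hm
  obtain ⟨-, hlog⟩ := log_div_norm_add_one_le hA hφ hθ hLφ ha hC1 haC hm
  have hne : ∀ z : ℂ, 0 ≤ z.re → f z ≠ 0 := fun z hz =>
    riemannZeta_ne_zero_of_one_le_re (by rw [Complex.add_re, hre]; linarith)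
  have hM : ∀ z ∈ Metric.closedBall 0 θ, ‖f z‖ ≤ Real.exp (A * φ) := by
    intro z hzm
    rw [mem_closedBall_zero_iff] at hzm
    exact norm_riemannZeta_add_le hθ1 hz hx0.le (by linarith) ht htH (by linarith) (by linarith)
  have hb : 4 / (θ / 2) * (Real.log (Real.exp (A * φ) / ‖f 0‖) + 1) ≤ 8 * (A + 3) * (φ / θ) := by
    rw [hf0]
    calc _ ≤ 4 / (θ / 2) * ((A + 3) * φ) := by gcongr
      _ = _ := by field_simp; ring
  have hr2 : θ / 2 < θ := by linarith
  rw [← hdf, ← hf0]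
  constructor
  · exact (neg_re_deriv_div_le (by linarith) hr2 (by linarith : θ < 1) hfd (hne 0 le_rfl)
      (fun z _ h => hne z h) hM).trans hb
  · intro d hd hdθ hzd
    have h := neg_re_deriv_div_le_of_zero (by linarith) hr2 (by linarith : θ < 1) hfd (hne 0 le_rfl)
      (fun z _ h => hne z h) hM hd hdθ (by
        rw [hf, ← hzd, hs₀]
        push_cast
        ring_nf)
    linarith

/-- A zero-free region for `ζ` deduced from an upper bound in a strip. -/
lemma riemannZeta_ne_zero_of_bound (hA : 1 ≤ A) (hC1 : 1 ≤ C₁)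
    (h1 : ∀ σ : ℝ, 1 < σ → σ ≤ 3 → ‖riemannZeta (σ : ℂ)‖ ≤ C₁ / (σ - 1)) (hC2 : 1 ≤ C₂)
    (h2 : ∀ σ : ℝ, 1 < σ → σ ≤ 2 →
      -(deriv riemannZeta σ / riemannZeta σ).re ≤ 1 / (σ - 1) + C₂)
    (hφ : 1 ≤ φ) (hθ : 0 < θ) (hθ1 : θ ≤ 1 / 16) (hLφ : φ / θ ≤ Real.exp φ) (ha : 0 < a)
    (haB : 100 * (8 * (A + 3) + C₂) * a ≤ 1) (haC : C₁ ≤ a * Real.exp φ)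
    (hz : ∀ t σ : ℝ, 3 ≤ t → t ≤ H → 1 - θ ≤ σ → σ < 3 →
      ‖riemannZeta (σ + t * Complex.I)‖ ≤ Real.exp (A * φ)) {t β : ℝ} (ht : 4 ≤ t)
    (htH : 2 * t + 1 ≤ H) (hβ : 1 - a * θ / φ / 10 ≤ β) :
    riemannZeta (β + t * Complex.I) ≠ 0 := by
  intro hzero
  have hβ1 : β < 1 := by
    by_contra h
    exact riemannZeta_ne_zero_of_one_le_re (by simpa using h) hzero
  have ha1 : a ≤ 1 / 100 := by nlinarith
  set x := a * θ / φ with hx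
  have hx0 : 0 < x := by positivity
  have hxa : x ≤ a * θ := by
    rw [hx, div_le_iff₀ (by linarith)]
    nlinarith [mul_pos ha hθ]
  have hxθ : x ≤ θ / 100 := by nlinarith
  have hL : φ / θ = a / x := by
    rw [hx]; field_simp
  set d := 1 + x - β with hd
  have hd0 : 0 < d := by linarith
  have hdx : d ≤ 11 / 10 * x := by linarith
  have e1 := (neg_re_deriv_riemannZeta_le hA hC1 h1 hφ hθ hθ1 hLφ ha (by linarith) haC hz ht
    (by linarith)).2 d hd0 (by linarith) (by
      rw [← hzero, ← hx, hd]
      push_cast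
      ring_nf)
  have e2 := (neg_re_deriv_riemannZeta_le hA hC1 h1 hφ hθ hθ1 hLφ ha (by linarith) haC hz
    (t := 2 * t) (by linarith) (by linarith)).1
  have e3 := h2 (1 + x) (by linarith) (by linarith)
  have e4 := three_four_one_deriv_riemannZeta (σ := 1 + x) (by linarith) t
  rw [← hx, hL] at e1 e2
  rw [add_sub_cancel_left] at e3
  have e5 : 10 / (11 * x) ≤ 1 / d := by
    rw [div_le_div_iff₀ (by positivity) hd0]
    linarith
  have e6 : d / θ ^ 2 ≤ 1 / 1000 / x := by
    rw [div_le_div_iff₀ (by positivity) hx0]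
    have h3 : d * x ≤ 11 / 10 * x * x := mul_le_mul_of_nonneg_right hdx hx0.le
    have h4 : x * x ≤ (θ / 100) * (θ / 100) := mul_le_mul hxθ hxθ hx0.le (by linarith)
    nlinarith
  have e7 : 0 ≤ 3 * (1 / x + C₂) + 4 * (8 * (A + 3) * (a / x) - (10 / (11 * x) - 1 / 1000 / x)) +
      8 * (A + 3) * (a / x) := by linarith
  have e8 : 3 * (1 / x + C₂) + 4 * (8 * (A + 3) * (a / x) - (10 / (11 * x) - 1 / 1000 / x)) +
      8 * (A + 3) * (a / x) =
      (3 + 3 * C₂ * x + 5 * (8 * (A + 3)) * a - 40 / 11 + 4 / 1000) / x := by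
    field_simp
    ring
  rw [e8] at e7
  have e9 : 3 + 3 * C₂ * x + 5 * (8 * (A + 3)) * a - 40 / 11 + 4 / 1000 < 0 := by
    have hxa' : x ≤ a := by nlinarith
    have : C₂ * x ≤ C₂ * a := by gcongr
    have h4 : 0 < C₂ * a := by positivity
    have h5 : 0 < (A + 3) * a := by positivity
    nlinarith
  exact absurd e7 (not_le.mpr (div_neg_of_neg_of_pos e9 hx0))

lemma norm_inv_riemannZeta_le_of_bound (hA : 1 ≤ A) (hC1 : 1 ≤ C₁)
    (h1 : ∀ σ : ℝ, 1 < σ → σ ≤ 3 → ‖riemannZeta (σ : ℂ)‖ ≤ C₁ / (σ - 1)) (hC2 : 1 ≤ C₂)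
    (h2 : ∀ σ : ℝ, 1 < σ → σ ≤ 2 →
      -(deriv riemannZeta σ / riemannZeta σ).re ≤ 1 / (σ - 1) + C₂)
    (hφ : 1 ≤ φ) (hθ : 0 < θ) (hθ1 : θ ≤ 1 / 16) (hLφ : φ / θ ≤ Real.exp φ) (ha : 0 < a)
    (haB : 100 * (8 * (A + 3) + C₂) * a ≤ 1) (haC : C₁ ≤ a * Real.exp φ)
    (hz : ∀ t σ : ℝ, 3 ≤ t → t ≤ H → 1 - θ ≤ σ → σ < 3 →
      ‖riemannZeta (σ + t * Complex.I)‖ ≤ Real.exp (A * φ)) {t σ : ℝ} (ht : 5 ≤ t)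
    (htH : 2 * t + 3 ≤ H) (hσ : 1 - a * θ / φ / 20 ≤ σ) (hσ2 : σ ≤ 2) :
    riemannZeta (σ + t * Complex.I) ≠ 0 ∧
      ‖(riemannZeta (σ + t * Complex.I))⁻¹‖ ≤ Real.exp ((42 * (A + 3) + 2) * φ) := by
  have ha1 : a ≤ 1 / 100 := by nlinarith
  set x := a * θ / φ with hx
  have hx0 : 0 < x := by positivity
  have hxa : x ≤ a * θ := by
    rw [hx, div_le_iff₀ (by linarith)]
    nlinarith [mul_pos ha hθ]
  have hxθ : x ≤ θ / 100 := by nlinarith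
  have hnz : ∀ t' β : ℝ, 4 ≤ t' → 2 * t' + 1 ≤ H → 1 - x / 10 ≤ β →
      riemannZeta (β + t' * Complex.I) ≠ 0 := fun t' β h3 h4 h5 =>
    riemannZeta_ne_zero_of_bound hA hC1 h1 hC2 h2 hφ hθ hθ1 hLφ ha haB haC hz h3 h4 h5
  refine ⟨hnz t σ (by linarith) (by linarith) (by linarith), ?_⟩
  have hm := norm_riemannZeta_ge hC1 h1 hx0 (by linarith) t
  obtain ⟨hexp, hlog⟩ := log_div_norm_add_one_le hA hφ hθ hLφ ha hC1 haC hm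
  rcases le_total (1 + x) σ with h | h
  · have hm2 := norm_riemannZeta_ge hC1 h1 (x := σ - 1) (by linarith) (by linarith) t
    rw [add_sub_cancel] at hm2
    have h3 : Real.exp (-(2 * φ)) ≤ ‖riemannZeta (σ + t * Complex.I)‖ := by
      refine (log_div_norm_add_one_le hA hφ hθ hLφ ha hC1 haC (le_trans ?_ hm2)).1
      rw [← hx]
      gcongr
      linarith
    rw [norm_inv]
    refine (inv_anti₀ (Real.exp_pos _) h3).trans ?_
    rw [← Real.exp_neg, neg_neg]
    refine Real.exp_le_exp.mpr ?_
    nlinarith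
  · set s₀ : ℂ := ((1 + x : ℝ) : ℂ) + t * Complex.I with hs₀
    have him : s₀.im = t := by simp [hs₀]
    set f : ℂ → ℂ := fun z => riemannZeta (s₀ + z) with hf
    have hr : 0 < 11 / 10 * x := by positivity
    have hfd : DifferentiableOn ℂ f (Metric.ball 0 (11 / 10 * x)) :=
      differentiableOn_riemannZeta_add (by rw [him]; linarith)
    have hf0 : f 0 = riemannZeta s₀ := by simp [hf]
    have hfne : ∀ z ∈ Metric.ball 0 (11 / 10 * x), f z ≠ 0 := by
      intro z hzm
      rw [mem_ball_zero_iff] at hzm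
      have h3 := Complex.abs_re_le_norm z
      have h4 := Complex.abs_im_le_norm z
      rw [abs_le] at h3 h4
      have h5 := hnz (t + z.im) (1 + x + z.re) (by linarith) (by linarith) (by linarith)
      convert h5 using 2
      apply Complex.ext <;> simp [hs₀]
    have hM : ∀ z ∈ Metric.ball 0 (11 / 10 * x), ‖f z‖ ≤ Real.exp (A * φ) := by
      intro z hzm
      rw [mem_ball_zero_iff] at hzm
      exact norm_riemannZeta_add_le hθ1 hz hx0.le (by linarith) (by linarith) (by linarith)
        (by linarith) (by linarith)
    obtain ⟨g, -, -, hg, hgn⟩ := exists_eq_mul_exp_of_norm_le hr hfd hfne hM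
    have hnorm : ‖((σ - 1 - x : ℝ) : ℂ)‖ ≤ 21 / 20 * x := by
      rw [Complex.norm_real, Real.norm_eq_abs, abs_le]
      constructor <;> linarith
    have hmem : ((σ - 1 - x : ℝ) : ℂ) ∈ Metric.ball (0 : ℂ) (11 / 10 * x) := by
      rw [mem_ball_zero_iff]
      linarith
    have hfz : f ((σ - 1 - x : ℝ) : ℂ) = riemannZeta (σ + t * Complex.I) := by
      rw [hf, hs₀]
      push_cast
      ring_nf
    have h3 := hgn _ hmem
    have h4 := hg _ hmem
    rw [hfz, hf0] at h4
    rw [hf0] at h3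
    have h5 : ‖g ((σ - 1 - x : ℝ) : ℂ)‖ ≤ 42 * (A + 3) * φ := by
      refine h3.trans ?_
      rw [div_le_iff₀ (by linarith)]
      have hK : 0 < (A + 3) * φ := by positivity
      have h6 : 2 * (Real.log (Real.exp (A * φ) / ‖riemannZeta s₀‖) + 1) *
          ‖((σ - 1 - x : ℝ) : ℂ)‖ ≤ 2 * ((A + 3) * φ) * (21 / 20 * x) := by gcongr
      have h7 : 42 * ((A + 3) * φ) * (x / 20) ≤
          42 * ((A + 3) * φ) * (11 / 10 * x - ‖((σ - 1 - x : ℝ) : ℂ)‖) := by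
        gcongr
        linarith
      linarith
    rw [h4, norm_inv, norm_mul, Complex.norm_exp, mul_inv, ← Real.exp_neg, add_mul, add_comm,
      Real.exp_add]
    refine mul_le_mul ?_ ?_ (Real.exp_pos _).le (Real.exp_pos _).le
    · refine (inv_anti₀ (Real.exp_pos _) hexp).trans ?_
      rw [← Real.exp_neg, neg_neg]
    · refine Real.exp_le_exp.mpr ?_
      exact ((neg_le_abs _).trans (Complex.abs_re_le_norm _)).trans h5

end Region

lemma exists_norm_inv_zetaMulSub_le_of_abs_le (H : ℝ) : ∃ r > (0 : ℝ), ∃ M : ℝ, ∀ t σ : ℝ, |t| ≤ H →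
    1 - r ≤ σ → σ ≤ 2 → zetaMulSub (σ + t * Complex.I) ≠ 0 ∧
      ‖(zetaMulSub (σ + t * Complex.I))⁻¹‖ ≤ M := by
  have hK : IsCompact (Set.Icc (1 : ℝ) 2 ×ℂ Set.Icc (-H) H) := isCompact_Icc.reProdIm isCompact_Icc
  have hU : IsOpen {s : ℂ | zetaMulSub s ≠ 0} :=
    isOpen_ne_fun differentiable_zetaMulSub.continuous continuous_const
  obtain ⟨r, hr, hrU⟩ := hK.exists_cthickening_subset_open hU (by
    intro s hs
    rw [Complex.mem_reProdIm] at hs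
    exact zetaMulSub_ne_zero hs.1.1)
  obtain ⟨M, hM⟩ := (hK.cthickening (r := r)).exists_bound_of_continuousOn
    (f := fun s => (zetaMulSub s)⁻¹)
    (differentiable_zetaMulSub.continuous.continuousOn.inv₀ (fun s hs => hrU hs))
  have hmem : ∀ t σ : ℝ, |t| ≤ H → 1 - r ≤ σ → σ ≤ 2 →
      (σ + t * Complex.I : ℂ) ∈ Metric.cthickening r (Set.Icc (1 : ℝ) 2 ×ℂ Set.Icc (-H) H) := by
    intro t σ ht h1 h2
    refine Metric.mem_cthickening_of_dist_le _ (((max σ 1 : ℝ) : ℂ) + t * Complex.I) _ _ ?_ ?_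
    · rw [Complex.mem_reProdIm]
      simpa [h2] using abs_le.mp ht
    · rw [dist_eq_norm, add_sub_add_right_eq_sub, ← Complex.ofReal_sub, Complex.norm_real,
        Real.norm_eq_abs, abs_le]
      rcases le_total σ 1 with h | h
      · rw [max_eq_right h]
        constructor <;> linarith
      · rw [max_eq_left h]
        constructor <;> linarith
  exact ⟨r, hr, M, fun t σ h0 h1 h2 => ⟨hrU (hmem t σ h0 h1 h2), hM _ (hmem t σ h0 h1 h2)⟩⟩

lemma norm_inv_zetaMulSub_conj (s : ℂ) :
    ‖(zetaMulSub ((starRingEnd ℂ) s))⁻¹‖ = ‖(zetaMulSub s)⁻¹‖ := by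
  rcases eq_or_ne s 1 with rfl | h
  · rw [map_one]
  · have h' : (starRingEnd ℂ) s ≠ 1 := by
      intro h2
      exact h (by simpa using congrArg (starRingEnd ℂ) h2)
    rw [zetaMulSub_of_ne h, zetaMulSub_of_ne h', riemannZeta_conj,
      show (starRingEnd ℂ) s - 1 = (starRingEnd ℂ) (s - 1) by simp, ← map_mul, norm_inv, norm_inv,
      Complex.norm_conj]

/-- Vinogradov–Korobov zero-free region for `ζ`, with a bound for `1 / ζ`. -/
lemma exists_norm_inv_zetaMulSub_le : ∃ A b φ₀ : ℝ, 1 ≤ A ∧ 0 < b ∧ b ≤ 1 ∧ ∀ φ : ℝ, φ₀ ≤ φ →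
    ∀ t σ : ℝ, |t| ≤ Real.exp (Real.exp φ) →
      1 - b * ((φ / Real.exp φ) ^ (2 / 3 : ℝ) / φ) ≤ σ → σ ≤ 2 →
      zetaMulSub (σ + t * Complex.I) ≠ 0 ∧
        ‖(zetaMulSub (σ + t * Complex.I))⁻¹‖ ≤ Real.exp (A * φ) := by
  obtain ⟨C, hC, hζ⟩ := exists_norm_riemannZeta_le
  obtain ⟨C₁, hC1, h1⟩ := exists_norm_riemannZeta_ofReal_le
  obtain ⟨C₂, hC2, h2⟩ := exists_neg_re_deriv_riemannZeta_div_le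
  obtain ⟨r, hr, M, hM⟩ := exists_norm_inv_zetaMulSub_le_of_abs_le 5
  set A : ℝ := 120004 with hA
  set a : ℝ := 1 / (100 * (8 * (A + 3) + C₂)) with ha
  have ha0 : 0 < a := by positivity
  have ha1 : a ≤ 1 := by
    rw [ha, div_le_one (by positivity), hA]
    linarith
  have hev : ∀ᶠ φ : ℝ in atTop, 1 ≤ φ ∧ Real.log (8 * C) ≤ φ ∧ C₁ ≤ a * Real.exp φ ∧
      64 * φ ≤ Real.exp φ ∧ M ≤ φ ∧ 1 / r ≤ φ := by
    have e1 : Tendsto (fun φ : ℝ => φ / Real.exp φ) atTop (nhds 0) := by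
      simpa using Real.tendsto_pow_mul_exp_neg_atTop_nhds_zero 1 |>.congr
        (fun x => by rw [pow_one, Real.exp_neg, div_eq_mul_inv])
    filter_upwards [eventually_ge_atTop 1, eventually_ge_atTop (Real.log (8 * C)),
      eventually_ge_atTop M, e1.eventually_le_const (by norm_num : (0 : ℝ) < 1 / 64),
      eventually_ge_atTop (1 / r),
      Real.tendsto_exp_atTop.eventually_ge_atTop (C₁ / a)] with φ q1 q2 q3 q4 q5 q6
    refine ⟨q1, q2, ?_, ?_, q3, q5⟩
    · rwa [div_le_iff₀' ha0] at q6
    · rw [div_le_iff₀ (Real.exp_pos _)] at q4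
      linarith
  obtain ⟨φ₀, hφ₀⟩ := eventually_atTop.mp hev
  refine ⟨42 * (A + 3) + 2, a / 20, φ₀, by rw [hA]; norm_num, by positivity, by linarith,
    fun φ hφ => ?_⟩
  obtain ⟨p1, p2, p3, p4, p5, p6⟩ := hφ₀ φ hφ
  have hφ0 : 0 < φ := by linarith
  set ℓ := Real.exp φ with hℓ
  have hℓ0 : 0 < ℓ := Real.exp_pos _
  set θ := (φ / ℓ) ^ (2 / 3 : ℝ) with hθ
  have hq0 : 0 < φ / ℓ := by positivity
  have hq : φ / ℓ ≤ 1 / 64 := by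
    rw [div_le_iff₀ hℓ0]; linarith
  have hθ0 : 0 < θ := Real.rpow_pos_of_pos hq0 _
  have hθ1 : θ ≤ 1 / 16 := by
    calc θ ≤ (1 / 64 : ℝ) ^ (2 / 3 : ℝ) := Real.rpow_le_rpow hq0.le hq (by norm_num)
      _ = 1 / 16 := by
        rw [show (1 / 64 : ℝ) = (1 / 4) ^ (3 : ℝ) by norm_num, ← Real.rpow_mul (by norm_num)]
        norm_num
  have hqθ : φ / ℓ ≤ θ := by
    calc φ / ℓ = (φ / ℓ) ^ (1 : ℝ) := (Real.rpow_one _).symm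
      _ ≤ θ := Real.rpow_le_rpow_of_exponent_ge hq0 (by linarith) (by norm_num)
  have hLφ : φ / θ ≤ ℓ := by
    rw [div_le_iff₀ hθ0]
    rwa [div_le_iff₀' hℓ0] at hqθ
  have hθ32 : θ ^ (3 / 2 : ℝ) = φ / ℓ := by
    rw [hθ, ← Real.rpow_mul hq0.le]
    norm_num
  set T := Real.exp ℓ with hT
  have hT5 : 5 ≤ T := by
    have := Real.add_one_le_exp ℓ
    linarith
  have hz : ∀ t σ : ℝ, 3 ≤ t → t ≤ T ^ 2 → 1 - θ ≤ σ → σ < 3 →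
      ‖riemannZeta (σ + t * Complex.I)‖ ≤ Real.exp (A * φ) := by
    intro t σ ht3 htT h3 h4
    refine (hζ t σ θ ht3 (by linarith) h4 hθ0.le (by linarith)).trans ?_
    have hlog : Real.log t ≤ 2 * ℓ := by
      calc Real.log t ≤ Real.log (T ^ 2) := Real.log_le_log (by linarith) htT
        _ = 2 * ℓ := by rw [Real.log_pow, hT, Real.log_exp]; norm_num
    have hlog0 : 0 ≤ Real.log t := Real.log_nonneg (by linarith)
    have h8 : 8 * C ≤ Real.exp φ := (Real.log_le_iff_le_exp (by linarith)).mp p2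
    have e3 : 60000 * θ ^ (3 / 2 : ℝ) * Real.log t ≤ 120000 * φ := by
      rw [hθ32]
      calc 60000 * (φ / ℓ) * Real.log t ≤ 60000 * (φ / ℓ) * (2 * ℓ) := by gcongr
        _ = _ := by field_simp; norm_num
    calc C * Real.log t ^ 3 * Real.exp (60000 * θ ^ (3 / 2 : ℝ) * Real.log t)
        ≤ C * (2 * ℓ) ^ 3 * Real.exp (120000 * φ) := by gcongr
      _ = (8 * C) * (Real.exp φ ^ 3) * Real.exp (120000 * φ) := by rw [hℓ]; ring
      _ ≤ Real.exp φ * (Real.exp φ ^ 3) * Real.exp (120000 * φ) := by gcongr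
      _ = Real.exp (A * φ) := by
        rw [← Real.exp_nat_mul, ← Real.exp_add, ← Real.exp_add, hA]
        congr 1
        push_cast
        ring
  have hmain : ∀ t σ : ℝ, 5 ≤ t → t ≤ T → 1 - a / 20 * (θ / φ) ≤ σ → σ ≤ 2 →
      zetaMulSub (σ + t * Complex.I) ≠ 0 ∧
        ‖(zetaMulSub (σ + t * Complex.I))⁻¹‖ ≤ Real.exp ((42 * (A + 3) + 2) * φ) := by
    intro t σ ht htT hσ hσ2
    obtain ⟨q1, q2⟩ := norm_inv_riemannZeta_le_of_bound (A := A) (H := T ^ 2) (a := a)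
      (by rw [hA]; norm_num) hC1 h1 hC2 h2 p1 hθ0 hθ1 hLφ ha0
      (by rw [ha, mul_one_div_cancel (by positivity)]) p3 hz ht (by nlinarith)
      (by refine le_trans (le_of_eq ?_) hσ; ring) hσ2
    have hne : (σ + t * Complex.I : ℂ) - 1 ≠ 0 := by
      intro h
      have := congrArg Complex.im h
      simp at this
      linarith
    have hne1 : 1 ≤ ‖(σ + t * Complex.I : ℂ) - 1‖ := by
      have := Complex.abs_im_le_norm ((σ + t * Complex.I : ℂ) - 1)
      simp at this
      have h3 := le_abs_self t
      linarith
    rw [zetaMulSub_of_ne (sub_ne_zero.mp hne)]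
    refine ⟨mul_ne_zero hne q1, ?_⟩
    rw [mul_inv, norm_mul, norm_inv ((σ + t * Complex.I : ℂ) - 1)]
    calc _ ≤ 1 * ‖(riemannZeta (σ + t * Complex.I))⁻¹‖ := by
          gcongr
          exact inv_le_one_of_one_le₀ hne1
      _ ≤ _ := by rwa [one_mul]
  intro t σ ht hσ hσ2
  rcases le_total |t| 5 with h5 | h5
  · have hθφ : a / 20 * (θ / φ) ≤ r := by
      rw [div_le_iff₀ hr] at p6
      calc a / 20 * (θ / φ) ≤ 1 * (θ / φ) := by
            gcongr
            linarith
        _ ≤ r := by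
          rw [one_mul, div_le_iff₀ hφ0]
          linarith
    obtain ⟨q1, q2⟩ := hM t σ h5 (by linarith) hσ2
    refine ⟨q1, q2.trans (p5.trans ?_)⟩
    have := Real.add_one_le_exp ((42 * (A + 3) + 2) * φ)
    nlinarith
  · rcases le_total 0 t with h0 | h0
    · rw [abs_of_nonneg h0] at ht h5
      exact hmain t σ h5 ht hσ hσ2
    · rw [abs_of_nonpos h0] at ht h5
      obtain ⟨q1, q2⟩ := hmain (-t) σ h5 ht hσ hσ2
      have hconj : (starRingEnd ℂ) (σ + ((-t : ℝ) : ℂ) * Complex.I) = σ + t * Complex.I := by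
        simp
      rw [← norm_inv_zetaMulSub_conj, hconj] at q2
      refine ⟨fun h => ?_, q2⟩
      have h3 := norm_inv_zetaMulSub_conj (σ + ((-t : ℝ) : ℂ) * Complex.I)
      rw [hconj, h, inv_zero, norm_zero, eq_comm, norm_eq_zero, inv_eq_zero] at h3
      exact q1 h3

lemma hasMellin_max_zero_one_sub {s : ℂ} (hs : 0 < s.re) :
    HasMellin (fun t : ℝ => Set.indicator (Set.Ioc 0 1) (fun _ => (1 : ℂ)) t -
      Set.indicator (Set.Ioc 0 1) (fun t : ℝ => (t : ℂ) ^ (1 : ℂ)) t) s (1 / (s * (s + 1))) := by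
  have h1 := hasMellin_one_Ioc hs
  have h2 := hasMellin_cpow_Ioc 1 (s := s) (by simp; linarith)
  have h3 := hasMellin_sub h1.1 h2.1
  rw [h1.2, h2.2] at h3
  have hs0 : s ≠ 0 := by
    rintro rfl
    simp at hs
  have hs1 : s + 1 ≠ 0 := by
    intro h
    have := congrArg Complex.re h
    simp at this
    linarith
  have h4 : 1 / (s * (s + 1)) = 1 / s - 1 / (s + 1) := by
    field_simp
    ring
  rwa [h4]

lemma indicator_sub_indicator_eq_max {t : ℝ} (ht : 0 < t) :
    Set.indicator (Set.Ioc 0 1) (fun _ => (1 : ℂ)) t -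
      Set.indicator (Set.Ioc 0 1) (fun t : ℝ => (t : ℂ) ^ (1 : ℂ)) t = ((max 0 (1 - t) : ℝ) : ℂ) := by
  by_cases h : t ≤ 1
  · have hm : t ∈ Set.Ioc (0 : ℝ) 1 := ⟨ht, h⟩
    rw [Set.indicator_of_mem hm, Set.indicator_of_mem hm, max_eq_right (by linarith)]
    simp
  · have hm : t ∉ Set.Ioc (0 : ℝ) 1 := fun h' => h h'.2
    rw [Set.indicator_of_notMem hm, Set.indicator_of_notMem hm,
      max_eq_left (by linarith [not_le.mp h])]
    simp

lemma norm_one_div_mul_add_one_le {σ : ℝ} (hσ : 0 < σ) (y : ℝ) :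
    ‖1 / ((σ + y * Complex.I : ℂ) * (σ + y * Complex.I + 1))‖ ≤ 1 / (σ ^ 2 + y ^ 2) := by
  have e : ∀ a : ℝ, ‖(a + y * Complex.I : ℂ)‖ ^ 2 = a ^ 2 + y ^ 2 := by
    intro a
    rw [Complex.sq_norm, Complex.normSq_add_mul_I]
  have h1 : ‖(σ + y * Complex.I : ℂ)‖ ≤ ‖(σ + y * Complex.I + 1 : ℂ)‖ := by
    refine le_of_sq_le_sq ?_ (norm_nonneg _)
    have e1 := e (σ + 1)
    push_cast at e1
    rw [show (σ + y * Complex.I + 1 : ℂ) = σ + 1 + y * Complex.I by ring, e, e1]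
    nlinarith
  rw [norm_div, norm_one, norm_mul]
  refine one_div_le_one_div_of_le (by positivity) ?_
  rw [← e σ, sq]
  gcongr

lemma one_div_sq_add_sq_le {σ : ℝ} (hσ : 0 < σ) (y : ℝ) :
    1 / (σ ^ 2 + y ^ 2) ≤ (1 + 1 / σ ^ 2) * (1 + y ^ 2)⁻¹ := by
  rw [div_le_iff₀ (by positivity), mul_right_comm, ← div_eq_mul_inv, le_div_iff₀ (by positivity)]
  have h : (1 + 1 / σ ^ 2) * (σ ^ 2 + y ^ 2) = 1 + y ^ 2 + σ ^ 2 + y ^ 2 / σ ^ 2 := by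
    field_simp
    ring
  rw [h]
  have : 0 ≤ y ^ 2 / σ ^ 2 := by positivity
  nlinarith [sq_nonneg σ]

lemma integrable_one_div_mul_add_one {σ : ℝ} (hσ : 0 < σ) :
    Integrable (fun y : ℝ => 1 / ((σ + y * Complex.I : ℂ) * (σ + y * Complex.I + 1))) := by
  have hcont : Continuous (fun y : ℝ => 1 / ((σ + y * Complex.I : ℂ) * (σ + y * Complex.I + 1))) := by
    refine continuous_const.div (by fun_prop) (fun y => mul_ne_zero ?_ ?_)
    all_goals
      intro h
      have := congrArg Complex.re h
      simp at this
      linarith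
  refine Integrable.mono' (g := fun y : ℝ => (1 + 1 / σ ^ 2) * (1 + y ^ 2)⁻¹)
    (integrable_inv_one_add_sq.const_mul _) hcont.aestronglyMeasurable
    (Eventually.of_forall fun y => ?_)
  exact (norm_one_div_mul_add_one_le hσ y).trans (one_div_sq_add_sq_le hσ y)

lemma integral_cpow_div_eq_max {σ u : ℝ} (hσ : 0 < σ) (hu : 0 < u) :
    ∫ y : ℝ, (u : ℂ) ^ (-(σ + y * Complex.I)) * (1 / ((σ + y * Complex.I : ℂ) *
      (σ + y * Complex.I + 1))) = 2 * Real.pi * ((max 0 (1 - u) : ℝ) : ℂ) := by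
  set f : ℝ → ℂ := fun t : ℝ => Set.indicator (Set.Ioc 0 1) (fun _ => (1 : ℂ)) t -
      Set.indicator (Set.Ioc 0 1) (fun t : ℝ => (t : ℂ) ^ (1 : ℂ)) t with hf
  have hre : ∀ y : ℝ, 0 < (σ + y * Complex.I : ℂ).re := fun y => by simpa using hσ
  have hm : ∀ y : ℝ, mellin f (σ + y * Complex.I) =
      1 / ((σ + y * Complex.I : ℂ) * (σ + y * Complex.I + 1)) :=
    fun y => (hasMellin_max_zero_one_sub (hre y)).2
  have h := mellinInv_mellin_eq σ f hu (hasMellin_max_zero_one_sub (by simpa using hσ)).1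
    (by
      unfold Complex.VerticalIntegrable
      simp_rw [hm]
      exact integrable_one_div_mul_add_one hσ)
    (by
      have hc : ContinuousAt (fun t : ℝ => ((max 0 (1 - t) : ℝ) : ℂ)) u := by fun_prop
      refine hc.congr ?_
      filter_upwards [eventually_gt_nhds hu] with t ht
      exact (indicator_sub_indicator_eq_max ht).symm)
  rw [hf] at h
  simp only at h
  rw [indicator_sub_indicator_eq_max hu, mellinInv, ← hf] at h
  simp_rw [hm, smul_eq_mul] at h
  have hpi : (Real.pi : ℂ) ≠ 0 := by exact_mod_cast Real.pi_ne_zero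
  rw [← h, Complex.real_smul, ← mul_assoc, Complex.ofReal_div, Complex.ofReal_one,
    Complex.ofReal_mul, Complex.ofReal_ofNat, mul_one_div_cancel (by simp), one_mul]

/-- The Riesz mean of `μ(n) / n`. -/
noncomputable def rieszMoebius (X : ℝ) : ℝ :=
  ∑ n ∈ Icc 1 ⌊X⌋₊, ((ArithmeticFunction.moebius n : ℤ) : ℝ) / n * (1 - n / X)

lemma norm_moebius_div_le (n : ℕ) :
    ‖(((ArithmeticFunction.moebius n : ℤ) : ℂ)) / n‖ ≤ 1 / n := by
  rw [norm_div, Complex.norm_natCast, Complex.norm_intCast]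
  gcongr
  exact_mod_cast ArithmeticFunction.abs_moebius_le_one

lemma norm_cpow_div_zetaMulSub_le {X σ : ℝ} (hX : 0 < X) (hσ : 0 < σ) (y : ℝ) :
    ‖(X : ℂ) ^ (σ + y * Complex.I) /
      ((σ + y * Complex.I + 1) * zetaMulSub (1 + (σ + y * Complex.I)))‖ ≤
    X ^ σ * ‖riemannZeta ((1 + σ : ℝ) : ℂ)‖ * (1 / (σ ^ 2 + y ^ 2)) := by
  have h0 := norm_one_div_mul_add_one_le hσ y
  set s : ℂ := σ + y * Complex.I with hs
  have hsre : s.re = σ := by simp [hs]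
  have hs0 : s ≠ 0 := by
    intro h
    rw [h] at hsre
    simp at hsre
    linarith
  have h1 : zetaMulSub (1 + s) = s * riemannZeta (1 + s) := by
    rw [zetaMulSub_of_ne (by simpa using hs0), add_sub_cancel_left]
  have h2 := norm_inv_riemannZeta_le (s := 1 + s) (by simp [hsre, hσ])
  rw [show (1 + s).re = 1 + σ by simp [hsre]] at h2
  have h3 : (X : ℂ) ^ s / ((s + 1) * zetaMulSub (1 + s)) =
      (X : ℂ) ^ s * (riemannZeta (1 + s))⁻¹ * (1 / (s * (s + 1))) := by
    rw [h1, div_eq_mul_inv, one_div, mul_inv, mul_inv, mul_inv]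
    ring
  rw [h3, norm_mul, norm_mul, Complex.norm_cpow_eq_rpow_re_of_pos hX, hsre]
  gcongr

lemma continuous_cpow_div_zetaMulSub {X σ : ℝ} (hX : 0 < X) (hσ : 0 < σ) :
    Continuous (fun y : ℝ => (X : ℂ) ^ (σ + y * Complex.I) /
      ((σ + y * Complex.I + 1) * zetaMulSub (1 + (σ + y * Complex.I)))) := by
  refine Continuous.div ?_ ?_ (fun y => mul_ne_zero ?_ (zetaMulSub_ne_zero (by simpa using hσ.le)))
  · exact Continuous.const_cpow (by fun_prop) (Or.inl (by exact_mod_cast hX.ne'))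
  · have := differentiable_zetaMulSub.continuous
    fun_prop
  · intro h
    have := congrArg Complex.re h
    simp at this
    linarith

lemma rieszMoebius_eq_integral {X σ : ℝ} (hX : 0 < X) (hσ : 0 < σ) :
    2 * Real.pi * (rieszMoebius X : ℂ) = ∫ y : ℝ, (X : ℂ) ^ (σ + y * Complex.I) /
      ((σ + y * Complex.I + 1) * zetaMulSub (1 + (σ + y * Complex.I))) := by
  set K : ℝ → ℂ := fun y => 1 / ((σ + y * Complex.I : ℂ) * (σ + y * Complex.I + 1)) with hK
  set F : ℕ → ℝ → ℂ := fun n y => (((ArithmeticFunction.moebius n : ℤ) : ℂ)) / n *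
    ((((n / X : ℝ) : ℂ)) ^ (-(σ + y * Complex.I)) * K y) with hF
  have hKi : Integrable K := integrable_one_div_mul_add_one hσ
  have hnorm : ∀ n : ℕ, n ≠ 0 → ∀ y : ℝ, ‖(((n / X : ℝ) : ℂ)) ^ (-(σ + y * Complex.I))‖ =
      (n / X) ^ (-σ) := by
    intro n hn y
    rw [Complex.norm_cpow_eq_rpow_re_of_pos (by positivity)]
    simp
  have hF0 : F 0 = 0 := by
    ext y
    simp [hF]
  have hFn : ∀ n y, ‖F n y‖ ≤ X ^ σ * (1 / (n : ℝ) ^ (1 + σ)) * ‖K y‖ := by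
    intro n y
    rcases eq_or_ne n 0 with rfl | hn
    · rw [hF0]
      simp only [Pi.zero_apply, norm_zero]
      positivity
    · rw [hF]
      simp only [norm_mul]
      rw [hnorm n hn y]
      have hn0 : (0 : ℝ) < n := by positivity
      calc _ ≤ 1 / n * ((n / X) ^ (-σ) * ‖K y‖) := by
            gcongr
            exact norm_moebius_div_le n
        _ = _ := by
          rw [Real.div_rpow hn0.le hX.le, Real.rpow_neg hn0.le, Real.rpow_neg hX.le,
            Real.rpow_add hn0, Real.rpow_one]
          field_simp
  have hFi : ∀ n, Integrable (F n) := by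
    intro n
    refine Integrable.mono' (hKi.norm.const_mul (X ^ σ * (1 / (n : ℝ) ^ (1 + σ)))) ?_
      (Eventually.of_forall (hFn n))
    rcases eq_or_ne n 0 with rfl | hn
    · rw [hF0]
      exact aestronglyMeasurable_const
    · refine AEStronglyMeasurable.const_mul (AEStronglyMeasurable.mul ?_ hKi.1) _
      refine Continuous.aestronglyMeasurable ?_
      have : ((n / X : ℝ) : ℂ) ≠ 0 := by
        exact_mod_cast (by positivity : (n / X : ℝ) ≠ 0)
      exact Continuous.const_cpow (by fun_prop) (Or.inl this)
  have hFs : Summable fun n => ∫ y, ‖F n y‖ := by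
    refine Summable.of_nonneg_of_le (fun n => integral_nonneg fun y => norm_nonneg _)
      (f := fun n : ℕ => X ^ σ * (1 / (n : ℝ) ^ (1 + σ)) * ∫ y, ‖K y‖) (fun n => ?_) ?_
    · rw [← integral_const_mul]
      exact integral_mono (hFi n).norm (hKi.norm.const_mul _) (hFn n)
    · exact ((Real.summable_one_div_nat_rpow.mpr (by linarith)).mul_left _).mul_right _
  have hsum := hasSum_integral_of_summable_integral_norm hFi hFs
  have hG : ∀ y : ℝ, ∑' n, F n y = (X : ℂ) ^ (σ + y * Complex.I) /
      ((σ + y * Complex.I + 1) * zetaMulSub (1 + (σ + y * Complex.I))) := by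
    intro y
    set s : ℂ := σ + y * Complex.I with hs
    have hsre : s.re = σ := by simp [hs]
    have hs0 : s ≠ 0 := by
      intro h
      rw [h] at hsre
      simp at hsre
      linarith
    have h1 : zetaMulSub (1 + s) = s * riemannZeta (1 + s) := by
      rw [zetaMulSub_of_ne (by simpa using hs0), add_sub_cancel_left]
    have h2 := inv_riemannZeta_eq_LSeries (s := 1 + s) (by simp [hsre, hσ])
    rw [h1, div_eq_mul_inv, mul_inv, mul_inv, h2, LSeries, ← tsum_mul_left, ← tsum_mul_left,
      ← tsum_mul_left]
    refine tsum_congr fun n => ?_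
    rcases eq_or_ne n 0 with rfl | hn
    · simp [hF0]
    · rw [LSeries.term_of_ne_zero hn, hF]
      simp only
      have hn0 : (n : ℂ) ≠ 0 := by exact_mod_cast hn
      have hX0 : (X : ℂ) ≠ 0 := by exact_mod_cast hX.ne'
      rw [← hs, Complex.ofReal_div, Complex.ofReal_natCast, hK]
      simp only
      rw [← hs, Complex.cpow_add _ _ hn0, Complex.cpow_one, div_eq_mul_inv (n : ℂ),
        ← Complex.ofReal_natCast, ← Complex.ofReal_inv,
        Complex.mul_cpow_ofReal_nonneg (by positivity) (by positivity), Complex.ofReal_inv,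
        Complex.inv_cpow _ _ (by
          rw [Complex.arg_ofReal_of_nonneg hX.le]; exact Real.pi_pos.ne), Complex.cpow_neg,
        Complex.cpow_neg, inv_inv, Complex.ofReal_natCast]
      field_simp
  have hI : ∀ n, ∫ y, F n y = 2 * Real.pi * ((((ArithmeticFunction.moebius n : ℤ) : ℝ) / n *
      max 0 (1 - n / X) : ℝ) : ℂ) := by
    intro n
    rcases eq_or_ne n 0 with rfl | hn
    · simp [hF0]
    · rw [hF]
      simp only
      rw [integral_const_mul, integral_cpow_div_eq_max hσ (by positivity)]
      push_cast
      ring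
  have hfin : HasSum (fun n => ∫ y, F n y) (2 * Real.pi * (rieszMoebius X : ℂ)) := by
    have : (2 * Real.pi * (rieszMoebius X : ℂ)) = ∑ n ∈ Icc 1 ⌊X⌋₊, ∫ y, F n y := by
      rw [rieszMoebius, Complex.ofReal_sum, mul_sum]
      refine sum_congr rfl fun n hn => ?_
      rw [hI, max_eq_right]
      rw [sub_nonneg, div_le_one hX]
      exact (Nat.le_floor_iff hX.le).mp (mem_Icc.mp hn).2
    rw [this]
    refine hasSum_sum_of_ne_finset_zero fun n hn => ?_
    rw [hI]
    rcases eq_or_ne n 0 with rfl | hn0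
    · simp
    · rw [max_eq_left, mul_zero, Complex.ofReal_zero, mul_zero]
      rw [sub_nonpos, one_le_div hX]
      have : ⌊X⌋₊ < n := by
        by_contra h
        exact hn (mem_Icc.mpr ⟨Nat.one_le_iff_ne_zero.mpr hn0, not_lt.mp h⟩)
      exact ((Nat.floor_lt hX.le).mp this).le
  simp_rw [hG] at hsum
  exact hfin.unique hsum

lemma integrable_cpow_div_zetaMulSub {X σ : ℝ} (hX : 0 < X) (hσ : 0 < σ) :
    Integrable (fun y : ℝ => (X : ℂ) ^ (σ + y * Complex.I) /
      ((σ + y * Complex.I + 1) * zetaMulSub (1 + (σ + y * Complex.I)))) := by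
  refine Integrable.mono' (g := fun y : ℝ => X ^ σ * ‖riemannZeta ((1 + σ : ℝ) : ℂ)‖ *
    ((1 + 1 / σ ^ 2) * (1 + y ^ 2)⁻¹)) ((integrable_inv_one_add_sq.const_mul _).const_mul _)
    (continuous_cpow_div_zetaMulSub hX hσ).aestronglyMeasurable
    (Eventually.of_forall fun y => (norm_cpow_div_zetaMulSub_le hX hσ y).trans ?_)
  gcongr
  exact one_div_sq_add_sq_le hσ y

lemma norm_integral_Ioi_le_of_norm_le_div_sq {G : ℝ → ℂ} {M H : ℝ} (hH : 0 < H)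
    (hb : ∀ y, H < y → ‖G y‖ ≤ M / y ^ 2) : ‖∫ y in Set.Ioi H, G y‖ ≤ M / H := by
  have hi : IntegrableOn (fun y : ℝ => M / y ^ 2) (Set.Ioi H) := by
    have h0 : IntegrableOn (fun y : ℝ => M * y ^ (-2 : ℝ)) (Set.Ioi H) :=
      (integrableOn_Ioi_rpow_of_lt (by norm_num : (-2 : ℝ) < -1) hH).const_mul M
    refine h0.congr_fun (fun y hy => ?_) measurableSet_Ioi
    have hy0 : (0 : ℝ) < y := hH.trans hy
    simp only
    rw [Real.rpow_neg hy0.le, div_eq_mul_inv]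
    norm_num
  refine (norm_integral_le_of_norm_le hi ((ae_restrict_iff' measurableSet_Ioi).mpr
    (Eventually.of_forall hb))).trans (le_of_eq ?_)
  have h2 : ∫ y in Set.Ioi H, M / y ^ 2 = ∫ y in Set.Ioi H, M * y ^ (-2 : ℝ) := by
    refine setIntegral_congr_fun measurableSet_Ioi (fun y hy => ?_)
    have hy0 : (0 : ℝ) < y := hH.trans hy
    rw [Real.rpow_neg hy0.le, div_eq_mul_inv]
    norm_num
  rw [h2, integral_const_mul, integral_Ioi_rpow_of_lt (by norm_num) hH]
  norm_num
  rw [Real.rpow_neg_one, div_eq_mul_inv]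

lemma norm_integral_le_of_norm_le_div_sq {G : ℝ → ℂ} (hG : Integrable G) {M H : ℝ} (hH : 0 < H)
    (hb : ∀ y, y ≠ 0 → ‖G y‖ ≤ M / y ^ 2) : ‖∫ y, G y‖ ≤ ‖∫ y in (-H)..H, G y‖ + 2 * (M / H) := by
  have h1 := norm_integral_Ioi_le_of_norm_le_div_sq hH (fun y hy => hb y (hH.trans hy).ne')
  have h2 := norm_integral_Ioi_le_of_norm_le_div_sq (G := fun y => G (-y)) hH
    (fun y hy => by simpa using hb (-y) (neg_ne_zero.mpr (hH.trans hy).ne'))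
  rw [integral_comp_neg_Ioi] at h2
  have h3 := intervalIntegral.integral_Iic_add_Ioi (b := -H) hG.integrableOn hG.integrableOn
  have h4 := intervalIntegral.integral_interval_add_Ioi (a := -H) (b := H) hG.integrableOn
    hG.integrableOn
  rw [← h3, ← h4]
  refine (norm_add_le _ _).trans ?_
  have := norm_add_le (∫ y in (-H)..H, G y) (∫ y in Set.Ioi H, G y)
  linarith

lemma abs_rieszMoebius_le {X H η B C₁ : ℝ} (hX : 1 ≤ Real.log X) (hX0 : 0 < X) (hH : 1 ≤ H)
    (hη : 0 < η) (hη1 : η ≤ 1 / 2) (hC1 : 1 ≤ C₁)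
    (h1 : ∀ σ : ℝ, 1 < σ → σ ≤ 3 → ‖riemannZeta (σ : ℂ)‖ ≤ C₁ / (σ - 1))
    (hZ : ∀ t σ : ℝ, |t| ≤ H → 1 - η ≤ σ → σ ≤ 2 → zetaMulSub (σ + t * Complex.I) ≠ 0 ∧
      ‖(zetaMulSub (σ + t * Complex.I))⁻¹‖ ≤ B) :
    |rieszMoebius X| ≤ 4 * (H * X ^ (-η) * B) + 12 * (B / H) + 6 * C₁ * (Real.log X / H) := by
  set σ : ℝ := 1 / Real.log X with hσ
  have hlog0 : 0 < Real.log X := by linarith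
  have hσ0 : 0 < σ := by positivity
  have hσ1 : σ ≤ 1 := by rwa [hσ, div_le_one hlog0]
  have hH0 : 0 < H := by linarith
  have hXσ : X ^ σ = Real.exp 1 := by
    rw [Real.rpow_def_of_pos hX0, hσ, mul_one_div_cancel hlog0.ne']
  have he : Real.exp 1 ≤ 3 := Real.exp_one_lt_three.le
  have hB0 : 0 ≤ B := (norm_nonneg _).trans (hZ 0 1 (by simpa using hH0.le) (by linarith) (by norm_num)).2
  set g : ℂ → ℂ := fun w => (X : ℂ) ^ w / ((w + 1) * zetaMulSub (1 + w)) with hg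
  have hne : ∀ w : ℂ, -η ≤ w.re → w.re ≤ σ → |w.im| ≤ H → zetaMulSub (1 + w) ≠ 0 ∧
      ‖(zetaMulSub (1 + w))⁻¹‖ ≤ B := by
    intro w hw1 hw2 hw3
    have h := hZ w.im (1 + w.re) hw3 (by linarith) (by linarith)
    have e : (((1 + w.re : ℝ) : ℂ) + w.im * Complex.I) = 1 + w := by
      apply Complex.ext <;> simp
    rwa [e] at h
  have hw1 : ∀ w : ℂ, -η ≤ w.re → 1 / 2 ≤ ‖w + 1‖ := by
    intro w hw
    have := Complex.re_le_norm (w + 1)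
    simp at this
    linarith
  have hgb : ∀ w : ℂ, -η ≤ w.re → w.re ≤ σ → |w.im| ≤ H → ‖g w‖ ≤ X ^ w.re * (‖w + 1‖⁻¹ * B) := by
    intro w hw1 hw2 hw3
    rw [hg]
    simp only
    rw [div_eq_mul_inv, mul_inv, norm_mul, norm_mul, Complex.norm_cpow_eq_rpow_re_of_pos hX0,
      norm_inv (w + 1)]
    gcongr
    exact (hne w hw1 hw2 hw3).2
  have hgd : DifferentiableOn ℂ g (Set.uIcc (-η + -H * Complex.I : ℂ).re (σ + H * Complex.I : ℂ).re ×ℂ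
      Set.uIcc (-η + -H * Complex.I : ℂ).im (σ + H * Complex.I : ℂ).im) := by
    intro w hw
    rw [Complex.mem_reProdIm] at hw
    simp only [Complex.add_re, Complex.neg_re, Complex.ofReal_re, Complex.mul_re, Complex.I_re,
      mul_zero, Complex.ofReal_im, Complex.I_im, mul_one, sub_self, add_zero, Complex.add_im,
      Complex.neg_im, Complex.mul_im, neg_zero, zero_add, Complex.neg_re] at hw
    rw [Set.uIcc_of_le (by linarith), Set.uIcc_of_le (by linarith)] at hw
    obtain ⟨⟨q1, q2⟩, q3, q4⟩ := hw
    have hz := hne w q1 q2 (abs_le.mpr ⟨q3, q4⟩)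
    have hn : w + 1 ≠ 0 := by
      intro h
      have := hw1 w q1
      rw [h, norm_zero] at this
      linarith
    refine DifferentiableAt.differentiableWithinAt ?_
    have d1 : DifferentiableAt ℂ (fun w : ℂ => (X : ℂ) ^ w) w :=
      differentiableAt_id.const_cpow (Or.inl (by exact_mod_cast hX0.ne'))
    have d2 : DifferentiableAt ℂ (fun w : ℂ => (w + 1) * zetaMulSub (1 + w)) w := by
      refine (differentiableAt_id.add_const _).mul ?_
      exact (differentiable_zetaMulSub _).comp w (differentiableAt_id.const_add _)
    exact d1.div d2 (mul_ne_zero hn hz.1)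
  have hrect := Complex.integral_boundary_rect_eq_zero_of_differentiableOn g
    (-η + -H * Complex.I) (σ + H * Complex.I) hgd
  simp only [Complex.add_re, Complex.neg_re, Complex.ofReal_re, Complex.mul_re, Complex.I_re,
    mul_zero, Complex.ofReal_im, Complex.I_im, mul_one, sub_self, add_zero, Complex.add_im,
    Complex.neg_im, Complex.mul_im, neg_zero, zero_add, Complex.neg_re] at hrect
  have hhor : ∀ t : ℝ, |t| = H → ‖∫ x in (-η)..σ, g (x + t * Complex.I)‖ ≤ 6 * (B / H) := by
    intro t ht
    have hb : ∀ x ∈ Set.uIoc (-η) σ, ‖g (x + t * Complex.I)‖ ≤ 3 * (H⁻¹ * B) := by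
      intro x hx
      rw [Set.uIoc_of_le (by linarith)] at hx
      refine (hgb _ (by simpa using hx.1.le) (by simpa using hx.2) (by simp [ht])).trans ?_
      have e1 : X ^ (x + t * Complex.I : ℂ).re ≤ 3 := by
        rw [show (x + t * Complex.I : ℂ).re = x by simp]
        refine le_trans ?_ he
        rw [← hXσ, Real.rpow_def_of_pos hX0, Real.rpow_def_of_pos hX0]
        gcongr
        exact hx.2
      have e2 : H ≤ ‖(x + t * Complex.I : ℂ) + 1‖ := by
        have := Complex.abs_im_le_norm ((x + t * Complex.I : ℂ) + 1)
        simpa [ht] using this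
      gcongr
    refine (intervalIntegral.norm_integral_le_of_norm_le_const hb).trans ?_
    have e3 : |σ - -η| ≤ 2 := by
      rw [abs_of_nonneg (by linarith)]
      linarith
    calc 3 * (H⁻¹ * B) * |σ - -η| ≤ 3 * (H⁻¹ * B) * 2 := by gcongr
      _ = 6 * (B / H) := by ring
  have hleft : ‖∫ y in (-H)..H, g (((-η : ℝ) : ℂ) + y * Complex.I)‖ ≤ 4 * (H * X ^ (-η) * B) := by
    have hb : ∀ y ∈ Set.uIoc (-H) H, ‖g (((-η : ℝ) : ℂ) + y * Complex.I)‖ ≤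
        X ^ (-η) * ((1 / 2)⁻¹ * B) := by
      intro y hy
      rw [Set.uIoc_of_le (by linarith)] at hy
      have hre : ((((-η : ℝ) : ℂ) + y * Complex.I)).re = -η := by simp
      have := hgb (((-η : ℝ) : ℂ) + y * Complex.I) (by rw [hre]) (by rw [hre]; linarith)
        (by simpa using abs_le.mpr ⟨hy.1.le, hy.2⟩)
      rw [hre] at this
      refine this.trans ?_
      have := hw1 (((-η : ℝ) : ℂ) + y * Complex.I) (by rw [hre])
      gcongr
    refine (intervalIntegral.norm_integral_le_of_norm_le_const hb).trans (le_of_eq ?_)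
    rw [sub_neg_eq_add, abs_of_nonneg (by linarith)]
    ring
  have hright : ‖∫ y in (-H)..H, g (σ + y * Complex.I)‖ ≤
      4 * (H * X ^ (-η) * B) + 12 * (B / H) := by
    have h4 := hhor (-H) (by rw [abs_neg, abs_of_pos hH0])
    have h5 := hhor H (abs_of_pos hH0)
    push_cast at h4 hleft
    have h6 : Complex.I * (∫ y in (-H)..H, g (σ + y * Complex.I)) =
        Complex.I * (∫ y in (-H)..H, g (-η + y * Complex.I)) +
        ((∫ x in (-η)..σ, g (x + H * Complex.I)) - ∫ x in (-η)..σ, g (x + -H * Complex.I)) := by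
      simp only [smul_eq_mul] at hrect
      push_cast at hrect
      linear_combination hrect
    have h7 := congrArg norm h6
    rw [norm_mul, Complex.norm_I, one_mul] at h7
    rw [h7]
    refine (norm_add_le _ _).trans ?_
    rw [norm_mul, Complex.norm_I, one_mul]
    have := norm_sub_le (∫ x in (-η)..σ, g (x + H * Complex.I))
      (∫ x in (-η)..σ, g (x + -H * Complex.I))
    linarith
  have hintegral := rieszMoebius_eq_integral hX0 hσ0
  have htail := norm_integral_le_of_norm_le_div_sq (integrable_cpow_div_zetaMulSub hX0 hσ0)
    (M := 3 * (C₁ * Real.log X)) hH0 (by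
      intro y hy
      refine (norm_cpow_div_zetaMulSub_le hX0 hσ0 y).trans ?_
      have h3 := h1 (1 + σ) (by linarith) (by linarith)
      rw [add_sub_cancel_left, hσ, div_div_eq_mul_div, div_one, ← hσ] at h3
      rw [hXσ, ← mul_one_div (3 * (C₁ * Real.log X))]
      gcongr
      nlinarith)
  rw [← hintegral] at htail
  rw [← Complex.ofReal_ofNat, ← Complex.ofReal_mul, ← Complex.ofReal_mul, Complex.norm_real,
    Real.norm_eq_abs, abs_mul, abs_of_pos Real.two_pi_pos] at htail
  have h8 : |rieszMoebius X| ≤ 2 * Real.pi * |rieszMoebius X| :=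
    le_mul_of_one_le_left (abs_nonneg _) (by linarith [Real.pi_gt_three])
  calc |rieszMoebius X| ≤ _ := h8.trans htail
    _ ≤ (4 * (H * X ^ (-η) * B) + 12 * (B / H)) + 2 * (3 * (C₁ * Real.log X) / H) :=
        add_le_add_left hright _
    _ = _ := by ring

/-- The partial sums of `μ(n) / n`. -/
noncomputable def moebiusHarmonic (x : ℝ) : ℝ :=
  ∑ n ∈ Icc 1 ⌊x⌋₊, ((ArithmeticFunction.moebius n : ℤ) : ℝ) / n

lemma abs_moebius_div_le (n : ℕ) :
    |((ArithmeticFunction.moebius n : ℤ) : ℝ) / n| ≤ 1 / n := by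
  rw [abs_div, Nat.abs_cast]
  gcongr
  exact_mod_cast ArithmeticFunction.abs_moebius_le_one

lemma abs_moebiusHarmonic_le {x : ℝ} (hx : 1 ≤ x) : |moebiusHarmonic x| ≤ 1 + Real.log x := by
  refine (abs_sum_le_sum_abs _ _).trans ((sum_le_sum fun n _ => abs_moebius_div_le n).trans ?_)
  refine le_trans (le_of_eq ?_) (harmonic_floor_le_one_add_log x hx)
  rw [harmonic_eq_sum_Icc]
  push_cast
  simp

lemma mul_rieszMoebius {X : ℝ} (hX : 0 < X) : X * rieszMoebius X =
    ∑ n ∈ Icc 1 ⌊X⌋₊, ((ArithmeticFunction.moebius n : ℤ) : ℝ) / n * (X - n) := by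
  rw [rieszMoebius, mul_sum]
  refine sum_congr rfl fun n _ => ?_
  field_simp

lemma abs_moebiusHarmonic_le_of_riesz {x h : ℝ} (hx : 1 ≤ x) (hh : 0 < h) :
    |moebiusHarmonic x| ≤
      ((x + h) * |rieszMoebius (x + h)| + x * |rieszMoebius x|) / h + (h + 1) / x := by
  have hx0 : 0 < x := by linarith
  have hfl : ⌊x⌋₊ ≤ ⌊x + h⌋₊ := Nat.floor_le_floor (by linarith)
  set R := ∑ n ∈ Ioc ⌊x⌋₊ ⌊x + h⌋₊, ((ArithmeticFunction.moebius n : ℤ) : ℝ) / n * (x + h - n)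
    with hR
  have e1 : h * moebiusHarmonic x = (x + h) * rieszMoebius (x + h) - x * rieszMoebius x - R := by
    rw [mul_rieszMoebius (by linarith : 0 < x + h), mul_rieszMoebius hx0]
    have hsplit : Icc 1 ⌊x + h⌋₊ = Icc 1 ⌊x⌋₊ ∪ Ioc ⌊x⌋₊ ⌊x + h⌋₊ := by
      ext n
      simp only [mem_union, mem_Icc, mem_Ioc]
      omega
    have hdisj : Disjoint (Icc 1 ⌊x⌋₊) (Ioc ⌊x⌋₊ ⌊x + h⌋₊) := by
      rw [Finset.disjoint_left]
      intro n h1 h2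
      simp only [mem_Icc, mem_Ioc] at h1 h2
      omega
    rw [hsplit, sum_union hdisj, ← hR, add_sub_right_comm, add_sub_cancel_right, moebiusHarmonic,
      mul_sum, ← sum_sub_distrib]
    refine sum_congr rfl fun n _ => ?_
    ring
  have hRb : |R| ≤ h * ((h + 1) / x) := by
    have hcard : ((Ioc ⌊x⌋₊ ⌊x + h⌋₊).card : ℝ) ≤ h + 1 := by
      rw [Nat.card_Ioc, Nat.cast_sub hfl]
      have := Nat.floor_le (by linarith : 0 ≤ x + h)
      have := Nat.lt_floor_add_one x
      linarith
    refine (abs_sum_le_sum_abs _ _).trans ?_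
    have hterm : ∀ n ∈ Ioc ⌊x⌋₊ ⌊x + h⌋₊,
        |((ArithmeticFunction.moebius n : ℤ) : ℝ) / n * (x + h - n)| ≤ h / x := by
      intro n hn
      rw [mem_Ioc] at hn
      have h1 : x < n := (Nat.floor_lt hx0.le).mp hn.1
      have h2 : (n : ℝ) ≤ x + h := (Nat.le_floor_iff (by linarith)).mp hn.2
      rw [abs_mul, abs_of_nonneg (by linarith : (0 : ℝ) ≤ x + h - n)]
      calc _ ≤ 1 / (n : ℝ) * h := by
            gcongr
            · exact abs_moebius_div_le n
            · linarith
        _ ≤ 1 / x * h := by gcongr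
        _ = h / x := by ring
    refine (sum_le_card_nsmul _ _ _ hterm).trans ?_
    rw [nsmul_eq_mul]
    calc _ ≤ (h + 1) * (h / x) := by gcongr
      _ = _ := by ring
  have e2 : |h * moebiusHarmonic x| ≤
      (x + h) * |rieszMoebius (x + h)| + x * |rieszMoebius x| + h * ((h + 1) / x) := by
    rw [e1]
    refine (abs_sub _ _).trans (add_le_add ((abs_sub _ _).trans ?_) hRb)
    rw [abs_mul, abs_mul, abs_of_pos hx0, abs_of_pos (by linarith : 0 < x + h)]
  rw [abs_mul, abs_of_pos hh] at e2
  rw [← mul_le_mul_iff_right₀ hh]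
  refine e2.trans (le_of_eq ?_)
  field_simp

/-- `log (𝓛(y))` as a function of `u = log y`. -/
noncomputable def korobovExponent (u : ℝ) : ℝ := u ^ ((3 : ℝ) / 5) / Real.log u ^ ((1 : ℝ) / 5)

lemma korobovExponent_pow_five {u : ℝ} (hu : 1 < u) : korobovExponent u ^ 5 = u ^ 3 / Real.log u := by
  have hv : 0 < Real.log u := Real.log_pos hu
  rw [korobovExponent, div_pow, ← Real.rpow_natCast, ← Real.rpow_natCast,
    ← Real.rpow_mul (by linarith), ← Real.rpow_mul hv.le]
  norm_num

lemma korobovExponent_pos {u : ℝ} (hu : 1 < u) : 0 < korobovExponent u := by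
  have hv : 0 < Real.log u := Real.log_pos hu
  have : 0 < u := by linarith
  unfold korobovExponent
  positivity

lemma exists_forall_ge_log_and_le_exp (A D φ₀ : ℝ) : ∃ ℓ₀ : ℝ, 1 ≤ ℓ₀ ∧ ∀ ℓ : ℝ, ℓ₀ ≤ ℓ →
    φ₀ ≤ Real.log ℓ ∧ 2 ≤ Real.log ℓ ∧ 16 * Real.exp (A * Real.log ℓ) + D * ℓ ^ 3 ≤
      Real.exp (ℓ / 4) := by
  have h1 : Tendsto (fun ℓ : ℝ => 16 * (ℓ ^ A / Real.exp (1 / 4 * ℓ)) +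
      D * (ℓ ^ (3 : ℝ) / Real.exp (1 / 4 * ℓ))) atTop (nhds (16 * 0 + D * 0)) :=
    ((isLittleO_rpow_exp_pos_mul_atTop A (b := 1 / 4) (by norm_num)).tendsto_div_nhds_zero.const_mul 16).add
      ((isLittleO_rpow_exp_pos_mul_atTop 3 (b := 1 / 4) (by norm_num)).tendsto_div_nhds_zero.const_mul D)
  have hev : ∀ᶠ ℓ : ℝ in atTop, 1 ≤ ℓ ∧ φ₀ ≤ Real.log ℓ ∧ 2 ≤ Real.log ℓ ∧
      16 * Real.exp (A * Real.log ℓ) + D * ℓ ^ 3 ≤ Real.exp (ℓ / 4) := by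
    filter_upwards [eventually_ge_atTop 1, Real.tendsto_log_atTop.eventually_ge_atTop φ₀,
      Real.tendsto_log_atTop.eventually_ge_atTop 2,
      h1.eventually_le_const (show 16 * 0 + D * 0 < (1 : ℝ) by norm_num)] with ℓ q1 q2 q3 q4
    refine ⟨q1, q2, q3, ?_⟩
    rw [← mul_div_assoc, ← mul_div_assoc, ← add_div, div_le_one (Real.exp_pos _),
      Real.rpow_def_of_pos (by linarith : 0 < ℓ), mul_comm (Real.log ℓ)] at q4
    rw [div_eq_mul_one_div, mul_comm ℓ]
    exact_mod_cast q4
  obtain ⟨a, ha⟩ := eventually_atTop.mp hev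
  exact ⟨max a 1, le_max_right _ _, fun ℓ h => (ha ℓ ((le_max_left _ _).trans h)).2⟩

lemma sixteen_mul_le_of_korobovExponent {κ u ℓ φ : ℝ} (hκ0 : 0 < κ) (hκ1 : κ ≤ 1) (hu : 1 < u)
    (hℓdef : ℓ = κ * korobovExponent u) (hφ0 : 0 < φ) (hφv : φ ≤ Real.log u) :
    16 * ℓ ≤ 16 * κ * ((φ / ℓ) ^ (2 / 3 : ℝ) / φ) * u := by
  have hL0 : 0 < korobovExponent u := korobovExponent_pos hu
  have hL5 := korobovExponent_pow_five hu
  set L := korobovExponent u with hL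
  have hℓpos : 0 < ℓ := by rw [hℓdef]; positivity
  have hlu : 0 < Real.log u := Real.log_pos hu
  have hu0 : 0 < u := by linarith
  have h3 : ℓ * φ / (κ * u) ≤ (φ / ℓ) ^ (2 / 3 : ℝ) := by
    refine le_of_pow_le_pow_left₀ (n := 3) (by norm_num) (by positivity) ?_
    have e1 : ((φ / ℓ) ^ (2 / 3 : ℝ)) ^ 3 = (φ / ℓ) ^ 2 := by
      rw [← Real.rpow_natCast, ← Real.rpow_mul (by positivity)]
      norm_num
    rw [e1, div_pow, div_pow, div_le_div_iff₀ (by positivity) (by positivity)]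
    have e2 : ℓ ^ 5 * φ ≤ (κ * u) ^ 3 := by
      have e3 : L ^ 5 * Real.log u = u ^ 3 := by
        rw [hL5, div_mul_cancel₀ _ hlu.ne']
      calc ℓ ^ 5 * φ = κ ^ 5 * (L ^ 5 * φ) := by rw [hℓdef]; ring
        _ ≤ κ ^ 3 * (L ^ 5 * Real.log u) := by
          gcongr ?_ * (_ * ?_)
          exact pow_le_pow_of_le_one hκ0.le hκ1 (by norm_num)
        _ = _ := by rw [e3]; ring
    calc (ℓ * φ) ^ 3 * ℓ ^ 2 = φ ^ 2 * (ℓ ^ 5 * φ) := by ring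
      _ ≤ φ ^ 2 * (κ * u) ^ 3 := by gcongr
  calc 16 * ℓ = 16 * κ * (ℓ * φ / (κ * u) / φ) * u := by field_simp
    _ ≤ _ := by gcongr

lemma abs_rieszMoebius_le_exp {A C₁ κ u L ℓ η φ X : ℝ} (hκ0 : 0 < κ) (hC1 : 1 ≤ C₁)
    (hℓdef : ℓ = κ * L) (hℓpos : 0 < ℓ) (huL : u ≤ L ^ 3) (hη0 : 0 < η) (hη1 : η ≤ 1 / 2)
    (hηu : 16 * ℓ ≤ η * u)
    (p3 : 16 * Real.exp (A * φ) + 12 * C₁ / κ ^ 3 * ℓ ^ 3 ≤ Real.exp (ℓ / 4))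
    (hX0 : 0 < X) (hX1 : 1 ≤ Real.log X) (hlX : u / 8 ≤ Real.log X) (hlX' : Real.log X ≤ 2 * u)
    (h1 : ∀ σ : ℝ, 1 < σ → σ ≤ 3 → ‖riemannZeta (σ : ℂ)‖ ≤ C₁ / (σ - 1))
    (hZ : ∀ t σ : ℝ, |t| ≤ Real.exp ℓ → 1 - η ≤ σ → σ ≤ 2 →
      zetaMulSub (σ + t * Complex.I) ≠ 0 ∧
        ‖(zetaMulSub (σ + t * Complex.I))⁻¹‖ ≤ Real.exp (A * φ)) :
    |rieszMoebius X| ≤ Real.exp (-(3 / 4 * ℓ)) := by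
  have h4 := abs_rieszMoebius_le (X := X) (H := Real.exp ℓ) (η := η) (B := Real.exp (A * φ))
    hX1 hX0 (Real.one_le_exp hℓpos.le) hη0 hη1 hC1 h1 hZ
  have h5 : X ^ (-η) ≤ Real.exp (-ℓ) * Real.exp (-ℓ) := by
    rw [Real.rpow_def_of_pos hX0, ← Real.exp_add]
    have : η * (u / 8) ≤ η * Real.log X := by gcongr
    exact Real.exp_le_exp.mpr (by linarith)
  have h6 : Real.exp ℓ * Real.exp (-ℓ) = 1 := by
    rw [← Real.exp_add, add_neg_cancel, Real.exp_zero]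
  have h7 : Real.exp (-(3 / 4 * ℓ)) = Real.exp (ℓ / 4) * Real.exp (-ℓ) := by
    rw [← Real.exp_add]
    congr 1
    ring
  have h8 : 2 * u ≤ 2 * (ℓ / κ) ^ 3 := by
    rw [hℓdef, mul_div_cancel_left₀ _ hκ0.ne']
    linarith
  calc |rieszMoebius X| ≤ _ := h4
    _ ≤ 4 * (Real.exp ℓ * (Real.exp (-ℓ) * Real.exp (-ℓ)) * Real.exp (A * φ)) +
        12 * (Real.exp (A * φ) / Real.exp ℓ) + 6 * C₁ * ((2 * (ℓ / κ) ^ 3) / Real.exp ℓ) := by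
      gcongr
      linarith
    _ = (16 * Real.exp (A * φ) + 12 * C₁ / κ ^ 3 * ℓ ^ 3) * Real.exp (-ℓ) := by
      rw [← mul_assoc (Real.exp ℓ), h6, div_eq_mul_inv, div_eq_mul_inv (2 * (ℓ / κ) ^ 3),
        ← Real.exp_neg]
      ring
    _ ≤ Real.exp (-(3 / 4 * ℓ)) := by
      rw [h7]
      gcongr

lemma abs_moebiusHarmonic_le_of_forall_riesz {x E : ℝ} (hx : 1 ≤ x) (hE0 : 0 < E) (hE1 : E ≤ 1)
    (hR : ∀ X : ℝ, x ≤ X → X ≤ 2 * x → |rieszMoebius X| ≤ E ^ 3) :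
    |moebiusHarmonic x| ≤ 4 * E + 1 / x := by
  have hx0 : 0 < x := by linarith
  have hxE : x * E ≤ x := mul_le_of_le_one_right hx0.le hE1
  have hxE0 : 0 < x * E := by positivity
  have h10 := hR x le_rfl (by linarith)
  have h11 := hR (x + x * E) (by linarith) (by linarith)
  calc |moebiusHarmonic x| ≤ _ := abs_moebiusHarmonic_le_of_riesz hx hxE0
    _ ≤ ((x + x * 1) * E ^ 3 + x * E ^ 3) / (x * E) + (x * E + 1) / x := by gcongr
    _ = 3 * E ^ 2 + E + 1 / x := by
      field_simp
      ring
    _ ≤ 3 * E + E + 1 / x := by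
      gcongr
      exact pow_le_of_le_one hE0.le hE1 two_ne_zero
    _ = _ := by ring

set_option maxHeartbeats 1000000 in
lemma exists_abs_moebiusHarmonic_le_exp : ∃ c > (0 : ℝ), ∃ C > (0 : ℝ), ∀ y : ℝ, 3 ≤ y →
    ∀ x : ℝ, y ^ ((1 : ℝ) / 8) ≤ x → x ≤ y →
      |moebiusHarmonic x| ≤ C * Real.exp (-(c * korobovExponent (Real.log y))) := by
  obtain ⟨A, b, φ₀, hA, hb0, hb1, hZ⟩ := exists_norm_inv_zetaMulSub_le
  obtain ⟨C₁, hC1, h1⟩ := exists_norm_riemannZeta_ofReal_le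
  set κ := b / 16 with hκ
  have hκ0 : 0 < κ := by positivity
  have hκ1 : κ ≤ 1 := by linarith
  obtain ⟨ℓ₀, hℓ0, hℓ⟩ := exists_forall_ge_log_and_le_exp A (12 * C₁ / κ ^ 3) φ₀
  set q := ℓ₀ / κ with hq
  have hq1 : 1 ≤ q := by
    rw [hq, one_le_div hκ0]
    linarith
  set u₀ := q ^ 5 + 8 with hu₀
  have hq5 : 1 ≤ q ^ 5 := one_le_pow₀ hq1
  have hlog3 : 1 < Real.log 3 := (Real.lt_log_iff_exp_lt (by norm_num)).mpr Real.exp_one_lt_three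
  have hll3 : 0 < Real.log (Real.log 3) := Real.log_pos hlog3
  set K := u₀ ^ ((3 : ℝ) / 5) / Real.log (Real.log 3) ^ ((1 : ℝ) / 5) with hK
  refine ⟨κ / 8, by positivity, 5 + (1 + u₀) * Real.exp (κ / 8 * K), by positivity,
    fun y hy x hxy hxy' => ?_⟩
  have hy0 : 0 < y := by linarith
  set u := Real.log y with hu
  have hu1 : Real.log 3 ≤ u := Real.log_le_log (by norm_num) hy
  have hx1 : 1 ≤ x := le_trans (Real.one_le_rpow (by linarith) (by norm_num)) hxy
  have hx0 : 0 < x := by linarith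
  have hlogx : Real.log x ≤ u := Real.log_le_log hx0 hxy'
  have hlogx' : u / 8 ≤ Real.log x := by
    have := Real.log_le_log (by positivity) hxy
    rw [Real.log_rpow hy0] at this
    linarith
  have hv0 : Real.log (Real.log 3) ≤ Real.log u := Real.log_le_log (by linarith) hu1
  rcases le_total u u₀ with hsmall | hbig
  · have hKb : korobovExponent u ≤ K := by
      rw [korobovExponent, hK]
      have : 0 ≤ u := by linarith
      gcongr
    calc |moebiusHarmonic x| ≤ 1 + Real.log x := abs_moebiusHarmonic_le hx1
      _ ≤ 1 + u₀ := by linarith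
      _ = (1 + u₀) * Real.exp (κ / 8 * K) * Real.exp (-(κ / 8 * K)) := by
        rw [mul_assoc, ← Real.exp_add, add_neg_cancel, Real.exp_zero, mul_one]
      _ ≤ (5 + (1 + u₀) * Real.exp (κ / 8 * K)) *
          Real.exp (-(κ / 8 * korobovExponent u)) := by
        gcongr
        linarith
  · have hu8 : 8 ≤ u := by linarith
    set L := korobovExponent u with hL
    have hL0 : 0 < L := korobovExponent_pos (by linarith)
    have hL5 : L ^ 5 = u ^ 3 / Real.log u := korobovExponent_pow_five (by linarith)
    have hv : 1 ≤ Real.log u := by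
      rw [Real.le_log_iff_exp_le (by linarith)]
      linarith [Real.exp_one_lt_three]
    have hvu : Real.log u ≤ u := by linarith [Real.log_le_sub_one_of_pos (by linarith : 0 < u)]
    have hLu2 : u ^ 2 ≤ L ^ 5 := by
      rw [hL5, le_div_iff₀ (by linarith)]
      calc u ^ 2 * Real.log u ≤ u ^ 2 * u := by gcongr
        _ = u ^ 3 := by ring
    have hLq : q ≤ L := by
      refine le_of_pow_le_pow_left₀ (n := 5) (by norm_num) hL0.le ?_
      nlinarith
    have hL1 : 1 ≤ L := hq1.trans hLq
    have hLu : L ≤ u := by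
      refine le_of_pow_le_pow_left₀ (n := 5) (by norm_num) (by linarith) ?_
      rw [hL5]
      calc u ^ 3 / Real.log u ≤ u ^ 3 := div_le_self (by positivity) hv
        _ ≤ u ^ 5 := pow_le_pow_right₀ (by linarith) (by norm_num)
    have huL : u ≤ L ^ 3 := by
      refine le_of_pow_le_pow_left₀ (n := 2) (by norm_num) (by positivity) ?_
      calc u ^ 2 ≤ L ^ 5 := hLu2
        _ ≤ L ^ 6 := pow_le_pow_right₀ hL1 (by norm_num)
        _ = (L ^ 3) ^ 2 := by ring
    set ℓ := κ * L with hℓdef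
    have hℓpos : 0 < ℓ := by positivity
    have hℓℓ : ℓ₀ ≤ ℓ := by
      rw [hq, div_le_iff₀ hκ0] at hLq
      linarith
    have hℓu : ℓ ≤ u := by nlinarith
    obtain ⟨p1, p2, p3⟩ := hℓ ℓ hℓℓ
    set φ := Real.log ℓ with hφ
    have hexpφ : Real.exp φ = ℓ := Real.exp_log hℓpos
    have hφv : φ ≤ Real.log u := Real.log_le_log hℓpos hℓu
    have hφℓ : φ ≤ ℓ := by linarith [Real.log_le_sub_one_of_pos hℓpos]
    set η := b * ((φ / ℓ) ^ (2 / 3 : ℝ) / φ) with hη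
    have hφ0 : 0 < φ := by linarith
    have hη0 : 0 < η := by positivity
    have hη1 : η ≤ 1 / 2 := by
      have h3 : (φ / ℓ) ^ (2 / 3 : ℝ) ≤ 1 :=
        Real.rpow_le_one (by positivity) (by rwa [div_le_one hℓpos]) (by norm_num)
      calc η ≤ 1 * (1 / 2) := by
            rw [hη]
            gcongr
        _ = 1 / 2 := by norm_num
    have hηu : 16 * ℓ ≤ η * u := by
      have := sixteen_mul_le_of_korobovExponent hκ0 hκ1 (by linarith) hℓdef hφ0 hφv
      rwa [show 16 * κ = b by rw [hκ]; ring] at this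
    have hR : ∀ X : ℝ, x ≤ X → X ≤ 2 * x → |rieszMoebius X| ≤ Real.exp (-(3 / 4 * ℓ)) := by
      intro X hX1 hX2
      have hX0 : 0 < X := hx0.trans_le hX1
      have hlX : u / 8 ≤ Real.log X := hlogx'.trans (Real.log_le_log hx0 hX1)
      have hlX' : Real.log X ≤ 2 * u := by
        have h3 := Real.log_le_log hX0 hX2
        rw [Real.log_mul (by norm_num) hx0.ne'] at h3
        have h4 := Real.log_two_lt_d9
        linarith only [h3, h4, hlogx, hu8]
      exact abs_rieszMoebius_le_exp hκ0 hC1 hℓdef hℓpos huL hη0 hη1 hηu p3 hX0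
        (by linarith only [hlX, hu8]) hlX hlX' h1 (fun t σ ht hσ hσ2 =>
          hZ φ p1 t σ (by rwa [hexpφ]) (by rwa [hexpφ]) hσ2)
    set E := Real.exp (-(ℓ / 4)) with hE
    have hE0 : 0 < E := Real.exp_pos _
    have hE1 : E ≤ 1 := Real.exp_le_one_iff.mpr (by linarith)
    have hE3 : Real.exp (-(3 / 4 * ℓ)) = E ^ 3 := by
      rw [hE, ← Real.exp_nat_mul]
      congr 1
      push_cast
      ring
    have h9 := abs_moebiusHarmonic_le_of_forall_riesz hx1 hE0 hE1
      (fun X hX1 hX2 => (hR X hX1 hX2).trans hE3.le)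
    have hxE : 1 / x ≤ Real.exp (-(κ / 8 * L)) := by
      rw [one_div, ← Real.exp_log hx0, ← Real.exp_neg]
      refine Real.exp_le_exp.mpr ?_
      linarith
    have hEE : E ≤ Real.exp (-(κ / 8 * L)) := Real.exp_le_exp.mpr (by linarith)
    calc |moebiusHarmonic x| ≤ _ := h9
      _ ≤ 5 * Real.exp (-(κ / 8 * L)) := by linarith
      _ ≤ _ := by
        gcongr
        have : 0 ≤ (1 + u₀) * Real.exp (κ / 8 * K) := by positivity
        linarith

lemma sum_squarefree_divisors_primeFactors {n : ℕ} (hn : n ≠ 0) (f : Finset ℕ → ℝ) :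
    ∑ d ∈ n.divisors with Squarefree d, f d.primeFactors = ∑ t ∈ n.primeFactors.powerset, f t := by
  have hprime : ∀ t ∈ n.primeFactors.powerset, ∀ p ∈ t, p.Prime := fun t ht p hp =>
    Nat.prime_of_mem_primeFactors (mem_powerset.mp ht hp)
  refine Finset.sum_nbij' Nat.primeFactors (fun t => ∏ p ∈ t, p) ?_ ?_ ?_ ?_ (fun _ _ => rfl)
  · intro d hd
    simp only [mem_filter, Nat.mem_divisors] at hd
    exact mem_powerset.mpr (Nat.primeFactors_mono hd.1.1 hn)
  · intro t ht
    simp only [mem_filter, Nat.mem_divisors]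
    refine ⟨⟨(Finset.prod_dvd_prod_of_subset _ _ _ (mem_powerset.mp ht)).trans
      (Nat.prod_primeFactors_dvd n), hn⟩, ?_⟩
    refine Finset.squarefree_prod_of_pairwise_isCoprime ?_ fun p hp => (hprime t ht p hp).squarefree
    intro p hp q hq hpq
    exact Nat.coprime_iff_isRelPrime.mp
      ((Nat.coprime_primes (hprime t ht p hp) (hprime t ht q hq)).mpr hpq)
  · intro d hd
    simp only [mem_filter] at hd
    exact Nat.prod_primeFactors_of_squarefree hd.2
  · intro t ht
    exact Nat.primeFactors_prod (hprime t ht)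

lemma moebius_eq_neg_one_pow_card_primeFactors {n : ℕ} (h : Squarefree n) :
    ArithmeticFunction.moebius n = (-1) ^ n.primeFactors.card := by
  rw [ArithmeticFunction.moebius_apply_of_squarefree h,
    ← (ArithmeticFunction.cardDistinctFactors_eq_cardFactors_iff_squarefree h.ne_zero).mpr h]
  rfl

lemma sum_divisors_moebius_mul_prod_primeFactors {n : ℕ} (hn : n ≠ 0) (w : ℕ → ℝ) :
    ∑ d ∈ n.divisors, ((ArithmeticFunction.moebius d : ℤ) : ℝ) * ∏ p ∈ d.primeFactors, w p =
      ∏ p ∈ n.primeFactors, (1 - w p) := by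
  have h1 : ∑ d ∈ n.divisors, ((ArithmeticFunction.moebius d : ℤ) : ℝ) * ∏ p ∈ d.primeFactors, w p
      = ∑ d ∈ n.divisors with Squarefree d, ∏ p ∈ d.primeFactors, (-w p) := by
    rw [sum_filter]
    refine sum_congr rfl fun d _ => ?_
    split_ifs with h
    · rw [moebius_eq_neg_one_pow_card_primeFactors h, prod_neg]
      push_cast
      ring
    · rw [ArithmeticFunction.moebius_eq_zero_of_not_squarefree h]
      simp
  rw [h1, sum_squarefree_divisors_primeFactors hn (fun t => ∏ p ∈ t, (-w p)),
    ← prod_one_add]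
  exact prod_congr rfl fun p _ => by ring

lemma sum_moebius_mul_prod_primeFactors_div (w : ℕ → ℝ) (z : ℝ) :
    ∑ d ∈ Icc 1 ⌊z⌋₊, ((ArithmeticFunction.moebius d : ℤ) : ℝ) * (∏ p ∈ d.primeFactors, w p) / d =
      ∑ e ∈ Icc 1 ⌊z⌋₊, (∏ p ∈ e.primeFactors, (1 - w p)) / e * moebiusHarmonic (z / e) := by
  let F : ArithmeticFunction ℝ := ⟨fun n => ((ArithmeticFunction.moebius n : ℤ) : ℝ) / n, by simp⟩
  let G : ArithmeticFunction ℝ := ⟨fun n => (∏ p ∈ n.primeFactors, (1 - w p)) / n, by simp⟩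
  have hinv := (ArithmeticFunction.sum_eq_iff_sum_mul_moebius_eq
    (f := fun d => ((ArithmeticFunction.moebius d : ℤ) : ℝ) * ∏ p ∈ d.primeFactors, w p)
    (g := fun n => ∏ p ∈ n.primeFactors, (1 - w p))).mp
    fun n hn => sum_divisors_moebius_mul_prod_primeFactors hn.ne' w
  have h1 : ∀ n ∈ Ioc 0 ⌊z⌋₊, ((ArithmeticFunction.moebius n : ℤ) : ℝ) *
      (∏ p ∈ n.primeFactors, w p) / n = (G * F) n := by
    intro n hn
    rw [mem_Ioc] at hn
    rw [← hinv n hn.1, mul_comm G, ArithmeticFunction.mul_apply, sum_div]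
    refine sum_congr rfl fun x hx => ?_
    rw [← (Nat.mem_divisorsAntidiagonal.mp hx).1]
    push_cast
    exact mul_div_mul_comm _ _ _ _
  have hI : ∀ N : ℕ, Icc 1 N = Ioc 0 N := fun N => rfl
  rw [hI, sum_congr rfl h1, ArithmeticFunction.sum_Ioc_mul_eq_sum_sum]
  refine sum_congr rfl fun e _ => ?_
  rw [moebiusHarmonic, Nat.floor_div_natCast, hI]
  rfl

lemma prod_primeFactors_mul_of_coprime (G : ℕ → ℝ) {a b : ℕ} (h : Nat.Coprime a b) :
    ∏ p ∈ (a * b).primeFactors, G p =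
      (∏ p ∈ a.primeFactors, G p) * ∏ p ∈ b.primeFactors, G p := by
  rw [h.primeFactors_mul, prod_union h.disjoint_primeFactors]

lemma inv_two_rpow_seven_eighths_le : ((2 : ℝ) ^ (-(7 / 8) : ℝ)) ≤ 2 / 3 := by
  refine le_of_pow_le_pow_left₀ (n := 8) (by norm_num) (by norm_num) ?_
  rw [← Real.rpow_natCast, ← Real.rpow_mul (by norm_num)]
  norm_num

/-- Rankin-type bound for sums of functions depending only on the prime factors. -/
lemma sum_prod_primeFactors_mul_rpow_le {G : ℕ → ℝ} (hG : ∀ p, 0 ≤ G p) (N : ℕ) :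
    ∑ e ∈ Icc 1 N, (∏ p ∈ e.primeFactors, G p) * (e : ℝ) ^ (-(7 / 8) : ℝ) ≤
      ∏ p ∈ (N + 1).primesBelow, (1 + 3 * (G p * (p : ℝ) ^ (-(7 / 8) : ℝ))) := by
  set f : ℕ → ℝ := fun e => (∏ p ∈ e.primeFactors, G p) * (e : ℝ) ^ (-(7 / 8) : ℝ) with hf
  have hf0 : ∀ e, 0 ≤ f e := fun e =>
    mul_nonneg (prod_nonneg fun p _ => hG p) (Real.rpow_nonneg (Nat.cast_nonneg _) _)
  have hf1 : f 1 = 1 := by simp [hf]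
  have hmul : ∀ {a b : ℕ}, Nat.Coprime a b → f (a * b) = f a * f b := by
    intro a b hab
    simp only [hf]
    rw [prod_primeFactors_mul_of_coprime G hab, Nat.cast_mul,
      Real.mul_rpow (Nat.cast_nonneg _) (Nat.cast_nonneg _)]
    ring
  have hr : ∀ {p : ℕ}, p.Prime → (p : ℝ) ^ (-(7 / 8) : ℝ) ≤ 2 / 3 := fun hp =>
    (Real.rpow_le_rpow_of_nonpos (by norm_num) (by exact_mod_cast hp.two_le) (by norm_num)).trans
      inv_two_rpow_seven_eighths_le
  have hr0 : ∀ p : ℕ, 0 ≤ (p : ℝ) ^ (-(7 / 8) : ℝ) := fun p =>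
    Real.rpow_nonneg (Nat.cast_nonneg _) _
  have hpow : ∀ {p : ℕ}, p.Prime → ∀ n : ℕ, f (p ^ (n + 1)) =
      G p * (p : ℝ) ^ (-(7 / 8) : ℝ) * ((p : ℝ) ^ (-(7 / 8) : ℝ)) ^ n := by
    intro p hp n
    simp only [hf]
    rw [Nat.primeFactors_prime_pow (Nat.succ_ne_zero n) hp, prod_singleton, Nat.cast_pow,
      ← Real.rpow_natCast, ← Real.rpow_mul (Nat.cast_nonneg _), mul_comm ((n + 1 : ℕ) : ℝ),
      Real.rpow_mul (Nat.cast_nonneg _), Real.rpow_natCast]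
    ring
  have hs : ∀ {p : ℕ}, p.Prime → HasSum (fun n : ℕ => f (p ^ (n + 1)))
      (G p * (p : ℝ) ^ (-(7 / 8) : ℝ) * (1 - (p : ℝ) ^ (-(7 / 8) : ℝ))⁻¹) := by
    intro p hp
    simp only [hpow hp]
    exact (hasSum_geometric_of_lt_one (hr0 p) ((hr hp).trans_lt (by norm_num))).mul_left _
  have hs' : ∀ {p : ℕ}, p.Prime → Summable (fun n : ℕ => f (p ^ n)) := fun hp =>
    (summable_nat_add_iff 1).mp (hs hp).summable
  obtain ⟨hS, hT⟩ := EulerProduct.summable_and_hasSum_smoothNumbers_prod_primesBelow_tsum hf1 hmul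
    (fun hp => (hs' hp).norm) (N + 1)
  have h1 : ∑ e ∈ Icc 1 N, f e ≤ ∏ p ∈ (N + 1).primesBelow, ∑' n : ℕ, f (p ^ n) := by
    have hmem : ∀ e ∈ Icc 1 N, e ∈ (N + 1).smoothNumbers := by
      intro e he
      rw [mem_Icc] at he
      rw [Nat.mem_smoothNumbers]
      exact ⟨by omega, fun p hp => Nat.lt_succ_of_le ((Nat.le_of_mem_primeFactorsList hp).trans he.2)⟩
    rw [← Finset.sum_subtype_of_mem f hmem]
    exact sum_le_hasSum _ (fun e _ => hf0 e) hT
  refine h1.trans (prod_le_prod (fun p _ => tsum_nonneg fun n => hf0 _) fun p hp => ?_)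
  have hp' := Nat.prime_of_mem_primesBelow hp
  rw [(hs' hp').tsum_eq_zero_add, pow_zero, hf1, (hs hp').tsum_eq]
  have h3 : (1 - (p : ℝ) ^ (-(7 / 8) : ℝ))⁻¹ ≤ 3 := by
    rw [inv_le_comm₀ (by linarith [hr hp']) (by norm_num)]
    linarith [hr hp']
  have := mul_le_mul_of_nonneg_left h3 (mul_nonneg (hG p) (hr0 p))
  linarith

lemma prod_primesBelow_ite_dvd_le {n N : ℕ} (hn : n ≠ 0) {a : ℕ → ℝ} (ha : ∀ p, 1 ≤ a p) :
    ∏ p ∈ N.primesBelow, (if p ∣ n then a p else 1) ≤ ∏ p ∈ n.primeFactors, a p := by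
  rw [← prod_filter]
  have hsub : {p ∈ N.primesBelow | p ∣ n} ⊆ n.primeFactors := by
    intro p hp
    rw [mem_filter] at hp
    exact Nat.mem_primeFactors.mpr ⟨Nat.prime_of_mem_primesBelow hp.1, hp.2, hn⟩
  exact Finset.prod_le_prod_of_subset_of_one_le hsub (fun p _ => zero_le_one.trans (ha p)) fun p _ _ => ha p

lemma exists_prod_primesBelow_le : ∃ K : ℝ, 0 < K ∧ ∀ N : ℕ,
    ∏ p ∈ N.primesBelow, (1 + 3 * (p : ℝ) ^ (-(15 / 8) : ℝ)) ≤ K := by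
  have hs : Summable (fun p : ℕ => 3 * (p : ℝ) ^ (-(15 / 8) : ℝ)) :=
    (Real.summable_nat_rpow.mpr (by norm_num)).mul_left 3
  have h0 : ∀ p : ℕ, 0 ≤ 3 * (p : ℝ) ^ (-(15 / 8) : ℝ) := fun p => by positivity
  refine ⟨Real.exp (∑' p : ℕ, 3 * (p : ℝ) ^ (-(15 / 8) : ℝ)), Real.exp_pos _, fun N => ?_⟩
  calc _ ≤ ∏ p ∈ N.primesBelow, Real.exp (3 * (p : ℝ) ^ (-(15 / 8) : ℝ)) := by
        refine prod_le_prod (fun p _ => by linarith [h0 p]) fun p _ => ?_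
        rw [add_comm]
        exact Real.add_one_le_exp _
    _ = Real.exp (∑ p ∈ N.primesBelow, 3 * (p : ℝ) ^ (-(15 / 8) : ℝ)) := (Real.exp_sum _ _).symm
    _ ≤ _ := Real.exp_le_exp.mpr (hs.sum_le_tsum _ fun p _ => h0 p)

/-- The Euler factors of `μ(d) / ψ_m(d)` restricted to `(d, δ) = 1`, times `p`. -/
noncomputable def localWeight (m δ p : ℕ) : ℝ :=
  if p ∣ m then p else if p ∣ δ then 0 else p / (p + 1)

lemma one_add_three_mul_abs_one_sub_localWeight_le {m δ p : ℕ} (hp : 1 ≤ p) :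
    1 + 3 * (|1 - localWeight m δ p| * (p : ℝ) ^ (-(7 / 8) : ℝ)) ≤
      (if p ∣ m then 1 + 3 * (p : ℝ) ^ ((1 : ℝ) / 8) else 1) * (if p ∣ δ then 4 else 1) *
        (1 + 3 * (p : ℝ) ^ (-(15 / 8) : ℝ)) := by
  have hp1 : (1 : ℝ) ≤ p := by exact_mod_cast hp
  have hp0 : (0 : ℝ) < p := by linarith
  have hk : 0 ≤ 3 * (p : ℝ) ^ (-(15 / 8) : ℝ) := by positivity
  have e1 : (p : ℝ) * (p : ℝ) ^ (-(7 / 8) : ℝ) = (p : ℝ) ^ ((1 : ℝ) / 8) := by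
    rw [← Real.rpow_one_add' hp0.le (by norm_num)]
    norm_num
  have e2 : (p : ℝ)⁻¹ * (p : ℝ) ^ (-(7 / 8) : ℝ) = (p : ℝ) ^ (-(15 / 8) : ℝ) := by
    rw [← Real.rpow_neg_one, ← Real.rpow_add hp0]
    norm_num
  have hq1 : (p : ℝ) ^ (-(7 / 8) : ℝ) ≤ 1 := Real.rpow_le_one_of_one_le_of_nonpos hp1 (by norm_num)
  have hq0 : 0 ≤ (p : ℝ) ^ (-(7 / 8) : ℝ) := by positivity
  have h4 : (1 : ℝ) ≤ if p ∣ δ then 4 else 1 := by split_ifs <;> norm_num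
  have hA : (1 : ℝ) ≤ 1 + 3 * (p : ℝ) ^ ((1 : ℝ) / 8) := by
    have : 0 ≤ (p : ℝ) ^ ((1 : ℝ) / 8) := by positivity
    linarith
  rw [localWeight]
  by_cases hm : p ∣ m
  · simp only [if_pos hm]
    have h1 : |1 - (p : ℝ)| ≤ p := by
      rw [abs_sub_comm, abs_of_nonneg (by linarith)]
      linarith
    have h2 := mul_le_mul_of_nonneg_right h1 hq0
    rw [e1] at h2
    calc _ ≤ 1 + 3 * (p : ℝ) ^ ((1 : ℝ) / 8) := by linarith
      _ ≤ (1 + 3 * (p : ℝ) ^ ((1 : ℝ) / 8)) * (if p ∣ δ then 4 else 1) :=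
        le_mul_of_one_le_right (by linarith) h4
      _ ≤ _ := le_mul_of_one_le_right (by positivity) (by linarith)
  · simp only [if_neg hm]
    by_cases hd : p ∣ δ
    · simp only [if_pos hd, sub_zero, abs_one, one_mul]
      linarith
    · simp only [if_neg hd, one_mul]
      have h1 : |1 - (p : ℝ) / (p + 1)| ≤ (p : ℝ)⁻¹ := by
        rw [one_sub_div (by positivity), add_sub_cancel_left, abs_of_nonneg (by positivity),
          one_div]
        gcongr
        linarith
      have h2 := mul_le_mul_of_nonneg_right h1 hq0
      rw [e2] at h2
      linarith

lemma exists_sum_prod_abs_one_sub_localWeight_le : ∃ K : ℝ, 0 < K ∧ ∀ m δ N : ℕ, m ≠ 0 → δ ≠ 0 →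
    ∑ e ∈ Icc 1 N, (∏ p ∈ e.primeFactors, |1 - localWeight m δ p|) * (e : ℝ) ^ (-(7 / 8) : ℝ) ≤
      K * (∏ p ∈ m.primeFactors, (1 + 3 * (p : ℝ) ^ ((1 : ℝ) / 8))) *
        4 ^ δ.primeFactors.card := by
  obtain ⟨K, hK0, hK⟩ := exists_prod_primesBelow_le
  refine ⟨K, hK0, fun m δ N hm hδ => ?_⟩
  have hA : ∀ p : ℕ, (1 : ℝ) ≤ 1 + 3 * (p : ℝ) ^ ((1 : ℝ) / 8) := fun p => by
    have : 0 ≤ (p : ℝ) ^ ((1 : ℝ) / 8) := by positivity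
    linarith
  refine (sum_prod_primeFactors_mul_rpow_le (fun p => abs_nonneg _) N).trans ?_
  refine (prod_le_prod (fun p _ => by positivity) fun p hp =>
    one_add_three_mul_abs_one_sub_localWeight_le (m := m) (δ := δ)
      (Nat.prime_of_mem_primesBelow hp).one_le).trans ?_
  rw [prod_mul_distrib, prod_mul_distrib]
  have h1 := prod_primesBelow_ite_dvd_le (N := N + 1) hm hA
  have h2 := prod_primesBelow_ite_dvd_le (N := N + 1) hδ (a := fun _ => 4) (fun _ => by norm_num)
  rw [prod_const] at h2
  have h3 := hK (N + 1)
  have n1 : 0 ≤ ∏ p ∈ (N + 1).primesBelow,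
      (if p ∣ m then 1 + 3 * (p : ℝ) ^ ((1 : ℝ) / 8) else 1) :=
    prod_nonneg fun p _ => by split_ifs <;> linarith [hA p]
  have n2 : (0 : ℝ) ≤ ∏ p ∈ (N + 1).primesBelow, (if p ∣ δ then 4 else 1) :=
    prod_nonneg fun p _ => by split_ifs <;> norm_num
  have n3 : 0 ≤ ∏ p ∈ (N + 1).primesBelow, (1 + 3 * (p : ℝ) ^ (-(15 / 8) : ℝ)) :=
    prod_nonneg fun p _ => by positivity
  have n4 : 0 ≤ ∏ p ∈ m.primeFactors, (1 + 3 * (p : ℝ) ^ ((1 : ℝ) / 8)) := n1.trans h1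
  calc _ ≤ (∏ p ∈ m.primeFactors, (1 + 3 * (p : ℝ) ^ ((1 : ℝ) / 8))) * 4 ^ δ.primeFactors.card *
        K := by gcongr
    _ = _ := by ring

/-- Sums of `k ^ ω(n) / n`. -/
lemma sum_pow_card_primeFactors_div_le (k N : ℕ) :
    ∑ n ∈ Icc 1 N, (k : ℝ) ^ n.primeFactors.card / n ≤ (1 + Real.log N) ^ k := by
  induction k generalizing N with
  | zero =>
    have : ∀ n ∈ Icc 1 N, ((0 : ℕ) : ℝ) ^ n.primeFactors.card / n ≤ if n = 1 then 1 else 0 := by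
      intro n hn
      rw [mem_Icc] at hn
      split_ifs with h
      · simp [h]
      · have : n.primeFactors.card ≠ 0 := by
          rw [Finset.card_ne_zero, Nat.nonempty_primeFactors]
          omega
        simp [this]
    refine (sum_le_sum this).trans ?_
    rw [sum_ite_eq', pow_zero]
    split_ifs <;> norm_num
  | succ k ih =>
    let F : ArithmeticFunction ℝ := ⟨fun n => (k : ℝ) ^ n.primeFactors.card / n, by simp⟩
    let G : ArithmeticFunction ℝ := ⟨fun n => 1 / n, by simp⟩
    have h1 : ∀ n ∈ Ioc 0 N, ((k + 1 : ℕ) : ℝ) ^ n.primeFactors.card / n ≤ (F * G) n := by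
      intro n hn
      rw [mem_Ioc] at hn
      have hn0 : n ≠ 0 := by omega
      have e1 : (F * G) n = (∑ d ∈ n.divisors, (k : ℝ) ^ d.primeFactors.card) / n := by
        rw [ArithmeticFunction.mul_apply, ← Nat.sum_divisorsAntidiagonal
          (fun d _ => (k : ℝ) ^ d.primeFactors.card), sum_div]
        refine sum_congr rfl fun x hx => ?_
        rw [← (Nat.mem_divisorsAntidiagonal.mp hx).1]
        push_cast
        change (k : ℝ) ^ x.1.primeFactors.card / x.1 * (1 / x.2) = _
        rw [div_mul_div_comm, mul_one]
      rw [e1]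
      gcongr
      refine le_trans (le_of_eq ?_) (sum_le_sum_of_subset_of_nonneg
        (filter_subset Squarefree _) fun d _ _ => by positivity)
      rw [sum_squarefree_divisors_primeFactors hn0 (fun t => (k : ℝ) ^ t.card)]
      have := prod_one_add (s := n.primeFactors) (f := fun _ => (k : ℝ))
      simp only [prod_const] at this
      rw [← this, add_comm]
      push_cast
      rfl
    have hI : ∀ N : ℕ, Icc 1 N = Ioc 0 N := fun N => rfl
    rcases Nat.eq_zero_or_pos N with rfl | hN
    · simp
    have hlog : 0 ≤ Real.log N := Real.log_natCast_nonneg N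
    rw [hI]
    refine (sum_le_sum h1).trans ?_
    rw [ArithmeticFunction.sum_Ioc_mul_eq_sum_sum]
    have h2 : ∀ n ∈ Ioc 0 N, F n * ∑ j ∈ Ioc 0 (N / n), G j ≤ F n * (1 + Real.log N) := by
      intro n hn
      rw [mem_Ioc] at hn
      have hF : 0 ≤ F n := by
        change 0 ≤ (k : ℝ) ^ n.primeFactors.card / n
        positivity
      refine mul_le_mul_of_nonneg_left ?_ hF
      refine (sum_le_sum_of_subset_of_nonneg (t := Ioc 0 N) ?_ fun j _ _ => ?_).trans ?_
      · exact Ioc_subset_Ioc le_rfl (Nat.div_le_self _ _)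
      · change (0 : ℝ) ≤ 1 / j
        positivity
      · refine le_trans (le_of_eq ?_) (harmonic_le_one_add_log N)
        rw [harmonic_eq_sum_Icc]
        push_cast
        exact sum_congr rfl fun j _ => one_div _
    refine (sum_le_sum h2).trans ?_
    rw [← sum_mul, pow_succ]
    gcongr
    exact ih N

lemma exists_prod_primeFactors_mul_rpow_le {K : ℝ} (hK : 1 ≤ K) : ∃ C : ℝ, 0 < C ∧ ∀ m : ℕ,
    ∏ p ∈ m.primeFactors, (K * (p : ℝ) ^ (-(1 / 4) : ℝ)) ≤ C := by
  have hK0 : 0 < K := by linarith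
  obtain ⟨N, hN⟩ := exists_nat_ge (K ^ 4)
  refine ⟨K ^ N, by positivity, fun m => ?_⟩
  have h1 : ∀ p ∈ m.primeFactors, K * (p : ℝ) ^ (-(1 / 4) : ℝ) ≤ if p < N then K else 1 := by
    intro p hp
    have hp1 : (1 : ℝ) ≤ p := by exact_mod_cast (Nat.prime_of_mem_primeFactors hp).one_le
    split_ifs with h
    · exact mul_le_of_le_one_right hK0.le
        (Real.rpow_le_one_of_one_le_of_nonpos hp1 (by norm_num))
    · have h2 : K ^ 4 ≤ p := hN.trans (by exact_mod_cast not_lt.mp h)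
      rw [Real.rpow_neg (by linarith), ← div_eq_mul_inv, div_le_one (by positivity)]
      refine le_of_pow_le_pow_left₀ (n := 4) (by norm_num) (by positivity) ?_
      rw [← Real.rpow_natCast ((p : ℝ) ^ _), ← Real.rpow_mul (by linarith)]
      norm_num
      exact h2
  refine (prod_le_prod (fun p _ => by positivity) h1).trans ?_
  rw [← prod_filter, prod_const]
  refine pow_le_pow_right₀ hK ((card_le_card fun p hp => ?_).trans_eq (card_range N))
  exact mem_range.mpr (mem_filter.mp hp).2

lemma prod_localWeight_mul_psiM {m δ d : ℕ} (hd : Squarefree d) (hdδ : Nat.Coprime d δ) :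
    (∏ p ∈ d.primeFactors, localWeight m δ p) * psiM m d = d := by
  conv_rhs => rw [← Nat.prod_primeFactors_of_squarefree hd]
  rw [psiM, prod_filter]
  push_cast
  rw [← prod_mul_distrib]
  refine prod_congr rfl fun p hp => ?_
  have hpp := Nat.prime_of_mem_primeFactors hp
  have hδ : ¬ p ∣ δ := fun h =>
    hpp.one_lt.ne' (Nat.dvd_one.mp (hdδ ▸ Nat.dvd_gcd (Nat.dvd_of_mem_primeFactors hp) h))
  rw [localWeight, if_neg hδ]
  have : (p : ℝ) + 1 ≠ 0 := by positivity
  by_cases hm : p ∣ m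
  · simp [hm]
  · simp [hm, this]

lemma psiM_pos (m d : ℕ) : 0 < psiM m d := prod_pos fun p _ => Nat.succ_pos p

lemma moebius_mul_div_psiM {m δ d : ℕ} (hd : d ≠ 0) (hδm : Nat.gcd δ m = 1) :
    (ArithmeticFunction.moebius (d * δ) : ℝ) / (psiM m d : ℝ) =
      (ArithmeticFunction.moebius δ : ℝ) * ((ArithmeticFunction.moebius d : ℝ) *
        (∏ p ∈ d.primeFactors, localWeight m δ p) / d) := by
  by_cases hsq : Squarefree d
  · by_cases hc : Nat.Coprime d δ
    · have hψ : (psiM m d : ℝ) ≠ 0 := by exact_mod_cast (psiM_pos m d).ne'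
      have hd' : (d : ℝ) ≠ 0 := by exact_mod_cast hd
      rw [ArithmeticFunction.isMultiplicative_moebius.map_mul_of_coprime hc]
      have h1 := prod_localWeight_mul_psiM (m := m) hsq hc
      push_cast
      rw [← mul_div_assoc, div_eq_div_iff hψ hd', ← h1]
      ring
    · obtain ⟨p, hp, hpd, hpδ⟩ := Nat.Prime.not_coprime_iff_dvd.mp hc
      have hpm : ¬ p ∣ m := fun h => hp.one_lt.ne' (Nat.dvd_one.mp (hδm ▸ Nat.dvd_gcd hpδ h))
      rw [ArithmeticFunction.moebius_eq_zero_of_not_squarefree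
        (fun h => hc (Nat.squarefree_mul_iff.mp h).1),
        prod_eq_zero (Nat.mem_primeFactors.mpr ⟨hp, hpd, hd⟩)
          (by rw [localWeight, if_neg hpm, if_pos hpδ])]
      simp
  · rw [ArithmeticFunction.moebius_eq_zero_of_not_squarefree hsq,
      ArithmeticFunction.moebius_eq_zero_of_not_squarefree
        (fun h => hsq (h.squarefree_of_dvd (dvd_mul_right d δ)))]
    simp

lemma abs_sum_moebius_mul_div_psiM_le {m δ : ℕ} {z V : ℝ} (hδm : Nat.gcd δ m = 1)
    (hV : ∀ e : ℕ, 1 ≤ e → (e : ℝ) ≤ z →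
      |moebiusHarmonic (z / e)| ≤ V * (e : ℝ) ^ ((1 : ℝ) / 8)) :
    |∑ d ∈ Icc 1 ⌊z⌋₊, (ArithmeticFunction.moebius (d * δ) : ℝ) / (psiM m d : ℝ)| ≤
      |(ArithmeticFunction.moebius δ : ℝ)| * (V * ∑ e ∈ Icc 1 ⌊z⌋₊,
        (∏ p ∈ e.primeFactors, |1 - localWeight m δ p|) * (e : ℝ) ^ (-(7 / 8) : ℝ)) := by
  have h1 : ∀ d ∈ Icc 1 ⌊z⌋₊, (ArithmeticFunction.moebius (d * δ) : ℝ) / (psiM m d : ℝ) =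
      (ArithmeticFunction.moebius δ : ℝ) * ((ArithmeticFunction.moebius d : ℝ) *
        (∏ p ∈ d.primeFactors, localWeight m δ p) / d) := fun d hd =>
    moebius_mul_div_psiM (by rw [mem_Icc] at hd; omega) hδm
  rw [sum_congr rfl h1, ← mul_sum, sum_moebius_mul_prod_primeFactors_div, abs_mul]
  refine mul_le_mul_of_nonneg_left ?_ (abs_nonneg _)
  refine (abs_sum_le_sum_abs _ _).trans ?_
  rw [mul_sum]
  refine sum_le_sum fun e he => ?_
  rw [mem_Icc] at he
  have he0 : (0 : ℝ) < e := by exact_mod_cast he.1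
  have hez : (e : ℝ) ≤ z := (Nat.le_floor_iff' (by omega)).mp he.2
  have hr : (e : ℝ) ^ (-(7 / 8) : ℝ) = (e : ℝ) ^ ((1 : ℝ) / 8) / e := by
    rw [← Real.rpow_sub_one he0.ne']
    norm_num
  rw [abs_mul, abs_div, abs_prod, Nat.abs_cast, hr]
  calc _ ≤ (∏ p ∈ e.primeFactors, |1 - localWeight m δ p|) / e *
        (V * (e : ℝ) ^ ((1 : ℝ) / 8)) := by
        gcongr
        exact hV e he.1 hez
    _ = _ := by ring

lemma abs_moebiusHarmonic_div_le {y z E : ℝ} (hy : 1 ≤ y) (hz : y ^ ((1 : ℝ) / 4) ≤ z)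
    (hzy : z ≤ y) (hE : ∀ x : ℝ, y ^ ((1 : ℝ) / 8) ≤ x → x ≤ y → |moebiusHarmonic x| ≤ E)
    {e : ℕ} (he : 1 ≤ e) (hez : (e : ℝ) ≤ z) :
    |moebiusHarmonic (z / e)| ≤
      (E + (1 + Real.log y) * Real.exp (-(Real.log y / 64))) * (e : ℝ) ^ ((1 : ℝ) / 8) := by
  have hy0 : 0 < y := by linarith
  have he1 : (1 : ℝ) ≤ e := by exact_mod_cast he
  have he0 : (0 : ℝ) < e := by linarith
  have hlog : 0 ≤ Real.log y := Real.log_nonneg hy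
  have hr1 : 1 ≤ (e : ℝ) ^ ((1 : ℝ) / 8) := Real.one_le_rpow he1 (by norm_num)
  have hzey : z / e ≤ y := (div_le_self (by linarith) he1).trans hzy
  have hy8 : 1 ≤ y ^ ((1 : ℝ) / 8) := Real.one_le_rpow hy (by norm_num)
  have hE0 : 0 ≤ E := (abs_nonneg _).trans (hE y (by
    conv_rhs => rw [← Real.rpow_one y]
    exact Real.rpow_le_rpow_of_exponent_le hy (by norm_num)) le_rfl)
  have hsq : y ^ ((1 : ℝ) / 4) = y ^ ((1 : ℝ) / 8) * y ^ ((1 : ℝ) / 8) := by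
    rw [← Real.rpow_add hy0]
    norm_num
  rw [hsq] at hz
  rcases le_total (e : ℝ) (y ^ ((1 : ℝ) / 8)) with h | h
  · have h1 : y ^ ((1 : ℝ) / 8) ≤ z / e := by
      rw [le_div_iff₀ he0]
      refine le_trans ?_ hz
      gcongr
    calc _ ≤ E := hE _ h1 hzey
      _ ≤ E + (1 + Real.log y) * Real.exp (-(Real.log y / 64)) :=
        le_add_of_nonneg_right (by positivity)
      _ ≤ _ := le_mul_of_one_le_right (by positivity) hr1
  · have h1 : 1 ≤ Real.exp (-(Real.log y / 64)) * (e : ℝ) ^ ((1 : ℝ) / 8) := by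
      rw [Real.exp_neg, inv_mul_eq_div, one_le_div (Real.exp_pos _)]
      calc Real.exp (Real.log y / 64) = (y ^ ((1 : ℝ) / 8)) ^ ((1 : ℝ) / 8) := by
            rw [← Real.rpow_mul hy0.le, Real.rpow_def_of_pos hy0]
            congr 1
            ring
        _ ≤ _ := by gcongr
    have h2 : 1 ≤ z / e := by rwa [one_le_div he0]
    calc _ ≤ 1 + Real.log (z / e) := abs_moebiusHarmonic_le h2
      _ ≤ 1 + Real.log y := by
        gcongr
      _ ≤ (1 + Real.log y) * (Real.exp (-(Real.log y / 64)) * (e : ℝ) ^ ((1 : ℝ) / 8)) :=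
        le_mul_of_one_le_right (by positivity) h1
      _ ≤ _ := by
        rw [add_mul E, mul_assoc]
        exact le_add_of_nonneg_left (by positivity)

lemma exists_prod_sq_div_psi_le : ∃ C : ℝ, 0 < C ∧ ∀ m : ℕ,
    (∏ p ∈ m.primeFactors, (1 + 3 * (p : ℝ) ^ ((1 : ℝ) / 8))) ^ 2 / psi m ≤
      C / Real.sqrt (psi m) := by
  obtain ⟨C, hC0, hC⟩ := exists_prod_primeFactors_mul_rpow_le (K := 16) (by norm_num)
  refine ⟨C, hC0, fun m => ?_⟩
  have hψ : (0 : ℝ) < psi m := by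
    exact_mod_cast (show 0 < psi m from prod_pos fun p _ => Nat.succ_pos p)
  have hs : 0 < Real.sqrt (psi m) := Real.sqrt_pos.mpr hψ
  have e1 : Real.sqrt (psi m) = ∏ p ∈ m.primeFactors, Real.sqrt ((p : ℝ) + 1) := by
    rw [psi]
    push_cast
    exact Real.sqrt_prod _ fun p _ => by positivity
  have h1 : (∏ p ∈ m.primeFactors, (1 + 3 * (p : ℝ) ^ ((1 : ℝ) / 8))) ^ 2 ≤
      C * Real.sqrt (psi m) := by
    refine le_trans ?_ (mul_le_mul_of_nonneg_right (hC m) hs.le)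
    rw [e1, ← prod_pow, ← prod_mul_distrib]
    refine prod_le_prod (fun p _ => by positivity) fun p hp => ?_
    have hp1 : (1 : ℝ) ≤ p := by exact_mod_cast (Nat.prime_of_mem_primeFactors hp).one_le
    have hp0 : (0 : ℝ) < p := by linarith
    have h2 : 1 ≤ (p : ℝ) ^ ((1 : ℝ) / 8) := Real.one_le_rpow hp1 (by norm_num)
    calc (1 + 3 * (p : ℝ) ^ ((1 : ℝ) / 8)) ^ 2 ≤ (4 * (p : ℝ) ^ ((1 : ℝ) / 8)) ^ 2 := by
          gcongr
          linarith
      _ = 16 * (p : ℝ) ^ (-(1 / 4) : ℝ) * (p : ℝ) ^ ((1 : ℝ) / 2) := by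
        rw [mul_pow, ← Real.rpow_natCast ((p : ℝ) ^ _), ← Real.rpow_mul hp0.le, mul_assoc,
          ← Real.rpow_add hp0]
        norm_num
      _ ≤ _ := by
        rw [Real.sqrt_eq_rpow]
        gcongr
        linarith
  rw [div_le_div_iff₀ hψ hs]
  calc _ ≤ C * Real.sqrt (psi m) * Real.sqrt (psi m) := by gcongr
    _ = _ := by rw [mul_assoc, Real.mul_self_sqrt hψ.le]

lemma div_psi_sq_le {δ : ℕ} (h : Squarefree δ) : (δ : ℝ) / (psi δ : ℝ) ^ 2 ≤ 1 / δ := by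
  have hδ : (0 : ℝ) < δ := by exact_mod_cast Nat.pos_of_ne_zero h.ne_zero
  have h1 : (δ : ℝ) ≤ psi δ := by
    have : δ ≤ psi δ := by
      conv_lhs => rw [← Nat.prod_primeFactors_of_squarefree h]
      exact prod_le_prod' fun p _ => Nat.le_succ p
    exact_mod_cast this
  have h2 : (0 : ℝ) < psi δ := hδ.trans_le h1
  rw [div_le_div_iff₀ (by positivity) hδ]
  nlinarith

lemma rpow_two_fifths_le_korobovExponent {u : ℝ} (hu : 1 < u) :
    u ^ ((2 : ℝ) / 5) ≤ korobovExponent u := by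
  have hu0 : 0 < u := by linarith
  have hv : 0 < Real.log u := Real.log_pos hu
  have hvu : Real.log u ≤ u := by linarith [Real.log_le_sub_one_of_pos hu0]
  rw [korobovExponent, le_div_iff₀ (by positivity)]
  calc _ ≤ u ^ ((2 : ℝ) / 5) * u ^ ((1 : ℝ) / 5) := by gcongr
    _ = _ := by
      rw [← Real.rpow_add hu0]
      norm_num

lemma korobovExponent_le {a u : ℝ} (ha : 1 < a) (hu : a ≤ u) :
    korobovExponent u ≤ u / Real.log a ^ ((1 : ℝ) / 5) := by
  have hv : 0 < Real.log a := Real.log_pos ha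
  have h1 : u ^ ((3 : ℝ) / 5) ≤ u := by
    conv_rhs => rw [← Real.rpow_one u]
    exact Real.rpow_le_rpow_of_exponent_le (by linarith) (by norm_num)
  have hu0 : 0 ≤ u := by linarith
  rw [korobovExponent]
  gcongr

lemma exists_pow_mul_exp_neg_rpow_le {c : ℝ} (hc : 0 < c) : ∃ C : ℝ, 0 < C ∧ ∀ u : ℝ, 1 ≤ u →
    (1 + u) ^ 18 * Real.exp (-(c * u ^ ((2 : ℝ) / 5))) ≤ C := by
  refine ⟨2 ^ 18 * (((45).factorial : ℕ) / c ^ 45), by positivity, fun u hu => ?_⟩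
  have hu0 : 0 < u := by linarith
  set x := u ^ ((2 : ℝ) / 5) with hx
  have hx0 : 0 < x := by positivity
  have hux : u ^ 18 = x ^ 45 := by
    rw [hx, ← Real.rpow_natCast, ← Real.rpow_natCast, ← Real.rpow_mul hu0.le]
    norm_num
  have h1 := Real.pow_div_factorial_le_exp (c * x) (by positivity) 45
  have hf : (0 : ℝ) < ((45).factorial : ℕ) := by exact_mod_cast Nat.factorial_pos 45
  generalize ((45).factorial : ℕ) = F at *
  rw [div_le_iff₀ hf, mul_pow, mul_comm, ← le_div_iff₀ (by positivity)] at h1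
  calc _ ≤ (2 * u) ^ 18 * Real.exp (-(c * x)) := by
        gcongr
        linarith
    _ = 2 ^ 18 * x ^ 45 * Real.exp (-(c * x)) := by rw [mul_pow, hux]
    _ ≤ 2 ^ 18 * (Real.exp (c * x) * F / c ^ 45) * Real.exp (-(c * x)) := by gcongr
    _ = 2 ^ 18 * (F / c ^ 45) * (Real.exp (c * x) * Real.exp (-(c * x))) := by ring
    _ = _ := by rw [← Real.exp_add, add_neg_cancel, Real.exp_zero, mul_one]

lemma exists_sq_mul_pow_le_exp_korobovExponent {a c C : ℝ} (ha : 1 < a) (hc : 0 < c) (hC : 0 < C) :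
    ∃ c' > (0 : ℝ), ∃ C' > (0 : ℝ), ∀ u : ℝ, a ≤ u →
      (C * Real.exp (-(c * korobovExponent u)) + (1 + u) * Real.exp (-(u / 64))) ^ 2 *
        (1 + u) ^ 16 ≤ C' * Real.exp (-(c' * korobovExponent u)) := by
  have hv : 0 < Real.log a := Real.log_pos ha
  set B := Real.log a ^ ((1 : ℝ) / 5) with hB
  have hB0 : 0 < B := by positivity
  set c₁ := min c (B / 64) with hc₁
  have hc1 : 0 < c₁ := lt_min hc (by positivity)
  obtain ⟨D, hD0, hD⟩ := exists_pow_mul_exp_neg_rpow_le hc1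
  refine ⟨c₁, hc1, (C + 1) ^ 2 * D, by positivity, fun u hu => ?_⟩
  have hu1 : 1 < u := ha.trans_le hu
  have hu0 : 0 < u := by linarith
  set L := korobovExponent u with hL
  have hL0 : 0 < L := korobovExponent_pos hu1
  have hLu : L * B ≤ u := (le_div_iff₀ hB0).mp (korobovExponent_le ha hu)
  have h1 : Real.exp (-(c * L)) ≤ Real.exp (-(c₁ * L)) := by
    gcongr
    exact min_le_left _ _
  have h2 : Real.exp (-(u / 64)) ≤ Real.exp (-(c₁ * L)) := by
    refine Real.exp_le_exp.mpr (neg_le_neg ?_)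
    calc c₁ * L ≤ B / 64 * L := by
          gcongr
          exact min_le_right _ _
      _ ≤ u / 64 := by linarith
  have h3 : C * Real.exp (-(c * L)) + (1 + u) * Real.exp (-(u / 64)) ≤
      (C + 1) * (1 + u) * Real.exp (-(c₁ * L)) := by
    calc _ ≤ C * Real.exp (-(c₁ * L)) + (1 + u) * Real.exp (-(c₁ * L)) := by gcongr
      _ = (C + (1 + u)) * Real.exp (-(c₁ * L)) := by ring
      _ ≤ _ := by
        gcongr
        nlinarith
  have h4 : Real.exp (-(c₁ * L)) ≤ Real.exp (-(c₁ * u ^ ((2 : ℝ) / 5))) := by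
    gcongr
    exact rpow_two_fifths_le_korobovExponent hu1
  calc _ ≤ ((C + 1) * (1 + u) * Real.exp (-(c₁ * L))) ^ 2 * (1 + u) ^ 16 := by gcongr
    _ = (C + 1) ^ 2 * ((1 + u) ^ 18 * Real.exp (-(c₁ * L))) * Real.exp (-(c₁ * L)) := by ring
    _ ≤ (C + 1) ^ 2 * ((1 + u) ^ 18 * Real.exp (-(c₁ * u ^ ((2 : ℝ) / 5)))) *
        Real.exp (-(c₁ * L)) := by gcongr
    _ ≤ _ := by
      gcongr
      exact hD u hu1.le

lemma div_psi_sq_mul_sq_le {δ : ℕ} {V K A S T : ℝ} (hT : T ≤ K * A * 4 ^ δ.primeFactors.card)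
    (hV : 0 ≤ V) (hT0 : 0 ≤ T)
    (hS : |S| ≤ |(ArithmeticFunction.moebius δ : ℝ)| * (V * T)) :
    (δ : ℝ) / (psi δ : ℝ) ^ 2 * S ^ 2 ≤
      (V * K * A) ^ 2 * ((16 : ℕ) ^ δ.primeFactors.card / δ) := by
  by_cases hsq : Squarefree δ
  · have h1 : |(ArithmeticFunction.moebius δ : ℝ)| ≤ 1 := by
      exact_mod_cast ArithmeticFunction.abs_moebius_le_one
    have h2 : |S| ≤ V * (K * A * 4 ^ δ.primeFactors.card) :=
      hS.trans ((mul_le_of_le_one_left (by positivity) h1).trans (by gcongr))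
    calc _ = (δ : ℝ) / (psi δ : ℝ) ^ 2 * |S| ^ 2 := by rw [sq_abs]
      _ ≤ 1 / δ * (V * (K * A * 4 ^ δ.primeFactors.card)) ^ 2 := by
        exact mul_le_mul (div_psi_sq_le hsq) (pow_le_pow_left₀ (abs_nonneg _) h2 2)
          (sq_nonneg _) (by positivity)
      _ = _ := by
        rw [show ((16 : ℕ) : ℝ) = 4 ^ 2 by norm_num, ← pow_mul, mul_comm 2, pow_mul]
        ring
  · rw [ArithmeticFunction.moebius_eq_zero_of_not_squarefree hsq] at hS
    have : S = 0 := by simpa using hS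
    rw [this, zero_pow two_ne_zero, mul_zero]
    positivity

theorem stmt12 :
    ∃ c > (0 : ℝ), ∃ C > (0 : ℝ), ∀ m : ℕ, 1 ≤ m → ∀ y : ℝ, 3 ≤ y →
      (1 / (psi m : ℝ)) *
          ∑ δ ∈ (Finset.Icc 1 ⌊y ^ ((3 : ℝ) / 4)⌋₊).filter (fun δ : ℕ => Nat.gcd δ m = 1),
            ((δ : ℝ) / (psi δ : ℝ) ^ 2) *
              (∑ d ∈ Finset.Icc 1 ⌊y / (δ : ℝ)⌋₊,
                (ArithmeticFunction.moebius (d * δ) : ℝ) / (psiM m d : ℝ)) ^ 2 ≤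
        C / (Real.sqrt (psi m) * (curlyL y) ^ c) := by
  obtain ⟨c, hc, C, hC, hM⟩ := exists_abs_moebiusHarmonic_le_exp
  obtain ⟨K, hK0, hK⟩ := exists_sum_prod_abs_one_sub_localWeight_le
  obtain ⟨C₂, hC2, hψ⟩ := exists_prod_sq_div_psi_le
  have hlog3 : 1 < Real.log 3 := (Real.lt_log_iff_exp_lt (by norm_num)).mpr Real.exp_one_lt_three
  obtain ⟨c', hc', C', hC', hE⟩ := exists_sq_mul_pow_le_exp_korobovExponent hlog3 hc hC
  refine ⟨c', hc', C₂ * K ^ 2 * C', by positivity, fun m hm y hy => ?_⟩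
  have hy0 : 0 < y := by linarith
  set u := Real.log y with hu
  have hu1 : Real.log 3 ≤ u := Real.log_le_log (by norm_num) hy
  set V := C * Real.exp (-(c * korobovExponent u)) + (1 + u) * Real.exp (-(u / 64)) with hV
  have hV0 : 0 ≤ V := by
    have : 0 ≤ 1 + u := by linarith
    positivity
  set A := ∏ p ∈ m.primeFactors, (1 + 3 * (p : ℝ) ^ ((1 : ℝ) / 8)) with hA
  set N := ⌊y ^ ((3 : ℝ) / 4)⌋₊ with hN
  have hNy : (N : ℝ) ≤ y ^ ((3 : ℝ) / 4) := Nat.floor_le (by positivity)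
  have hyy : y ^ ((3 : ℝ) / 4) ≤ y := by
    conv_rhs => rw [← Real.rpow_one y]
    exact Real.rpow_le_rpow_of_exponent_le (by linarith) (by norm_num)
  have hlogN : Real.log N ≤ u := by
    rcases Nat.eq_zero_or_pos N with h | h
    · rw [h, Nat.cast_zero, Real.log_zero]
      linarith
    · exact Real.log_le_log (by exact_mod_cast h) (hNy.trans hyy)
  have hterm : ∀ δ ∈ (Icc 1 N).filter (fun δ : ℕ => Nat.gcd δ m = 1),
      ((δ : ℝ) / (psi δ : ℝ) ^ 2) * (∑ d ∈ Icc 1 ⌊y / (δ : ℝ)⌋₊,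
        (ArithmeticFunction.moebius (d * δ) : ℝ) / (psiM m d : ℝ)) ^ 2 ≤
      (V * K * A) ^ 2 * ((16 : ℕ) ^ δ.primeFactors.card / δ) := by
    intro δ hδ
    rw [mem_filter, mem_Icc] at hδ
    obtain ⟨⟨hδ1, hδN⟩, hδm⟩ := hδ
    have hδ1' : (1 : ℝ) ≤ δ := by exact_mod_cast hδ1
    have hδy : (δ : ℝ) ≤ y ^ ((3 : ℝ) / 4) := le_trans (by exact_mod_cast hδN) hNy
    have hz : y ^ ((1 : ℝ) / 4) ≤ y / δ := by
      rw [le_div_iff₀ (by linarith)]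
      calc _ ≤ y ^ ((1 : ℝ) / 4) * y ^ ((3 : ℝ) / 4) := by gcongr
        _ = y := by
          rw [← Real.rpow_add hy0]
          norm_num
    refine div_psi_sq_mul_sq_le (hK m δ ⌊y / (δ : ℝ)⌋₊ (by omega) (by omega)) hV0
      (sum_nonneg fun e _ => mul_nonneg (prod_nonneg fun p _ => abs_nonneg _) (by positivity))
      (abs_sum_moebius_mul_div_psiM_le hδm fun e he hez => ?_)
    exact abs_moebiusHarmonic_div_le (by linarith) hz (div_le_self hy0.le hδ1') (hM y hy) he hez
  have hsum : ∑ δ ∈ (Icc 1 N).filter (fun δ : ℕ => Nat.gcd δ m = 1),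
      ((δ : ℝ) / (psi δ : ℝ) ^ 2) * (∑ d ∈ Icc 1 ⌊y / (δ : ℝ)⌋₊,
        (ArithmeticFunction.moebius (d * δ) : ℝ) / (psiM m d : ℝ)) ^ 2 ≤
      (V * K * A) ^ 2 * (1 + u) ^ 16 := by
    refine (sum_le_sum hterm).trans ?_
    rw [← mul_sum]
    gcongr
    refine (sum_le_sum_of_subset_of_nonneg (filter_subset _ _) fun δ _ _ => by positivity).trans ?_
    refine (sum_pow_card_primeFactors_div_le 16 N).trans ?_
    have := Real.log_natCast_nonneg N
    gcongr
  have hL : curlyL y ^ c' = Real.exp (c' * korobovExponent u) := by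
    rw [curlyL, ← Real.exp_mul, mul_comm]
    rfl
  have hψm := hψ m
  calc _ ≤ 1 / (psi m : ℝ) * ((V * K * A) ^ 2 * (1 + u) ^ 16) := by gcongr
    _ = A ^ 2 / psi m * K ^ 2 * (V ^ 2 * (1 + u) ^ 16) := by ring
    _ ≤ C₂ / Real.sqrt (psi m) * K ^ 2 * (C' * Real.exp (-(c' * korobovExponent u))) := by
      have h0 : 0 ≤ V ^ 2 * (1 + u) ^ 16 := by positivity
      refine mul_le_mul ?_ (hE u hu1) h0 (by positivity)
      gcongr
    _ = _ := by
      rw [hL, Real.exp_neg, div_mul_eq_div_div]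
      ring
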